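/- Suppose f is a homeomorphism of the torus 𝕋² = ℝ²/ℤ² homotopic to the identity, with a lift F : ℝ² → ℝ² such that the rotation set ρ(F) is a non-degenerate line segment of rational slope (i.e. ρ(F) is contained in a line {p + λv : λ ∈ ℝ} with direction vector v ∈ ℤ² ∖ {0}) which contains no rational point (ρ(F) ∩ ℚ² = ∅). Then f has infinite perpendicular deviation: sup over x ∈ ℝ² and n ∈ ℕ of d(pr_⊥(n·ρ(F)), pr_⊥(Fⁿ(x) − x)) = +∞, where pr_⊥ is the orthogonal projection onto a unit vector perpendicular to v. -/

import Mathlib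

open Filter Metric Set

noncomputable section

abbrev R2 := ℝ × ℝ

/-- The rotation set of a lift F : ℝ² → ℝ² :
ρ(F) = { lim_i (F^{n_i}(x_i) − x_i)/n_i : x_i ∈ ℝ², n_i ↗ +∞ }. -/
def rotSet (F : R2 → R2) : Set R2 :=
  {w | ∃ (x : ℕ → R2) (n : ℕ → ℕ), StrictMono n ∧
    Tendsto (fun i => ((n i : ℝ))⁻¹ • (F^[n i] (x i) - x i)) atTop (nhds w)}

/-- Euclidean inner product on ℝ². -/
def dotp (a b : R2) : ℝ := a.1 * b.1 + a.2 * b.2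

namespace TorusRot

open Complex Topology

/-- Continuous logarithms exist on simply connected spaces. -/
theorem exists_continuous_log {X : Type*} [TopologicalSpace X] [SimplyConnectedSpace X]
    [LocallyPathConnectedSpace X] {g : X → ℂ} (hg : Continuous g) (h0 : ∀ x, g x ≠ 0) :
    ∃ f : X → ℂ, Continuous f ∧ ∀ x, exp (f x) = g x := by
  obtain ⟨x₀⟩ : Nonempty X := inferInstance
  obtain ⟨f, ⟨-, hf⟩, -⟩ := isCoveringMapOn_exp.existsUnique_continuousMap_lifts
    ⟨g, hg⟩ (a₀ := x₀) (exp_log (h0 x₀)) h0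
  exact ⟨f, f.continuous, fun x => congrFun hf x⟩

theorem two_pi_I_mul_int_inj {m n : ℤ} (h : 2 * Real.pi * I * (m : ℂ) = 2 * Real.pi * I * (n : ℂ)) :
    m = n := by
  have h2 : (2 * Real.pi * I : ℂ) ≠ 0 := two_pi_I_ne_zero
  exact_mod_cast mul_left_cancel₀ h2 h

/-- Two continuous logarithms of the same function on a preconnected set differ by a constant. -/
theorem log_unique {X : Type*} [TopologicalSpace X] {S : Set X} (hS : IsPreconnected S)
    {f g : X → ℂ} (hf : ContinuousOn f S) (hg : ContinuousOn g S)
    (h : ∀ x ∈ S, exp (f x) = exp (g x)) :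
    ∃ n : ℤ, ∀ x ∈ S, f x = g x + 2 * Real.pi * I * n := by
  have h1 : ∀ x ∈ S, ∃ n : ℤ, f x = g x + 2 * Real.pi * I * n := by
    intro x hx
    obtain ⟨n, hn⟩ := Complex.exp_eq_exp_iff_exists_int.1 (h x hx)
    exact ⟨n, by rw [hn]; ring⟩
  rcases S.eq_empty_or_nonempty with rfl | ⟨x0, hx0⟩
  · exact ⟨0, by simp⟩
  obtain ⟨n0, hn0⟩ := h1 x0 hx0
  refine ⟨n0, fun x hx => ?_⟩
  have hcont : ContinuousOn (fun x => ((f x - g x) / (2 * Real.pi * I)).re) S :=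
    Complex.continuous_re.comp_continuousOn ((hf.sub hg).div_const _)
  have hval : ∀ x ∈ S, ∀ n : ℤ, f x = g x + 2 * Real.pi * I * n →
      ((f x - g x) / (2 * Real.pi * I)).re = n := by
    intro x hx n hn
    have : (f x - g x) / (2 * Real.pi * I) = n := by
      rw [hn, add_sub_cancel_left, mul_div_cancel_left₀ _ two_pi_I_ne_zero]
    rw [this]; simp
  have hT : ∀ y ∈ S, ((f y - g y) / (2 * Real.pi * I)).re ∈ Set.range ((↑) : ℤ → ℝ) := by
    intro y hy
    obtain ⟨n, hn⟩ := h1 y hy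
    exact ⟨n, (hval y hy n hn).symm⟩
  have hdisc : IsDiscrete (Set.range ((↑) : ℤ → ℝ)) := by
    have := Int.isClosedEmbedding_coe_real.isEmbedding
    exact this.isDiscrete_range
  have := hS.constant_of_mapsTo hdisc hcont hT hx hx0
  obtain ⟨n, hn⟩ := h1 x hx
  rw [hval x hx n hn, hval x0 hx0 n0 hn0] at this
  rw [hn]
  have : n = n0 := by exact_mod_cast this
  rw [this]


theorem log_unique_univ {X : Type*} [TopologicalSpace X] [PreconnectedSpace X]
    {f g : X → ℂ} (hf : Continuous f) (hg : Continuous g) (h : ∀ x, exp (f x) = exp (g x)) :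
    ∃ n : ℤ, ∀ x, f x = g x + 2 * Real.pi * I * n := by
  obtain ⟨n, hn⟩ := log_unique isPreconnected_univ hf.continuousOn hg.continuousOn
    (fun x _ => h x)
  exact ⟨n, fun x => hn x trivial⟩

/-- A quasi-periodic path all of whose chords in the lattice `2πiℤ` are multiples of its own
period has period at most one: the case of a path defined on the whole line. -/
theorem period_lt_two_of_chords {γ : ℝ → ℂ} (hγ : Continuous γ) {m : ℤ}
    (hper : ∀ t, γ (t + 1) = γ t + 2 * Real.pi * I * m)
    (hch : ∀ s t : ℝ, ∀ e : ℤ, γ s - γ t = 2 * Real.pi * I * e → m ∣ e) : m < 2 := by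
  by_contra! hm
  set φ : ℝ × ℝ → ℂ := fun x => γ (x.1 + x.2) - γ x.1 - 2 * Real.pi * I with hφ
  have hφc : Continuous φ := by fun_prop
  have hφ0 : ∀ x, φ x ≠ 0 := by
    intro x hx
    have h1 := hch (x.1 + x.2) x.1 1 (by
      have : γ (x.1 + x.2) - γ x.1 - 2 * Real.pi * I = 0 := hx
      rw [sub_eq_zero.1 this]; simp)
    have := Int.le_of_dvd one_pos h1
    omega
  obtain ⟨l, hlc, hl⟩ := exists_continuous_log hφc hφ0
  -- the two edges
  have hedge : ∀ c : ℝ, (∀ t, φ (t, c) = φ (0, c)) → ∀ t, l (t, c) = l (0, c) := by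
    intro c hc t
    obtain ⟨n, hn⟩ := log_unique_univ (f := fun t : ℝ => l (t, c)) (g := fun _ => l (0, c))
      (by fun_prop) (by fun_prop) (fun t => by rw [hl, hl, hc])
    have h0 := hn 0
    have : (2 * Real.pi * I * n : ℂ) = 0 := by simpa using h0
    rw [hn t, this, add_zero]
  have e0 : ∀ t, φ (t, 0) = -(2 * Real.pi * I) := by intro t; simp [hφ]
  have e1 : ∀ t, φ (t, 1) = 2 * Real.pi * I * (m - 1) := by
    intro t; simp only [hφ, hper]; ring
  have k0 := hedge 0 (fun t => by rw [e0, e0])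
  have k1 := hedge 1 (fun t => by rw [e1, e1])
  -- extremal parameters
  have hre : ∀ t, (γ (t + 1)).re = (γ t).re := by
    intro t; rw [hper]; simp
  have hP : Function.Periodic (fun t => (γ t).re) 1 := hre
  have hcr : Continuous (fun t => (γ t).re) := by fun_prop
  obtain ⟨tM, -, htM⟩ := (isCompact_Icc (a := (0:ℝ)) (b := 1)).exists_isMaxOn
    ⟨0, by simp⟩ hcr.continuousOn
  obtain ⟨tm, -, htm⟩ := (isCompact_Icc (a := (0:ℝ)) (b := 1)).exists_isMinOn
    ⟨0, by simp⟩ hcr.continuousOn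
  have hfr : ∀ t, ∃ s ∈ Icc (0:ℝ) 1, (γ t).re = (γ s).re := by
    intro t
    obtain ⟨s, hs, hs2⟩ := hP.exists_mem_Ico₀ one_pos t
    exact ⟨s, ⟨hs.1, hs.2.le⟩, hs2⟩
  have hM : ∀ t, (γ t).re ≤ (γ tM).re := by
    intro t
    obtain ⟨s, hs, hs2⟩ := hfr t
    rw [hs2]; exact htM hs
  have hmi : ∀ t, (γ tm).re ≤ (γ t).re := by
    intro t
    obtain ⟨s, hs, hs2⟩ := hfr t
    rw [hs2]; exact htm hs
  -- comparison with the principal logarithm of `±φ`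
  have key : ∀ (t : ℝ) (ε : ℂ), ε ≠ 0 → (∀ v, 0 ≤ (ε * φ (t, v)).re) →
      l (t, 1) - l (t, 0) = log (ε * φ (t, 1)) - log (ε * φ (t, 0)) := by
    intro t ε hε h
    obtain ⟨n, hn⟩ := log_unique_univ (f := fun v : ℝ => l (t, v) + log ε)
      (g := fun v => log (ε * φ (t, v))) (by fun_prop) (by
        rw [continuous_iff_continuousAt]
        intro v
        refine ContinuousAt.clog (by fun_prop) ?_
        have hne : ε * φ (t, v) ≠ 0 := mul_ne_zero hε (hφ0 _)
        rw [mem_slitPlane_iff]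
        rcases (h v).lt_or_eq with h1 | h1
        · exact Or.inl h1
        · right
          intro h2
          exact hne (Complex.ext h1.symm h2)) (fun v => by
        rw [exp_add, hl, exp_log hε, exp_log (mul_ne_zero hε (hφ0 _))]; ring)
    have a := hn 1
    have b := hn 0
    linear_combination a - b
  have hmr : (2:ℝ) ≤ m := by exact_mod_cast hm
  have logpos : ∀ r : ℝ, 0 < r → (log (2 * Real.pi * I * r)).im = Real.pi / 2 := by
    intro r hr
    have : (2 * Real.pi * I * r : ℂ) = ((2 * Real.pi * r : ℝ) : ℂ) * I := by push_cast; ring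
    rw [log_im, this, arg_real_mul _ (by positivity), arg_I]
  have logneg : ∀ r : ℝ, 0 < r → (log (-(2 * Real.pi * I * r))).im = -(Real.pi / 2) := by
    intro r hr
    have : (-(2 * Real.pi * I * r) : ℂ) = ((2 * Real.pi * r : ℝ) : ℂ) * (-I) := by push_cast; ring
    rw [log_im, this, arg_real_mul _ (by positivity), arg_neg_I]
  have A := key tM (-1) (by norm_num) (fun v => by
    have := hM (tM + v)
    simp [hφ]; linarith)
  have B := key tm 1 (by norm_num) (fun v => by
    have := hmi (tm + v)
    simp [hφ]; linarith)
  rw [k0, k1] at A B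
  rw [A] at B
  simp only [e0, e1, one_mul, neg_mul, neg_neg] at B
  have B2 := congrArg Complex.im B
  have c1 : (m : ℂ) - 1 = ((m - 1 : ℝ) : ℂ) := by push_cast; ring
  have q1 := logneg 1 one_pos
  have q2 := logpos 1 one_pos
  simp only [ofReal_one, mul_one] at q1 q2
  rw [c1, sub_im, sub_im, logneg _ (by linarith), logpos _ (by linarith), q1, q2] at B2
  linarith [Real.pi_pos]

/-- A quasi-periodic path on `[0,1]` all of whose chords in `2πiℤ` are multiples of `m`, where
`m` is its own period, satisfies `|m| ≤ 1`. -/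
theorem abs_period_le_one_of_chords {γ : ℝ → ℂ} (hγ : ContinuousOn γ (Icc 0 1)) {m : ℤ}
    (hper : γ 1 = γ 0 + 2 * Real.pi * I * m)
    (hch : ∀ s ∈ Icc (0:ℝ) 1, ∀ t ∈ Icc (0:ℝ) 1, ∀ e : ℤ,
      γ s - γ t = 2 * Real.pi * I * e → m ∣ e) : |m| ≤ 1 := by
  set g : ℝ → ℂ := fun t => γ t - 2 * Real.pi * I * m * t with hg
  have hgc : Continuous (g ∘ Int.fract) := by
    refine ContinuousOn.comp_fract'' (hγ.sub (by fun_prop)) ?_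
    simp [hg, hper]
  set Γ : ℝ → ℂ := fun t => (g ∘ Int.fract) t + 2 * Real.pi * I * m * t with hΓ
  have hΓc : Continuous Γ := hgc.add (by fun_prop)
  have hΓper : ∀ t, Γ (t + 1) = Γ t + 2 * Real.pi * I * m := by
    intro t; simp [hΓ]; ring
  have hΓγ : ∀ t, Γ t = γ (Int.fract t) + 2 * Real.pi * I * (m * ⌊t⌋ : ℤ) := by
    intro t
    have : ((Int.fract t : ℝ) : ℂ) = t - ⌊t⌋ := by
      rw [← Int.self_sub_floor]; push_cast; ring
    simp only [hΓ, hg, Function.comp, this]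
    push_cast; ring
  have hΓch : ∀ s t : ℝ, ∀ e : ℤ, Γ s - Γ t = 2 * Real.pi * I * e → m ∣ e := by
    intro s t e h
    have := hch (Int.fract s) ⟨Int.fract_nonneg s, (Int.fract_lt_one s).le⟩ (Int.fract t)
      ⟨Int.fract_nonneg t, (Int.fract_lt_one t).le⟩ (e - m * ⌊s⌋ + m * ⌊t⌋) (by
        rw [hΓγ, hΓγ] at h
        push_cast at h ⊢
        linear_combination h)
    have h2 : m ∣ (e - m * ⌊s⌋ + m * ⌊t⌋) + m * (⌊s⌋ - ⌊t⌋) := dvd_add this ⟨_, rfl⟩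
    convert h2 using 1; ring
  have h1 := period_lt_two_of_chords hΓc hΓper hΓch
  have h2 := period_lt_two_of_chords (γ := fun t => -Γ t) (m := -m) hΓc.neg
    (fun t => by rw [hΓper]; push_cast; ring) (fun s t e h => by
      have := hΓch s t (-e) (by push_cast; linear_combination -h)
      simpa using this)
  rw [abs_le]; omega

/-- The function `q ↦ exp (2πi q / p)`, uniformizing the cylinder `ℂ / pℤ`. -/
def ee (p : ℕ) (q : ℂ) : ℂ := exp (2 * Real.pi * I * q / p)

/-- A function of `q` whose zeros are the points of `z + pℤ`. -/
def EE (p : ℕ) (q z : ℂ) : ℂ := 1 - ee p (q - z)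

theorem continuous_ee (p : ℕ) : Continuous (ee p) := by unfold ee; fun_prop

theorem ee_ne_zero (p : ℕ) (q : ℂ) : ee p q ≠ 0 := exp_ne_zero _

theorem ee_zero (p : ℕ) : ee p 0 = 1 := by simp [ee]

theorem ee_add (p : ℕ) (a b : ℂ) : ee p (a + b) = ee p a * ee p b := by
  simp only [ee, ← exp_add]; congr 1; ring

theorem ee_sub (p : ℕ) (a b : ℂ) : ee p (a - b) = ee p a / ee p b := by
  simp only [ee, ← exp_sub]; congr 1; ring

theorem ee_neg (p : ℕ) (a : ℂ) : ee p (-a) = (ee p a)⁻¹ := by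
  simp only [ee, ← exp_neg]; congr 1; ring

theorem norm_ee (p : ℕ) (q : ℂ) : ‖ee p q‖ = Real.exp (-(2 * Real.pi * q.im / p)) := by
  have : (2 * Real.pi * I * q / p : ℂ).re = -(2 * Real.pi * q.im / p) := by
    have : (2 * Real.pi * I * q / p : ℂ) = ((2 * Real.pi / p : ℝ) : ℂ) * (I * q) := by
      push_cast; ring
    rw [this, re_ofReal_mul]; simp; ring
  rw [ee, norm_exp, this]

theorem ee_eq_iff {p : ℕ} (hp : p ≠ 0) {a b : ℂ} :
    ee p a = ee p b ↔ ∃ k : ℤ, a = b + k * p := by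
  have hp' : (p : ℂ) ≠ 0 := by exact_mod_cast hp
  have h2 : (2 * Real.pi * I : ℂ) ≠ 0 := two_pi_I_ne_zero
  rw [ee, ee, exp_eq_exp_iff_exists_int]
  refine exists_congr fun k => ?_
  constructor
  · intro h
    have h3 : 2 * Real.pi * I * a = 2 * Real.pi * I * (b + k * p) := by
      field_simp at h ⊢
      linear_combination h
    exact mul_left_cancel₀ h2 h3
  · rintro rfl
    field_simp

theorem ee_eq_one_iff {p : ℕ} (hp : p ≠ 0) {a : ℂ} : ee p a = 1 ↔ ∃ k : ℤ, a = k * p := by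
  rw [← ee_zero p, ee_eq_iff hp]; simp

theorem ee_add_int_mul {p : ℕ} (hp : p ≠ 0) (a : ℂ) (k : ℤ) : ee p (a + k * p) = ee p a :=
  (ee_eq_iff hp).2 ⟨k, rfl⟩

theorem EE_eq_zero_iff {p : ℕ} (hp : p ≠ 0) {q z : ℂ} : EE p q z = 0 ↔ ∃ k : ℤ, q - z = k * p := by
  rw [EE, sub_eq_zero, eq_comm, ee_eq_one_iff hp]

theorem EE_add_int_mul {p : ℕ} (hp : p ≠ 0) (q z : ℂ) (k : ℤ) : EE p (q + k * p) z = EE p q z := by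
  rw [EE, EE, ← ee_add_int_mul hp (q - z) k]; congr 2; ring

theorem tendsto_ee_bot {p : ℕ} (hp : p ≠ 0) (z : ℂ) :
    Tendsto (fun q => ee p (z - q)) (comap im atBot) (𝓝 0) := by
  rw [tendsto_zero_iff_norm_tendsto_zero]
  simp only [norm_ee, sub_im]
  have hp' : (0:ℝ) < p := by positivity
  have h1 : Tendsto (fun q : ℂ => -(2 * Real.pi * (z.im - q.im) / p)) (comap im atBot) atBot := by
    have h2 : Tendsto (fun y : ℝ => (2 * Real.pi / p) * y + -(2 * Real.pi * z.im / p)) atBot atBot :=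
      tendsto_atBot_add_const_right _ _ (tendsto_id.const_mul_atBot (by positivity))
    refine (h2.comp (tendsto_comap (f := im))).congr fun q => ?_
    simp only [Function.comp]; ring
  exact Real.tendsto_exp_atBot.comp h1

theorem tendsto_ee_top {p : ℕ} (hp : p ≠ 0) (z : ℂ) :
    Tendsto (fun q => ee p (q - z)) (comap im atTop) (𝓝 0) := by
  rw [tendsto_zero_iff_norm_tendsto_zero]
  simp only [norm_ee, sub_im]
  have hp' : (0:ℝ) < p := by positivity
  have h1 : Tendsto (fun q : ℂ => -(2 * Real.pi * (q.im - z.im) / p)) (comap im atTop) atBot := by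
    have h2 : Tendsto (fun y : ℝ => (-(2 * Real.pi / p)) * y + (2 * Real.pi * z.im / p)) atTop
        atBot :=
      tendsto_atBot_add_const_right _ _
        (tendsto_id.const_mul_atTop_of_neg (neg_neg_of_pos (by positivity)))
    refine (h2.comp (tendsto_comap (f := im))).congr fun q => ?_
    simp only [Function.comp]; ring
  exact Real.tendsto_exp_atBot.comp h1

/-- `G` is a continuous logarithm of `EE p · z / EE p · w` on `A`, normalized at both ends of the
cylinder. -/
structure IsLog (p : ℕ) (A : Set ℂ) (z w : ℂ) (G : ℂ → ℂ) : Prop where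
  cont : ContinuousOn G A
  exp_eq : ∀ q ∈ A, exp (G q) * EE p q w = EE p q z
  bot : Tendsto G (comap im atBot ⊓ 𝓟 A) (𝓝 (2 * Real.pi * I * (w - z) / p))
  top : Tendsto G (comap im atTop ⊓ 𝓟 A) (𝓝 0)

namespace IsLog

variable {p : ℕ} {A B : Set ℂ} {z w x : ℂ} {G G' : ℂ → ℂ}

theorem mono (h : IsLog p A z w G) (hB : B ⊆ A) : IsLog p B z w G where
  cont := h.cont.mono hB
  exp_eq q hq := h.exp_eq q (hB hq)
  bot := h.bot.mono_left (inf_le_inf_left _ (principal_mono.2 hB))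
  top := h.top.mono_left (inf_le_inf_left _ (principal_mono.2 hB))

theorem trans (h : IsLog p A z w G) (h' : IsLog p A w x G') : IsLog p A z x (fun q => G q + G' q) where
  cont := h.cont.add h'.cont
  exp_eq q hq := by
    rw [exp_add, mul_assoc, h'.exp_eq q hq, h.exp_eq q hq]
  bot := by
    have := h.bot.add h'.bot
    convert this using 2; ring
  top := by
    have := h.top.add h'.top
    simpa using this

theorem symm (h : IsLog p A z w G) : IsLog p A w z (fun q => -G q) where
  cont := h.cont.neg
  exp_eq q hq := by
    rw [← h.exp_eq q hq, exp_neg, ← mul_assoc, inv_mul_cancel₀ (exp_ne_zero _),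
      one_mul]
  bot := by
    have := h.bot.neg
    convert this using 2; ring
  top := by
    have := h.top.neg
    simpa using this

theorem unique (hA : IsPreconnected A) (h0 : ∀ q ∈ A, EE p q w ≠ 0)
    (h : IsLog p A z w G) (h' : IsLog p A z w G')
    (hne : (comap im atBot ⊓ 𝓟 A).NeBot ∨ (comap im atTop ⊓ 𝓟 A).NeBot) : EqOn G G' A := by
  obtain ⟨n, hn⟩ := log_unique hA h.cont h'.cont (fun q hq => by
    have := (h.exp_eq q hq).trans (h'.exp_eq q hq).symm
    exact mul_right_cancel₀ (h0 q hq) this)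
  have aux : ∀ (l : Filter ℂ) (c : ℂ), (l ⊓ 𝓟 A).NeBot → Tendsto G (l ⊓ 𝓟 A) (𝓝 c) →
      Tendsto G' (l ⊓ 𝓟 A) (𝓝 c) → (2 * Real.pi * I * n : ℂ) = 0 := by
    intro l c hl t1 t2
    have t3 : Tendsto G (l ⊓ 𝓟 A) (𝓝 (c + 2 * Real.pi * I * n)) := by
      refine (t2.add_const (2 * Real.pi * I * n : ℂ)).congr' ?_
      filter_upwards [mem_inf_of_right (mem_principal_self A)] with q hq using (hn q hq).symm
    have := tendsto_nhds_unique t1 t3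
    simpa using this
  have : (2 * Real.pi * I * n : ℂ) = 0 := by
    rcases hne with hne | hne
    · exact aux _ _ hne h.bot h'.bot
    · exact aux _ _ hne h.top h'.top
  intro q hq
  rw [hn q hq, this, add_zero]

end IsLog

/-- Points close to `1` on the circle bundle come from points close to the lattice. -/
theorem exists_lower_bound_ee_sub_one {p : ℕ} (hp : p ≠ 0) {η : ℝ} (hη : 0 < η) :
    ∃ c > 0, ∀ u : ℂ, (∀ k : ℤ, η ≤ ‖u - k * p‖) → c ≤ ‖ee p u - 1‖ := by
  have hp' : (0:ℝ) < p := by positivity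
  have hpc : (p : ℂ) ≠ 0 := by exact_mod_cast hp
  have hc : ContinuousAt log 1 := continuousAt_clog (by simp)
  have hev : ∀ᶠ s in 𝓝 (1:ℂ), ‖log s‖ < 2 * Real.pi * η / p := by
    have := hc.norm.tendsto
    simp only [log_one, norm_zero] at this
    exact this.eventually (gt_mem_nhds (by positivity))
  obtain ⟨c, hc0, hc1⟩ := Metric.eventually_nhds_iff.1 hev
  refine ⟨c, hc0, fun u hu => ?_⟩
  by_contra! hlt
  have h1 := hc1 (y := ee p u) (by rwa [dist_eq_norm])
  have h2 : exp (log (ee p u)) = exp (2 * Real.pi * I * u / p) := exp_log (ee_ne_zero _ _)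
  obtain ⟨k, hk⟩ := exp_eq_exp_iff_exists_int.1 h2.symm
  have h2 : (2 * Real.pi * I : ℂ) ≠ 0 := two_pi_I_ne_zero
  have h3 : 2 * Real.pi * I * (u - k * p) = p * log (ee p u) := by
    field_simp at hk
    linear_combination hk
  have h4 := congrArg norm h3
  simp only [norm_mul, norm_I, Complex.norm_natCast, mul_one, Complex.norm_real, Real.norm_eq_abs,
    abs_of_pos Real.pi_pos] at h4
  have h5 := hu k
  have h6 : (p:ℝ) * ‖log (ee p u)‖ < 2 * Real.pi * η := by
    rw [lt_div_iff₀ hp'] at h1; linarith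
  rw [← h4] at h6
  have h7 : ‖(2:ℂ)‖ = 2 := by simp
  rw [h7] at h6
  have := mul_le_mul_of_nonneg_left h5 (by positivity : (0:ℝ) ≤ 2 * Real.pi)
  linarith

theorem eventually_isLog {p : ℕ} (hp : p ≠ 0) {A : Set ℂ} (hA : IsClosed A)
    (hinv : ∀ q ∈ A, ∀ k : ℤ, q + k ∈ A) {z₀ : ℂ} (hz₀ : z₀ ∉ A) :
    ∀ᶠ z in 𝓝 z₀, ∃ G, IsLog p A z z₀ G ∧ ∀ q ∈ A, |(G q).im| ≤ Real.pi := by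
  have hp' : (0:ℝ) < p := by positivity
  obtain ⟨η, hη, hball⟩ := Metric.isOpen_iff.1 hA.isOpen_compl z₀ hz₀
  obtain ⟨c, hc, hlow⟩ := exists_lower_bound_ee_sub_one hp hη
  have hlowA : ∀ q ∈ A, c ≤ ‖ee p (z₀ - q) - 1‖ := by
    intro q hq
    refine hlow _ fun k => ?_
    by_contra! h
    have h1 : q + ((k * p : ℤ) : ℂ) ∈ A := hinv q hq _
    refine hball ?_ h1
    rw [mem_ball, dist_comm, dist_eq_norm]
    have h2 : z₀ - (q + ((k * p : ℤ) : ℂ)) = z₀ - q - k * p := by push_cast; ring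
    rwa [h2]
  have e1 : ∀ᶠ z in 𝓝 z₀, ‖1 - ee p (z₀ - z)‖ < c := by
    have : ContinuousAt (fun z => ‖1 - ee p (z₀ - z)‖) z₀ := by
      have := continuous_ee p
      fun_prop
    refine this.tendsto.eventually (gt_mem_nhds ?_)
    simpa [ee_zero] using hc
  have e2 : ∀ᶠ z in 𝓝 z₀, ‖2 * Real.pi * I * (z₀ - z) / p‖ < Real.pi := by
    have : ContinuousAt (fun z => ‖2 * Real.pi * I * (z₀ - z) / p‖) z₀ := by
      fun_prop
    refine this.tendsto.eventually (gt_mem_nhds ?_)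
    simpa using Real.pi_pos
  filter_upwards [e1, e2] with z h1 h2
  set a := ee p (z₀ - z) with ha
  set r : ℂ → ℂ := fun q => 1 + (1 - a) / (ee p (z₀ - q) - 1) with hr
  have hne : ∀ q ∈ A, ee p (z₀ - q) - 1 ≠ 0 := by
    intro q hq h
    have := hlowA q hq
    rw [h, norm_zero] at this; linarith
  have hslit : ∀ q ∈ A, r q ∈ slitPlane := by
    intro q hq
    refine mem_slitPlane_of_norm_lt_one ?_
    rw [norm_div, div_lt_one (by linarith [hlowA q hq])]
    linarith [hlowA q hq]
  refine ⟨fun q => log (r q), ⟨?_, ?_, ?_, ?_⟩, fun q _ => ?_⟩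
  · refine ContinuousOn.clog ?_ hslit
    have := continuous_ee p
    refine continuousOn_const.add (continuousOn_const.div (by fun_prop) hne)
  · intro q hq
    rw [exp_log (slitPlane_ne_zero (hslit q hq))]
    have hq0 := hne q hq
    simp only [hr]
    have e1 : EE p q z₀ = (ee p (z₀ - q) - 1) / ee p (z₀ - q) := by
      rw [EE, ← neg_sub z₀ q, ee_neg]; field_simp [ee_ne_zero]
    have e2 : EE p q z = (ee p (z₀ - q) - a) / ee p (z₀ - q) := by
      have : ee p (q - z) = a / ee p (z₀ - q) := by
        rw [ha, ← ee_sub]; congr 1; ring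
      rw [EE, this]; field_simp [ee_ne_zero]
    rw [e1, e2]
    have := ee_ne_zero p (z₀ - q)
    field_simp
    ring
  · have t1 : Tendsto r (comap im atBot) (𝓝 (1 + (1 - a) / (0 - 1))) :=
      tendsto_const_nhds.add (tendsto_const_nhds.div ((tendsto_ee_bot hp z₀).sub_const 1) (by simp))
    have h3 : (1 + (1 - a) / (0 - 1)) = a := by ring
    rw [h3] at t1
    have h4 : log a = 2 * Real.pi * I * (z₀ - z) / p := by
      rw [ha, ee, log_exp]
      · exact (abs_lt.1 ((abs_im_le_norm _).trans_lt h2)).1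
      · exact (abs_lt.1 ((abs_im_le_norm _).trans_lt h2)).2.le
    have h5 : a ∈ slitPlane := by
      have h6 : |(2 * Real.pi * I * (z₀ - z) / p).im| < Real.pi := (abs_im_le_norm _).trans_lt h2
      rw [mem_slitPlane_iff_arg]
      refine ⟨fun h => ?_, ee_ne_zero _ _⟩
      have := congrArg im h4
      rw [log_im, h] at this
      rw [← this, abs_of_pos Real.pi_pos] at h6
      exact lt_irrefl _ h6
    have := (t1.clog h5)
    rw [h4] at this
    exact this.mono_left inf_le_left
  · have t0 : Tendsto (fun q => (ee p (z₀ - q) - 1)) (comap im atTop) (Bornology.cobounded ℂ) := by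
      have h6 : Tendsto (fun q => (ee p (q - z₀))⁻¹) (comap im atTop) (Bornology.cobounded ℂ) := by
        refine tendsto_inv₀_nhdsNE_zero.comp (tendsto_nhdsWithin_iff.2 ⟨tendsto_ee_top hp z₀, ?_⟩)
        exact Eventually.of_forall fun q => ee_ne_zero _ _
      have h7 : ∀ q, (ee p (q - z₀))⁻¹ - 1 = ee p (z₀ - q) - 1 := by
        intro q; rw [← ee_neg, neg_sub]
      simp_rw [← h7]
      rw [← tendsto_norm_atTop_iff_cobounded] at h6 ⊢
      refine tendsto_atTop_mono (fun q => ?_) (tendsto_atTop_add_const_right _ (-1) h6)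
      have := norm_sub_norm_le (ee p (q - z₀))⁻¹ 1
      simp at this ⊢
      linarith
    have t1 : Tendsto r (comap im atTop) (𝓝 (1 + (1 - a) * 0)) := by
      refine tendsto_const_nhds.add ?_
      simp_rw [div_eq_mul_inv]
      exact (tendsto_inv₀_cobounded.comp t0).const_mul _
    rw [mul_zero, add_zero] at t1
    have := t1.clog (by simp)
    rw [log_one] at this
    exact this.mono_left inf_le_left
  · rw [log_im]; exact abs_arg_le_pi _

theorem exists_isLog {p : ℕ} (hp : p ≠ 0) {A : Set ℂ} (hA : IsClosed A)
    (hinv : ∀ q ∈ A, ∀ k : ℤ, q + k ∈ A) {S : Set ℂ} (hS : IsPreconnected S) (hSA : S ⊆ Aᶜ)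
    {z w : ℂ} (hz : z ∈ S) (hw : w ∈ S) :
    ∃ G C, IsLog p A z w G ∧ ∀ q ∈ A, |(G q).im| ≤ C := by
  refine hS.induction₂' (P := fun z w => ∃ G C, IsLog p A z w G ∧ ∀ q ∈ A, |(G q).im| ≤ C)
    (fun x hx => ?_) ?_ hz hw
  · filter_upwards [nhdsWithin_le_nhds (eventually_isLog hp hA hinv (hSA hx))] with y hy
    obtain ⟨G, hG, hb⟩ := hy
    exact ⟨⟨fun q => -G q, Real.pi, hG.symm, fun q hq => by simpa using hb q hq⟩, ⟨G, Real.pi, hG, hb⟩⟩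
  · rintro x y z - - - ⟨G, C, h, hb⟩ ⟨G', C', h', hb'⟩
    exact ⟨fun q => G q + G' q, C + C', h.trans h', fun q hq => by
      rw [add_im]
      exact (abs_add_le _ _).trans (add_le_add (hb q hq) (hb' q hq))⟩

/-- A path connected set, invariant under integer translations, carrying a `p`-periodic
logarithm of `EE p · z / EE p · w`. -/
structure IsEnd (p : ℕ) (z w : ℂ) (X : Set ℂ) (G : ℂ → ℂ) : Prop where
  conn : IsPathConnected X
  inv : ∀ q ∈ X, ∀ k : ℤ, q + k ∈ X
  ne_zero : ∀ q ∈ X, EE p q w ≠ 0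
  cont : ContinuousOn G X
  exp_eq : ∀ q ∈ X, exp (G q) * EE p q w = EE p q z
  per : ∀ q ∈ X, ∀ k : ℤ, G (q + k * p) = G q

/-- An arc from `X` to `Y`, embedded modulo integer translations and avoiding the orbits of
`z` and `w`. -/
structure IsArc (z w : ℂ) (X Y : Set ℂ) (κ : ℝ → ℂ) : Prop where
  cont : ContinuousOn κ (Icc 0 1)
  left : κ 0 ∈ X
  right : κ 1 ∈ Y
  eq_zero : ∀ t ∈ Icc (0:ℝ) 1, κ t ∈ X → t = 0
  eq_one : ∀ t ∈ Icc (0:ℝ) 1, κ t ∈ Y → t = 1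
  inj : ∀ s ∈ Icc (0:ℝ) 1, ∀ t ∈ Icc (0:ℝ) 1, ∀ k : ℤ, κ s = κ t + k → s = t
  avoid_left : ∀ t ∈ Icc (0:ℝ) 1, ∀ k : ℤ, κ t - z ≠ k
  avoid_right : ∀ t ∈ Icc (0:ℝ) 1, ∀ k : ℤ, κ t - w ≠ k

/-- The degree of an arc, relative to logarithms `GX`, `GY` at its ends. -/
def IsDeg (p : ℕ) (z w : ℂ) (GX GY : ℂ → ℂ) (κ : ℝ → ℂ) (d : ℤ) : Prop :=
  ∃ l : ℝ → ℂ, ContinuousOn l (Icc 0 1) ∧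
    (∀ t ∈ Icc (0:ℝ) 1, exp (l t) * EE p (κ t) w = EE p (κ t) z) ∧
    l 0 = GX (κ 0) ∧ l 1 = GY (κ 1) + 2 * Real.pi * I * d

theorem EE_ne_zero_of_forall_ne {p : ℕ} (hp : p ≠ 0) {q z : ℂ} (h : ∀ k : ℤ, q - z ≠ k) :
    EE p q z ≠ 0 := by
  rw [Ne, EE_eq_zero_iff hp]
  rintro ⟨k, hk⟩
  exact h (k * p) (by rw [hk]; push_cast; ring)

theorem continuous_EE (p : ℕ) (z : ℂ) : Continuous fun q => EE p q z := by
  have := continuous_ee p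
  unfold EE; fun_prop

namespace IsArc

variable {z w : ℂ} {X Y : Set ℂ} {κ : ℝ → ℂ}

theorem shift (h : IsArc z w X Y κ) (hX : ∀ q ∈ X, ∀ k : ℤ, q + k ∈ X)
    (hY : ∀ q ∈ Y, ∀ k : ℤ, q + k ∈ Y) (j : ℤ) : IsArc z w X Y (fun t => κ t + j) where
  cont := h.cont.add continuousOn_const
  left := hX _ h.left j
  right := hY _ h.right j
  eq_zero t ht hm := h.eq_zero t ht (by simpa using hX _ hm (-j))
  eq_one t ht hm := h.eq_one t ht (by simpa using hY _ hm (-j))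
  inj s hs t ht k hk := h.inj s hs t ht k (by linear_combination hk)
  avoid_left t ht k hk := h.avoid_left t ht (k - j) (by push_cast; linear_combination hk)
  avoid_right t ht k hk := h.avoid_right t ht (k - j) (by push_cast; linear_combination hk)

theorem exists_isDeg (h : IsArc z w X Y κ) {p : ℕ} (hp : p ≠ 0) {GX GY : ℂ → ℂ}
    (hGX : exp (GX (κ 0)) * EE p (κ 0) w = EE p (κ 0) z)
    (hGY : exp (GY (κ 1)) * EE p (κ 1) w = EE p (κ 1) z) : ∃ d, IsDeg p z w GX GY κ d := by
  have hz : ∀ t ∈ Icc (0:ℝ) 1, EE p (κ t) z ≠ 0 := fun t ht =>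
    EE_ne_zero_of_forall_ne hp (h.avoid_left t ht)
  have hw : ∀ t ∈ Icc (0:ℝ) 1, EE p (κ t) w ≠ 0 := fun t ht =>
    EE_ne_zero_of_forall_ne hp (h.avoid_right t ht)
  set pr : ℝ → ℝ := fun t => projIcc (0:ℝ) 1 zero_le_one t with hpr
  have hprm : ∀ t, pr t ∈ Icc (0:ℝ) 1 := fun t => (projIcc (0:ℝ) 1 zero_le_one t).2
  have hκ : Continuous (κ ∘ pr) := by
    refine h.cont.comp_continuous ?_ hprm
    exact continuous_subtype_val.comp continuous_projIcc
  obtain ⟨l, hlc, hl⟩ := exists_continuous_log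
    (g := fun t => EE p (κ (pr t)) z / EE p (κ (pr t)) w)
    (((continuous_EE p z).comp hκ).div ((continuous_EE p w).comp hκ) (fun t => hw _ (hprm t)))
    (fun t => div_ne_zero (hz _ (hprm t)) (hw _ (hprm t)))
  have hl' : ∀ t ∈ Icc (0:ℝ) 1, exp (l t) * EE p (κ t) w = EE p (κ t) z := by
    intro t ht
    have hpt : pr t = t := by simp [hpr, projIcc_of_mem zero_le_one ht]
    rw [hl t, hpt, div_mul_cancel₀ _ (hw t ht)]
  have m0 : (0:ℝ) ∈ Icc (0:ℝ) 1 := by simp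
  have m1 : (1:ℝ) ∈ Icc (0:ℝ) 1 := by simp
  obtain ⟨a, ha⟩ := exp_eq_exp_iff_exists_int.1
    (mul_right_cancel₀ (hw 0 m0) ((hl' 0 m0).trans hGX.symm))
  obtain ⟨b, hb⟩ := exp_eq_exp_iff_exists_int.1
    (mul_right_cancel₀ (hw 1 m1) ((hl' 1 m1).trans hGY.symm))
  refine ⟨b - a, fun t => l t - a * (2 * Real.pi * I), by fun_prop, fun t ht => ?_, ?_, ?_⟩
  · rw [exp_sub, exp_int_mul_two_pi_mul_I, div_one, hl' t ht]
  · simp only [ha]; ring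
  · simp only [hb]; push_cast; ring

end IsArc

theorem IsDeg.unique {p : ℕ} {z w : ℂ} {GX GY : ℂ → ℂ} {κ : ℝ → ℂ} {d d' : ℤ}
    (hw : ∀ t ∈ Icc (0:ℝ) 1, EE p (κ t) w ≠ 0)
    (h : IsDeg p z w GX GY κ d) (h' : IsDeg p z w GX GY κ d') : d = d' := by
  obtain ⟨l, hl, he, h0, h1⟩ := h
  obtain ⟨l', hl', he', h0', h1'⟩ := h'
  obtain ⟨n, hn⟩ := log_unique isPreconnected_Icc hl hl' (fun t ht =>
    mul_right_cancel₀ (hw t ht) ((he t ht).trans (he' t ht).symm))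
  have a := hn 0 (by simp)
  have b := hn 1 (by simp)
  rw [h0, h0'] at a
  rw [h1, h1'] at b
  exact two_pi_I_mul_int_inj (by linear_combination b - a)

/-- The function `EE p · z / EE p · w` is injective on the cylinder. -/
theorem eq_add_of_div_eq {p : ℕ} (hp : p ≠ 0) {z w : ℂ} (hzw : ∀ k : ℤ, z - w ≠ k * p)
    {q q' c : ℂ} (h : c * EE p q w = EE p q z)
    (h' : c * EE p q' w = EE p q' z) : ∃ k : ℤ, q = q' + k * p := by
  rw [← ee_eq_iff hp]
  have h1 : EE p q z * EE p q' w = EE p q' z * EE p q w := by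
    rw [← h, ← h']; ring
  simp only [EE, ee_sub] at h1
  have hne : ee p z ≠ ee p w := by
    rw [Ne, ee_eq_iff hp]
    rintro ⟨k, hk⟩
    exact hzw k (by rw [hk]; ring)
  have hz := ee_ne_zero p z
  have hw := ee_ne_zero p w
  have : (ee p q - ee p q') * (ee p z - ee p w) = 0 := by
    field_simp at h1
    linear_combination h1
  rcases mul_eq_zero.1 this with h2 | h2
  · exact sub_eq_zero.1 h2
  · exact absurd (sub_eq_zero.1 h2) hne

theorem deg_sub_le_one {p : ℕ} (hp : p ≠ 0) {z w : ℂ} (hzw : ∀ k : ℤ, z - w ≠ k * p)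
    {X Y : Set ℂ} {GX GY : ℂ → ℂ} (hX : IsEnd p z w X GX) (hY : IsEnd p z w Y GY)
    (hXY : Disjoint X Y) {κ κ' : ℝ → ℂ} (hκ : IsArc z w X Y κ) (hκ' : IsArc z w X Y κ')
    (hdis : ∀ s ∈ Icc (0:ℝ) 1, ∀ t ∈ Icc (0:ℝ) 1, ∀ k : ℤ, κ s ≠ κ' t + k * p)
    {d d' : ℤ} (hd : IsDeg p z w GX GY κ d) (hd' : IsDeg p z w GX GY κ' d') :
    |d - d'| ≤ 1 := by
  obtain ⟨l, hl, he, h0, h1⟩ := hd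
  obtain ⟨l', hl', he', h0', h1'⟩ := hd'
  set m := d - d' with hm
  set N : ℤ → ℂ := fun j => 2 * Real.pi * I * j with hN
  have hexpN : ∀ j, exp (N j) = 1 := by
    intro j; rw [hN]; simp only []; rw [mul_comm, exp_int_mul_two_pi_mul_I]
  have m0 : (0:ℝ) ∈ Icc (0:ℝ) 1 := by simp
  have m1 : (1:ℝ) ∈ Icc (0:ℝ) 1 := by simp
  set TX : Set (ℂ × ℂ) := (fun q => (q, GX q)) '' X with hTX
  set TY : Set (ℂ × ℂ) := (fun q => (q, GY q + N d)) '' Y with hTY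
  set Tκ : Set (ℂ × ℂ) := (fun t => (κ t, l t)) '' Icc (0:ℝ) 1 with hTκ
  set Tκ' : Set (ℂ × ℂ) := (fun t => (κ' t, l' t + N m)) '' Icc (0:ℝ) 1 with hTκ'
  set T := TX ∪ TY ∪ Tκ ∪ Tκ' with hT
  have hIcc : IsPathConnected (Icc (0:ℝ) 1) := (convex_Icc 0 1).isPathConnected ⟨0, m0⟩
  have jX : IsPathConnected TX :=
    hX.conn.image' (continuousOn_id.prodMk hX.cont)
  have jY : IsPathConnected TY :=
    hY.conn.image' (continuousOn_id.prodMk (hY.cont.add continuousOn_const))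
  have jκ : IsPathConnected Tκ := hIcc.image' (hκ.cont.prodMk hl)
  have jκ' : IsPathConnected Tκ' :=
    hIcc.image' (hκ'.cont.prodMk (hl'.add continuousOn_const))
  have sX : TX ⊆ T := fun x hx => Or.inl (Or.inl (Or.inl hx))
  have sY : TY ⊆ T := fun x hx => Or.inl (Or.inl (Or.inr hx))
  have sκ : Tκ ⊆ T := fun x hx => Or.inl (Or.inr hx)
  have sκ' : Tκ' ⊆ T := fun x hx => Or.inr hx
  have J : JoinedIn T (κ' 0, GX (κ' 0)) (κ' 0, GX (κ' 0) + N m) := by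
    have J1 := (jX.joinedIn (κ' 0, GX (κ' 0)) ⟨_, hκ'.left, rfl⟩ (κ 0, GX (κ 0))
      ⟨_, hκ.left, rfl⟩).mono sX
    have J2 := (jκ.joinedIn (κ 0, l 0) ⟨_, m0, rfl⟩ (κ 1, l 1) ⟨_, m1, rfl⟩).mono sκ
    have J3 := (jY.joinedIn (κ 1, GY (κ 1) + N d) ⟨_, hκ.right, rfl⟩
      (κ' 1, GY (κ' 1) + N d) ⟨_, hκ'.right, rfl⟩).mono sY
    have J4 := (jκ'.joinedIn (κ' 1, l' 1 + N m) ⟨_, m1, rfl⟩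
      (κ' 0, l' 0 + N m) ⟨_, m0, rfl⟩).mono sκ'
    rw [h0, h1] at J2
    have e1 : l' 1 + N m = GY (κ' 1) + N d := by
      rw [h1']; simp only [hN, hm]; push_cast; ring
    rw [e1, h0'] at J4
    exact ((J1.trans J2).trans J3).trans J4
  have hwX : ∀ x ∈ T, EE p x.1 w ≠ 0 := by
    rintro x (((⟨q, hq, rfl⟩ | ⟨q, hq, rfl⟩) | ⟨t, ht, rfl⟩) | ⟨t, ht, rfl⟩)
    · exact hX.ne_zero q hq
    · exact hY.ne_zero q hq
    · exact EE_ne_zero_of_forall_ne hp (hκ.avoid_right t ht)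
    · exact EE_ne_zero_of_forall_ne hp (hκ'.avoid_right t ht)
  have hexp : ∀ x ∈ T, exp x.2 * EE p x.1 w = EE p x.1 z := by
    rintro x (((⟨q, hq, rfl⟩ | ⟨q, hq, rfl⟩) | ⟨t, ht, rfl⟩) | ⟨t, ht, rfl⟩)
    · exact hX.exp_eq q hq
    · rw [exp_add, hexpN, mul_one]; exact hY.exp_eq q hq
    · exact he t ht
    · rw [exp_add, hexpN, mul_one]; exact he' t ht
  have nXY : ∀ q ∈ X, q ∉ Y := fun q hq hq' => Set.disjoint_left.1 hXY hq hq'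
  have vX : ∀ x ∈ T, x.1 ∈ X → ∃ j : ℤ, x.2 = GX x.1 + N (m * j) := by
    rintro x (((⟨q, hq, rfl⟩ | ⟨q, hq, rfl⟩) | ⟨t, ht, rfl⟩) | ⟨t, ht, rfl⟩) hx
    · exact ⟨0, by simp [hN]⟩
    · exact absurd hq (nXY _ hx)
    · obtain rfl := hκ.eq_zero t ht hx
      exact ⟨0, by simp [hN, h0]⟩
    · obtain rfl := hκ'.eq_zero t ht hx
      exact ⟨1, by simp [h0']⟩
  have vY : ∀ x ∈ T, x.1 ∈ Y → x.2 = GY x.1 + N d := by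
    rintro x (((⟨q, hq, rfl⟩ | ⟨q, hq, rfl⟩) | ⟨t, ht, rfl⟩) | ⟨t, ht, rfl⟩) hx
    · exact absurd hx (nXY _ hq)
    · rfl
    · obtain rfl := hκ.eq_one t ht hx
      exact h1
    · obtain rfl := hκ'.eq_one t ht hx
      simp only [h1', hN, hm]; push_cast; ring
  have vN : ∀ x ∈ T, x.1 ∉ X → x.1 ∉ Y → x ∈ Tκ ∨ x ∈ Tκ' := by
    rintro x (((⟨q, hq, rfl⟩ | ⟨q, hq, rfl⟩) | hx) | hx) h h'
    · exact absurd hq h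
    · exact absurd hq h'
    · exact Or.inl hx
    · exact Or.inr hx
  have chord : ∀ x ∈ T, ∀ y ∈ T, ∀ e : ℤ, x.2 - y.2 = N e → m ∣ e := by
    intro x hx y hy e hxy
    have hex : exp x.2 = exp y.2 := by
      rw [← sub_add_cancel x.2 y.2, hxy, exp_add, hexpN, one_mul]
    obtain ⟨k, hk⟩ := eq_add_of_div_eq hp hzw (hexp x hx)
      (by rw [hex]; exact hexp y hy)
    have hkk : x.1 = y.1 + ((k * p : ℤ) : ℂ) := by rw [hk]; push_cast; ring
    have hkk' : y.1 = x.1 + ((-(k * p) : ℤ) : ℂ) := by rw [hk]; push_cast; ring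
    by_cases hxX : x.1 ∈ X
    · have hyX : y.1 ∈ X := by rw [hkk']; exact hX.inv _ hxX _
      obtain ⟨i, hi⟩ := vX x hx hxX
      obtain ⟨j, hj⟩ := vX y hy hyX
      have hper := hX.per y.1 hyX k
      rw [← hk] at hper
      rw [hi, hj, hper] at hxy
      refine ⟨i - j, two_pi_I_mul_int_inj ?_⟩
      simp only [hN] at hxy
      rw [← hxy]; push_cast; ring
    · have hyX : y.1 ∉ X := fun h => hxX (by rw [hkk]; exact hX.inv _ h _)
      have hcl : x.2 = y.2 → m ∣ e := by
        intro h
        rw [h, sub_self] at hxy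
        have : e = 0 := two_pi_I_mul_int_inj (by simp only [hN] at hxy; rw [← hxy]; simp)
        rw [this]; exact dvd_zero m
      by_cases hxY : x.1 ∈ Y
      · have hyY : y.1 ∈ Y := by rw [hkk']; exact hY.inv _ hxY _
        have hper := hY.per y.1 hyY k
        rw [← hk] at hper
        exact hcl (by rw [vY x hx hxY, vY y hy hyY, hper])
      · have hyY : y.1 ∉ Y := fun h => hxY (by rw [hkk]; exact hY.inv _ h _)
        rcases vN x hx hxX hxY with ⟨s, hs, rfl⟩ | ⟨s, hs, rfl⟩ <;>
          rcases vN y hy hyX hyY with ⟨t, ht, rfl⟩ | ⟨t, ht, rfl⟩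
        · obtain rfl := hκ.inj s hs t ht _ hkk
          exact hcl rfl
        · exact absurd hk (hdis s hs t ht k)
        · refine absurd ?_ (hdis t ht s hs (-k))
          have h := hkk'
          simp only at h
          rw [h]; push_cast; ring
        · obtain rfl := hκ'.inj s hs t ht _ hkk
          exact hcl rfl
  obtain ⟨γ, hγ⟩ := J
  have hγm : ∀ t, γ.extend t ∈ T := fun t => by
    have : γ.extend t ∈ range γ := by rw [← γ.extend_range]; exact ⟨t, rfl⟩
    obtain ⟨s, hs⟩ := this
    rw [← hs]; exact hγ s
  refine abs_period_le_one_of_chords (γ := fun t => (γ.extend t).2)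
    (continuous_snd.comp γ.continuous_extend).continuousOn (m := m) ?_ ?_
  · simp [hN]
  · intro s _ t _ e h
    exact chord _ (hγm s) _ (hγm t) e h

/-- A closed connected translation invariant set which is unbounded vertically. -/
structure IsSide (A : Set ℂ) : Prop where
  closed : IsClosed A
  preconn : IsPreconnected A
  inv : ∀ q ∈ A, ∀ k : ℤ, q + k ∈ A
  far : (comap im atBot ⊓ 𝓟 A).NeBot ∨ (comap im atTop ⊓ 𝓟 A).NeBot

theorem IsSide.EE_ne_zero {A : Set ℂ} (hA : IsSide A) {p : ℕ} (hp : p ≠ 0) {w : ℂ} (hw : w ∉ A) :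
    ∀ q ∈ A, EE p q w ≠ 0 := by
  intro q hq
  refine EE_ne_zero_of_forall_ne hp fun k hk => hw ?_
  have := hA.inv q hq (-k)
  convert this using 1
  push_cast; linear_combination -hk

theorem EE_one_eq_prod {p : ℕ} (hp : p ≠ 0) (q z : ℂ) :
    EE 1 q z = ∏ i ∈ Finset.range p, EE p (q + i) z := by
  have hζ := isPrimitiveRoot_exp p hp
  have hpc : (p : ℂ) ≠ 0 := by exact_mod_cast hp
  have h1 : EE 1 q z = 1 ^ p - (ee p (q - z)) ^ p := by
    rw [EE, one_pow, ee, ee, ← exp_nat_mul]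
    congr 2
    field_simp
    simp
  rw [h1, hζ.pow_sub_pow_eq_prod_sub_mul _ _ (Nat.pos_of_ne_zero hp)]
  symm
  refine Finset.prod_bij (fun i _ => exp (2 * Real.pi * I / p) ^ i) ?_ ?_ ?_ ?_
  · intro i _
    rw [Polynomial.mem_nthRootsFinset (Nat.pos_of_ne_zero hp), ← pow_mul, mul_comm i p, pow_mul,
      hζ.pow_eq_one, one_pow]
  · intro i hi j hj h
    exact hζ.pow_inj (Finset.mem_range.1 hi) (Finset.mem_range.1 hj) h
  · intro x hx
    rw [Polynomial.mem_nthRootsFinset (Nat.pos_of_ne_zero hp)] at hx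
    have : NeZero p := ⟨hp⟩
    obtain ⟨i, hi, h⟩ := hζ.eq_pow_of_pow_eq_one hx
    exact ⟨i, Finset.mem_range.2 hi, h⟩
  · intro i _
    rw [EE, show q + i - z = i + (q - z) by ring, ee_add]
    congr 2
    rw [ee, ← exp_nat_mul]
    congr 1; ring

theorem tendsto_add_int {A : Set ℂ} (inv : ∀ q ∈ A, ∀ k : ℤ, q + k ∈ A) (l : Filter ℝ) (k : ℤ) :
    Tendsto (fun q : ℂ => q + k) (comap im l ⊓ 𝓟 A) (comap im l ⊓ 𝓟 A) := by
  refine tendsto_inf.2 ⟨?_, ?_⟩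
  · refine Tendsto.mono_left (tendsto_comap_iff.2 ?_) inf_le_left
    exact tendsto_comap.congr fun q => by simp
  · exact tendsto_inf_right (tendsto_principal_principal.2 fun q hq => inv q hq k)

namespace IsLog

variable {p : ℕ} {A : Set ℂ} {z w : ℂ} {G G' : ℂ → ℂ}

theorem shift (hp : p ≠ 0) (inv : ∀ q ∈ A, ∀ k : ℤ, q + k ∈ A) (h : IsLog p A z w G) (k : ℤ) :
    IsLog p A z w (fun q => G (q + k * p)) where
  cont := h.cont.comp (by fun_prop) fun q hq => by
    have := inv q hq (k * p); push_cast at this; exact this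
  exp_eq q hq := by
    have hm := inv q hq (k * p)
    push_cast at hm
    rw [← EE_add_int_mul hp q w k, h.exp_eq _ hm, EE_add_int_mul hp]
  bot := by
    have := h.bot.comp (tendsto_add_int inv atBot (k * p))
    push_cast at this; exact this
  top := by
    have := h.top.comp (tendsto_add_int inv atTop (k * p))
    push_cast at this; exact this

theorem periodic (hA : IsSide A) (hp : p ≠ 0) (hw : w ∉ A) (h : IsLog p A z w G) :
    ∀ q ∈ A, ∀ k : ℤ, G (q + k * p) = G q := fun _ hq k =>
  (h.shift hp hA.inv k).unique hA.preconn (hA.EE_ne_zero hp hw) h hA.far hq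

theorem isEnd (hA : IsSide A) (hp : p ≠ 0) (hw : w ∉ A) (h : IsLog p A z w G) {X : Set ℂ}
    (hX : IsPathConnected X) (hXA : X ⊆ A) (hinv : ∀ q ∈ X, ∀ k : ℤ, q + k ∈ X) :
    IsEnd p z w X G where
  conn := hX
  inv := hinv
  ne_zero q hq := hA.EE_ne_zero hp hw q (hXA hq)
  cont := h.cont.mono hXA
  exp_eq q hq := h.exp_eq q (hXA hq)
  per q hq := h.periodic hA hp hw q (hXA hq)

theorem sum (hp : p ≠ 0) (inv : ∀ q ∈ A, ∀ k : ℤ, q + k ∈ A) (h : IsLog p A z w G) :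
    IsLog 1 A z w (fun q => ∑ i ∈ Finset.range p, G (q + i)) where
  cont := continuousOn_finsetSum _ fun i _ => h.cont.comp (by fun_prop) fun q hq => by
    have := inv q hq i; push_cast at this; exact this
  exp_eq q hq := by
    rw [exp_sum, EE_one_eq_prod hp, EE_one_eq_prod hp, ← Finset.prod_mul_distrib]
    refine Finset.prod_congr rfl fun i _ => h.exp_eq _ ?_
    have := inv q hq i; push_cast at this; exact this
  bot := by
    have hpc : (p : ℂ) ≠ 0 := by exact_mod_cast hp
    have : Tendsto (fun q => ∑ i ∈ Finset.range p, G (q + i)) (comap im atBot ⊓ 𝓟 A)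
        (𝓝 (∑ i ∈ Finset.range p, 2 * Real.pi * I * (w - z) / p)) :=
      tendsto_finsetSum _ fun i _ => by
        have := h.bot.comp (tendsto_add_int inv atBot i)
        push_cast at this; exact this
    convert this using 2
    simp
    field_simp
  top := by
    have : Tendsto (fun q => ∑ i ∈ Finset.range p, G (q + i)) (comap im atTop ⊓ 𝓟 A)
        (𝓝 (∑ i ∈ Finset.range p, (0:ℂ))) :=
      tendsto_finsetSum _ fun i _ => by
        have := h.top.comp (tendsto_add_int inv atTop i)
        push_cast at this; exact this
    simpa using this

end IsLog

namespace IsDeg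

variable {p : ℕ} {z w : ℂ} {GX GY GX' GY' : ℂ → ℂ} {κ : ℝ → ℂ} {d : ℤ}

theorem congr (h : IsDeg p z w GX GY κ d) (hX : GX' (κ 0) = GX (κ 0))
    (hY : GY' (κ 1) = GY (κ 1)) : IsDeg p z w GX' GY' κ d := by
  obtain ⟨l, hl, he, h0, h1⟩ := h
  exact ⟨l, hl, he, h0.trans hX.symm, by rw [h1, hY]⟩

theorem sum (hp : p ≠ 0) {d : ℕ → ℤ}
    (h : ∀ i : ℕ, IsDeg p z w GX GY (fun t => κ t + i) (d i)) :
    IsDeg 1 z w (fun q => ∑ i ∈ Finset.range p, GX (q + i))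
      (fun q => ∑ i ∈ Finset.range p, GY (q + i)) κ (∑ i ∈ Finset.range p, d i) := by
  choose l hl he h0 h1 using h
  refine ⟨fun t => ∑ i ∈ Finset.range p, l i t, continuousOn_finsetSum _ fun i _ => hl i,
    fun t ht => ?_, ?_, ?_⟩
  · rw [exp_sum, EE_one_eq_prod hp, EE_one_eq_prod hp, ← Finset.prod_mul_distrib]
    exact Finset.prod_congr rfl fun i _ => he i t ht
  · exact Finset.sum_congr rfl fun i _ => h0 i
  · simp only
    rw [Finset.sum_congr rfl fun i _ => h1 i, Finset.sum_add_distrib, ← Finset.mul_sum]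
    push_cast; rfl

theorem shift_one (h : IsDeg 1 z w GX GY κ d) (j : ℤ) (hX : GX (κ 0 + j) = GX (κ 0))
    (hY : GY (κ 1 + j) = GY (κ 1)) : IsDeg 1 z w GX GY (fun t => κ t + j) d := by
  obtain ⟨l, hl, he, h0, h1⟩ := h
  refine ⟨l, hl, fun t ht => ?_, h0.trans hX.symm, by rw [h1, hY]⟩
  have e : ∀ x, EE 1 (κ t + j) x = EE 1 (κ t) x := fun x => by
    have := EE_add_int_mul one_ne_zero (κ t) x j
    simpa using this
  rw [e, e, he t ht]

end IsDeg

/-- Arcs which are disjoint modulo `p` have degrees differing by at most `p`. -/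
theorem deg_compare {p : ℕ} (hp : p ≠ 0) {z w : ℂ} (hzw : ∀ k : ℤ, z - w ≠ k)
    {A B X Y : Set ℂ} (hA : IsSide A) (hB : IsSide B) (hwA : w ∉ A) (hwB : w ∉ B)
    (hXA : X ⊆ A) (hYB : Y ⊆ B) (hX : IsPathConnected X) (hY : IsPathConnected Y)
    (hXi : ∀ q ∈ X, ∀ k : ℤ, q + k ∈ X) (hYi : ∀ q ∈ Y, ∀ k : ℤ, q + k ∈ Y)
    (hXY : Disjoint X Y) {GX GY HX HY : ℂ → ℂ} (hGX : IsLog 1 A z w GX) (hGY : IsLog 1 B z w GY)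
    (hHX : IsLog p A z w HX) (hHY : IsLog p B z w HY) {κ κ' : ℝ → ℂ}
    (hκ : IsArc z w X Y κ) (hκ' : IsArc z w X Y κ') (j : ℤ)
    (hdis : ∀ s ∈ Icc (0:ℝ) 1, ∀ t ∈ Icc (0:ℝ) 1, ∀ k : ℤ, κ s ≠ κ' t + j + k * p)
    {d d' : ℤ} (hd : IsDeg 1 z w GX GY κ d) (hd' : IsDeg 1 z w GX GY κ' d') :
    |d - d'| ≤ p := by
  have hzwp : ∀ k : ℤ, z - w ≠ k * p := fun k hk => hzw (k * p) (by rw [hk]; push_cast; ring)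
  have key : ∀ {σ : ℝ → ℂ} {e : ℤ}, IsArc z w X Y σ → IsDeg 1 z w GX GY σ e →
      ∃ f : ℕ → ℤ, (∀ i : ℕ, IsDeg p z w HX HY (fun t => σ t + i) (f i)) ∧
        e = ∑ i ∈ Finset.range p, f i := by
    intro σ e hσ he
    have hsh : ∀ i : ℕ, ∃ f, IsDeg p z w HX HY (fun t => σ t + i) f := fun i => by
      have := hσ.shift hXi hYi i
      push_cast at this
      exact this.exists_isDeg hp (hHX.exp_eq _ (hXA this.left)) (hHY.exp_eq _ (hYB this.right))
    choose f hf using hsh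
    refine ⟨f, hf, ?_⟩
    have h1 := (IsDeg.sum hp hf).congr
      (hGX.unique hA.preconn (hA.EE_ne_zero one_ne_zero hwA) (hHX.sum hp hA.inv) hA.far
        (hXA hσ.left))
      (hGY.unique hB.preconn (hB.EE_ne_zero one_ne_zero hwB) (hHY.sum hp hB.inv) hB.far
        (hYB hσ.right))
    exact he.unique (fun t ht => EE_ne_zero_of_forall_ne one_ne_zero (hσ.avoid_right t ht)) h1
  have hs := hκ'.shift hXi hYi j
  have pX := hGX.periodic hA one_ne_zero hwA _ (hXA hκ'.left) j
  have pY := hGY.periodic hB one_ne_zero hwB _ (hYB hκ'.right) j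
  simp only [Nat.cast_one, mul_one] at pX pY
  obtain ⟨f, hf, rfl⟩ := key hκ hd
  obtain ⟨f', hf', rfl⟩ := key hs (hd'.shift_one j pX pY)
  rw [← Finset.sum_sub_distrib]
  have h1 : ∀ i ∈ Finset.range p, |f i - f' i| ≤ 1 := fun i _ => by
    have a1 := hκ.shift hXi hYi i
    have a2 := hs.shift hXi hYi i
    push_cast at a1 a2
    refine deg_sub_le_one hp hzwp (hHX.isEnd hA hp hwA hX hXA hXi)
      (hHY.isEnd hB hp hwB hY hYB hYi) hXY a1 a2 ?_ (hf i) (hf' i)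
    intro s hs t ht k hk
    exact hdis s hs t ht k (by linear_combination hk)
  calc |∑ i ∈ Finset.range p, (f i - f' i)| ≤ ∑ i ∈ Finset.range p, |f i - f' i| :=
        Finset.abs_sum_le_sum_abs _ _
    _ ≤ ∑ i ∈ Finset.range p, 1 := Finset.sum_le_sum h1
    _ = p := by simp

theorem exists_int_shift_avoid {p : ℕ} {a b e e' : ℝ} (h : e + e' + 1 < p) :
    ∃ j : ℤ, ∀ x y : ℝ, x ∈ Icc a (a + e) → y ∈ Icc b (b + e') → ∀ k : ℤ, x ≠ y + j + k * p := by
  refine ⟨⌊a - b + e⌋ + 1, fun x y hx hy k hk => ?_⟩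
  have h1 := Int.lt_floor_add_one (a - b + e)
  have h2 := Int.floor_le (a - b + e)
  obtain ⟨hx1, hx2⟩ := hx
  obtain ⟨hy1, hy2⟩ := hy
  push_cast at hk
  rcases le_or_gt 0 k with hk0 | hk0
  · have : (0:ℝ) ≤ k * p := by positivity
    linarith
  · have h3 : (k:ℝ) ≤ -1 := by exact_mod_cast Int.le_sub_one_of_lt hk0
    have h4 : (k:ℝ) * p ≤ -1 * p := by gcongr
    linarith

theorem one_sub_ee_mem_slitPlane {q z : ℂ} (h : ∀ k : ℤ, q.re - z.re ≠ k) :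
    EE 1 q z ∈ slitPlane := by
  have him : ∀ k : ℤ, (2 * Real.pi * I * (q - z) / (1:ℕ)).im = 2 * Real.pi * (q.re - z.re) := by
    intro k
    simp
  rw [mem_slitPlane_iff]
  by_contra! hcon
  obtain ⟨h1, h2⟩ := hcon
  simp only [EE, sub_re, one_re, sub_im, one_im, zero_sub, neg_eq_zero, ee] at h1 h2
  set ζ := 2 * Real.pi * I * (q - z) / (1:ℕ) with hζ
  have hζi : ζ.im = 2 * Real.pi * (q.re - z.re) := him 0
  rw [exp_im] at h2
  rw [exp_re] at h1
  have hs : Real.sin ζ.im = 0 := by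
    rcases mul_eq_zero.1 h2 with h | h
    · exact absurd h (Real.exp_ne_zero _)
    · exact h
  have hc : 0 < Real.cos ζ.im := by
    have := Real.exp_pos ζ.re
    by_contra! hc
    nlinarith
  have hc1 : Real.cos ζ.im = 1 := by
    have := Real.sin_sq_add_cos_sq ζ.im
    rw [hs] at this
    nlinarith
  obtain ⟨k, hk⟩ := (Real.cos_eq_one_iff _).1 hc1
  refine h k ?_
  rw [hζi] at hk
  have hpi := Real.pi_pos
  have : 2 * Real.pi * (q.re - z.re - k) = 0 := by linarith
  rcases mul_eq_zero.1 this with h | h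
  · linarith
  · linarith

/-- The degree of a vertical arc is governed by the logarithms at its ends. -/
theorem deg_vertical {z w : ℂ} {GX GY : ℂ → ℂ} {κ : ℝ → ℂ} {d : ℤ} {c C : ℝ}
    (hd : IsDeg 1 z w GX GY κ d) (hκ : ContinuousOn κ (Icc 0 1))
    (hre : ∀ t ∈ Icc (0:ℝ) 1, (κ t).re = c) (hcz : ∀ k : ℤ, c - z.re ≠ k)
    (hcw : ∀ k : ℤ, c - w.re ≠ k) (hX : |(GX (κ 0)).im - 2 * Real.pi * (w.re - z.re)| ≤ C)
    (hY : |(GY (κ 1)).im| ≤ C) : |d - (w.re - z.re)| ≤ 2 + C := by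
  obtain ⟨l, hl, he, h0, h1⟩ := hd
  have sz : ∀ t ∈ Icc (0:ℝ) 1, EE 1 (κ t) z ∈ slitPlane := fun t ht =>
    one_sub_ee_mem_slitPlane (by rw [hre t ht]; exact hcz)
  have sw : ∀ t ∈ Icc (0:ℝ) 1, EE 1 (κ t) w ∈ slitPlane := fun t ht =>
    one_sub_ee_mem_slitPlane (by rw [hre t ht]; exact hcw)
  have cz : ContinuousOn (fun t => log (EE 1 (κ t) z)) (Icc 0 1) :=
    ((continuous_EE 1 z).comp_continuousOn hκ).clog sz
  have cw : ContinuousOn (fun t => log (EE 1 (κ t) w)) (Icc 0 1) :=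
    ((continuous_EE 1 w).comp_continuousOn hκ).clog sw
  obtain ⟨n, hn⟩ := log_unique isPreconnected_Icc hl (cz.sub cw) (fun t ht => by
    have z0 := slitPlane_ne_zero (sz t ht)
    have w0 := slitPlane_ne_zero (sw t ht)
    simp only [Pi.sub_apply]
    rw [exp_sub, exp_log z0, exp_log w0, ← he t ht, mul_div_cancel_right₀ _ w0])
  have e0 := congrArg im (hn 0 (by simp))
  have e1 := congrArg im (hn 1 (by simp))
  rw [h0] at e0
  rw [h1] at e1
  have b1 := abs_le.1 (abs_arg_le_pi (EE 1 (κ 0) z))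
  have b2 := abs_le.1 (abs_arg_le_pi (EE 1 (κ 0) w))
  have b3 := abs_le.1 (abs_arg_le_pi (EE 1 (κ 1) z))
  have b4 := abs_le.1 (abs_arg_le_pi (EE 1 (κ 1) w))
  simp only [Pi.sub_apply, add_im, sub_im, log_im] at e0 e1
  have hi : ∀ m : ℤ, (2 * Real.pi * I * m : ℂ).im = 2 * Real.pi * m := fun m => by simp
  rw [hi] at e0 e1
  rw [hi] at e1
  have hX' := abs_le.1 hX
  have hY' := abs_le.1 hY
  have hpi := Real.pi_gt_three
  have hC : 0 ≤ C := (abs_nonneg _).trans hY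
  have k1 : 2 * Real.pi * (d - (w.re - z.re)) ≤ 4 * Real.pi + 2 * C := by linarith
  have k2 : -(4 * Real.pi + 2 * C) ≤ 2 * Real.pi * (d - (w.re - z.re)) := by linarith
  rw [abs_le]
  constructor <;> by_contra! hh <;> nlinarith

/-- If two paths are narrow relative to the period `p`, some integer translate of the second has all
its `p`-periodic translates disjoint from the first. -/
theorem exists_avoid_of_width {p : ℕ} {κ κ' : ℝ → ℂ} {a b e e' : ℝ} (h : e + e' + 1 < p)
    (hκ : ∀ t ∈ Icc (0:ℝ) 1, (κ t).re ∈ Icc a (a + e))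
    (hκ' : ∀ t ∈ Icc (0:ℝ) 1, (κ' t).re ∈ Icc b (b + e')) :
    ∃ j : ℤ, ∀ s ∈ Icc (0:ℝ) 1, ∀ t ∈ Icc (0:ℝ) 1, ∀ k : ℤ, κ s ≠ κ' t + j + k * p := by
  obtain ⟨j, hj⟩ := exists_int_shift_avoid (a := a) (b := b) h
  refine ⟨j, fun s hs t ht k hk => hj _ _ (hκ s hs) (hκ' t ht) k ?_⟩
  have := congrArg re hk
  simpa using this

theorem exp_eq_imp_periodic {g : ℂ → ℂ} (per : ∀ ζ, ∀ k : ℤ, g (ζ + k * (2 * Real.pi * I)) = g ζ)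
    {a b : ℂ} (h : exp a = exp b) : g a = g b := by
  obtain ⟨k, hk⟩ := exp_eq_exp_iff_exists_int.1 h
  rw [hk, per]

/-- A periodic function composed with the logarithm is continuous away from zero. -/
theorem continuousAt_comp_log {g : ℂ × ℂ → ℂ} (hg : Continuous g)
    (per : ∀ z ζ, ∀ k : ℤ, g (ζ + k * (2 * Real.pi * I), z) = g (ζ, z)) {u : ℂ} (hu : u ≠ 0)
    (z : ℂ) : ContinuousAt (fun x : ℂ × ℂ => g (log x.1, x.2)) (u, z) := by
  have key : ∀ a b : ℂ, exp a = exp b → ∀ y, g (a, y) = g (b, y) := fun a b h y =>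
    exp_eq_imp_periodic (g := fun ζ => g (ζ, y)) (per y) h
  by_cases hs : u ∈ slitPlane
  · have : ContinuousAt (fun x : ℂ × ℂ => (log x.1, x.2)) (u, z) :=
      (continuousAt_fst.clog hs).prodMk continuousAt_snd
    exact hg.continuousAt.comp this
  · have hs' : -u ∈ slitPlane := by
      rcases mem_slitPlane_or_neg_mem_slitPlane hu with h | h
      · exact absurd h hs
      · exact h
    have h1 : ContinuousAt (fun x : ℂ × ℂ => (log (-x.1) + Real.pi * I, x.2)) (u, z) :=
      ((continuousAt_fst.neg.clog hs').add continuousAt_const).prodMk continuousAt_snd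
    have h2 := hg.continuousAt.comp h1
    refine h2.congr ?_
    have : ∀ᶠ x : ℂ × ℂ in 𝓝 (u, z), x.1 ≠ 0 := continuousAt_fst.eventually_ne hu
    filter_upwards [this] with x hx
    refine key _ _ ?_ _
    rw [exp_add, exp_log (neg_ne_zero.2 hx), exp_log hx, exp_pi_mul_I]
    ring

/-- The data of a bounded periodic displacement, injective modulo integers. -/
structure IsDisp (D : ℂ → ℂ) (E : ℝ) : Prop where
  cont : Continuous D
  per : ∀ q, ∀ k : ℤ, D (q + k) = D q
  bound : ∀ q, ‖D q‖ ≤ E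
  inj : ∀ q z, ∀ k : ℤ, q + D q = z + D z + k → ∃ m : ℤ, q = z + m

/-- The function `1 - exp (2πi (F q - F z))`, in the coordinate `u = exp (2πi (q - z))`. -/
def NN (D : ℂ → ℂ) (x : ℂ × ℂ) : ℂ :=
  1 - x.1 * ee 1 (D (x.2 + log x.1 / (2 * Real.pi * I)) - D x.2)

theorem ee_one_eq (q : ℂ) : ee 1 q = exp (2 * Real.pi * I * q) := by simp [ee]

theorem ee_one_div (q : ℂ) : ee 1 (q / (2 * Real.pi * I)) = exp q := by
  rw [ee_one_eq, mul_div_cancel₀ _ two_pi_I_ne_zero]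

namespace IsDisp

variable {D : ℂ → ℂ} {E : ℝ} (h : IsDisp D E)
include h

theorem eq_of_ee_eq {a b : ℂ} (hab : ee 1 a = ee 1 b) : D a = D b := by
  obtain ⟨k, hk⟩ := (ee_eq_iff one_ne_zero).1 hab
  rw [hk, Nat.cast_one, mul_one, h.per]

theorem norm_ee_le (q z : ℂ) : ‖ee 1 (D q - D z)‖ ≤ Real.exp (4 * Real.pi * E) := by
  rw [norm_ee]
  have h1 := (abs_im_le_norm (D q)).trans (h.bound q)
  have h2 := (abs_im_le_norm (D z)).trans (h.bound z)
  have h1' := abs_le.1 h1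
  have h2' := abs_le.1 h2
  apply Real.exp_le_exp.2
  simp only [sub_im, Nat.cast_one, div_one]
  nlinarith [Real.pi_pos]

theorem NN_ee (q z : ℂ) : NN D (ee 1 (q - z), z) = EE 1 (q + D q) (z + D z) := by
  have : D (z + log (ee 1 (q - z)) / (2 * Real.pi * I)) = D q := by
    apply h.eq_of_ee_eq
    rw [ee_add, ee_one_div, exp_log (ee_ne_zero _ _), ee_sub, mul_div_cancel₀ _ (ee_ne_zero _ _)]
  rw [NN, EE, this, ← ee_add]
  congr 2; ring

theorem continuous_NN : Continuous (NN D) := by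
  rw [continuous_iff_continuousAt]
  rintro ⟨u, z⟩
  by_cases hu : u = 0
  · subst hu
    have h0 : NN D (0, z) = 1 := by simp [NN]
    rw [ContinuousAt, h0, tendsto_iff_norm_sub_tendsto_zero]
    have hb : Tendsto (fun x : ℂ × ℂ => ‖x.1‖ * Real.exp (4 * Real.pi * E)) (𝓝 (0, z)) (𝓝 0) := by
      have : Continuous (fun x : ℂ × ℂ => ‖x.1‖ * Real.exp (4 * Real.pi * E)) := by fun_prop
      simpa using this.tendsto (0, z)
    refine squeeze_zero (fun _ => norm_nonneg _) (fun x => ?_) hb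
    rw [NN, sub_sub_cancel_left, norm_neg, norm_mul]
    exact mul_le_mul_of_nonneg_left (h.norm_ee_le _ _) (norm_nonneg _)
  · have hc := h.cont
    have he := continuous_ee 1
    have key := continuousAt_comp_log
      (g := fun x : ℂ × ℂ => D (x.2 + x.1 / (2 * Real.pi * I))) (by fun_prop) (by
        intro z ζ k
        simp only
        rw [← h.per (z + ζ / (2 * Real.pi * I)) k]
        congr 1
        field_simp [two_pi_I_ne_zero]
        ring) hu z
    unfold NN
    exact continuousAt_const.sub (continuousAt_fst.mul
      (he.continuousAt.comp (key.sub (hc.continuousAt.comp continuousAt_snd))))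

theorem eq_one_of_NN {u z : ℂ} (h0 : NN D (u, z) = 0) : u = 1 := by
  have hu : u ≠ 0 := by
    rintro rfl
    simp [NN] at h0
  set q := z + log u / (2 * Real.pi * I) with hq
  have hu' : ee 1 (q - z) = u := by rw [hq, add_sub_cancel_left, ee_one_div, exp_log hu]
  rw [← hu', h.NN_ee, EE_eq_zero_iff one_ne_zero] at h0
  obtain ⟨k, hk⟩ := h0
  obtain ⟨m, hm⟩ := h.inj q z k (by push_cast at hk; linear_combination hk)
  rw [← hu', ee_eq_one_iff one_ne_zero]
  exact ⟨m, by rw [hm]; simp⟩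

end IsDisp

/-- The point `q` with `exp (2πi (q - z)) = 1 + exp ζ`, for `ζ` of large real part. -/
def qlow (x : ℂ × ℂ) : ℂ := x.2 + (x.1 + log (1 + exp (-x.1))) / (2 * Real.pi * I)

/-- The logarithm of `EE 1 (F q) (F z) / EE 1 q z` for `q` far below `z`. -/
def lowLog (D : ℂ → ℂ) (x : ℂ × ℂ) : ℂ :=
  log (1 + exp (-x.1)) + 2 * Real.pi * I * (D (qlow x) - D x.2) +
    log (EE 1 (x.2 + D x.2) (qlow x + D (qlow x)))

theorem norm_exp_neg_lt {ζ : ℂ} (h : 0 < ζ.re) : ‖exp (-ζ)‖ < 1 := by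
  rw [norm_exp]; simpa using h

theorem ee_qlow {x : ℂ × ℂ} (h : 0 < x.1.re) : ee 1 (qlow x - x.2) = 1 + exp x.1 := by
  have h1 := slitPlane_ne_zero (mem_slitPlane_of_norm_lt_one (norm_exp_neg_lt h))
  rw [qlow, add_sub_cancel_left, ee_one_div, exp_add, exp_log h1, mul_add, ← exp_add,
    add_neg_cancel, exp_zero, mul_one, add_comm]

namespace IsDisp

variable {D : ℂ → ℂ} {E : ℝ} (h : IsDisp D E)
include h

theorem norm_ee_qlow_lt {x : ℂ × ℂ} (hx : 4 * Real.pi * E + 1 < x.1.re) :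
    ‖ee 1 (x.2 + D x.2 - (qlow x + D (qlow x)))‖ < 1 := by
  have hE : 0 ≤ E := (norm_nonneg _).trans (h.bound 0)
  have hpi := Real.pi_pos
  have hx0 : 0 < x.1.re := by nlinarith [mul_nonneg hpi.le hE]
  rw [show x.2 + D x.2 - (qlow x + D (qlow x)) = (D x.2 - D (qlow x)) + -(qlow x - x.2) by ring,
    ee_add, ee_neg, ee_qlow hx0, norm_mul, norm_inv]
  set A := Real.exp (4 * Real.pi * E) with hA
  have hA1 : 1 ≤ A := Real.one_le_exp (by positivity)
  have h1 : 2 * A < ‖exp x.1‖ := by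
    rw [norm_exp]
    calc 2 * A ≤ Real.exp 1 * A := by
          gcongr; linarith [Real.add_one_le_exp (1:ℝ)]
      _ = Real.exp (4 * Real.pi * E + 1) := by rw [Real.exp_add]; ring
      _ < _ := Real.exp_lt_exp.2 hx
  have h2 : ‖exp x.1‖ - 1 ≤ ‖1 + exp x.1‖ := by
    have := norm_sub_le (1 + exp x.1) 1
    rw [add_sub_cancel_left, norm_one] at this
    linarith
  have h3 : A < ‖1 + exp x.1‖ := by linarith
  have h4 : 0 < ‖1 + exp x.1‖ := by linarith
  rw [← div_eq_mul_inv, div_lt_one h4]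
  exact (h.norm_ee_le _ _).trans_lt h3

theorem exp_lowLog {x : ℂ × ℂ} (hx : 4 * Real.pi * E + 1 < x.1.re) :
    exp (lowLog D x) = NN D (1 + exp x.1, x.2) / -exp x.1 := by
  have hE : 0 ≤ E := (norm_nonneg _).trans (h.bound 0)
  have hpi := Real.pi_pos
  have hx0 : 0 < x.1.re := by nlinarith [mul_nonneg hpi.le hE]
  have h1 := slitPlane_ne_zero (mem_slitPlane_of_norm_lt_one (norm_exp_neg_lt hx0))
  have h2 : EE 1 (x.2 + D x.2) (qlow x + D (qlow x)) ≠ 0 := by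
    rw [EE, sub_ne_zero]
    intro he
    have := h.norm_ee_qlow_lt hx
    rw [← he, norm_one] at this
    exact lt_irrefl _ this
  rw [lowLog, exp_add, exp_add, exp_log h1, exp_log h2, ← ee_one_eq, ← ee_qlow hx0, h.NN_ee]
  have h3 := ee_qlow hx0
  have h4 : exp x.1 ≠ 0 := exp_ne_zero _
  have h5 : 1 + exp (-x.1) = ee 1 (qlow x - x.2) / exp x.1 := by
    rw [h3, exp_neg]; field_simp; ring
  rw [h5, EE, EE]
  have e1 : ee 1 (x.2 + D x.2 - (qlow x + D (qlow x))) =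
      (ee 1 (qlow x - x.2) * ee 1 (D (qlow x) - D x.2))⁻¹ := by
    rw [← ee_add, ← ee_neg]; congr 1; ring
  have e2 : ee 1 (qlow x + D (qlow x) - (x.2 + D x.2)) =
      ee 1 (qlow x - x.2) * ee 1 (D (qlow x) - D x.2) := by
    rw [← ee_add]; congr 1; ring
  rw [e1, e2]
  have n1 := ee_ne_zero 1 (qlow x - x.2)
  have n2 := ee_ne_zero 1 (D (qlow x) - D x.2)
  field_simp
  ring

theorem continuousOn_lowLog :
    ContinuousOn (lowLog D) {x : ℂ × ℂ | 4 * Real.pi * E + 1 < x.1.re} := by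
  have hE : 0 ≤ E := (norm_nonneg _).trans (h.bound 0)
  have hpi := Real.pi_pos
  have hD := h.cont
  have c1 : ContinuousOn (fun x : ℂ × ℂ => log (1 + exp (-x.1)))
      {x : ℂ × ℂ | 4 * Real.pi * E + 1 < x.1.re} := by
    refine ContinuousOn.clog (by fun_prop) fun x hx => ?_
    have hx' : 4 * Real.pi * E + 1 < x.1.re := hx
    exact mem_slitPlane_of_norm_lt_one (norm_exp_neg_lt (by nlinarith [mul_nonneg hpi.le hE]))
  have c2 : ContinuousOn qlow {x : ℂ × ℂ | 4 * Real.pi * E + 1 < x.1.re} :=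
    continuousOn_snd.add ((continuousOn_fst.add c1).div_const _)
  have c3 := hD.comp_continuousOn c2
  have c4 : ContinuousOn (fun x : ℂ × ℂ => D x.2) {x : ℂ × ℂ | 4 * Real.pi * E + 1 < x.1.re} :=
    (hD.comp continuous_snd).continuousOn
  refine (c1.add (continuousOn_const.mul (c3.sub c4))).add (ContinuousOn.clog ?_ ?_)
  · exact continuousOn_const.sub ((continuous_ee 1).comp_continuousOn
      ((continuousOn_snd.add c4).sub (c2.add c3)))
  · intro x hx
    have := mem_slitPlane_of_norm_lt_one (z := -ee 1 (x.2 + D x.2 - (qlow x + D (qlow x))))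
      (by rw [norm_neg]; exact h.norm_ee_qlow_lt hx)
    rwa [← sub_eq_add_neg] at this

theorem lowLog_add_two_pi (x : ℂ × ℂ) :
    lowLog D (x.1 + 2 * Real.pi * I, x.2) = lowLog D x := by
  have h1 : exp (-(x.1 + 2 * Real.pi * I)) = exp (-x.1) := by
    rw [neg_add, ← sub_eq_add_neg, exp_sub, exp_two_pi_mul_I, div_one]
  have h2 : qlow (x.1 + 2 * Real.pi * I, x.2) = qlow x + (1:ℤ) := by
    have h3 : (2 * Real.pi * I : ℂ) ≠ 0 := two_pi_I_ne_zero
    simp only [qlow, h1]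
    field_simp
    push_cast; ring
  have h3 : ee 1 (x.2 + D x.2 - (qlow x + (1:ℤ) + D (qlow x))) =
      ee 1 (x.2 + D x.2 - (qlow x + D (qlow x))) :=
    (ee_eq_iff one_ne_zero).2 ⟨-1, by push_cast; ring⟩
  simp only [lowLog, h1, h2, h.per, EE, h3]

/-- A globally defined logarithm, with its normalisation and asymptotics. -/
theorem exists_cover_log : ∃ l : ℂ × ℂ → ℂ, Continuous l ∧
    (∀ x, exp (l x) = NN D (1 + exp x.1, x.2) / -exp x.1) ∧ (∀ z, l (Real.pi * I, z) = 0) ∧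
    (∀ z ζ, ∀ k : ℤ, l (ζ + k * (2 * Real.pi * I), z) = l (ζ, z)) ∧
    ∃ c : ℤ, ∀ x : ℂ × ℂ, 4 * Real.pi * E + 1 < x.1.re →
      l x = lowLog D x + 2 * Real.pi * I * c := by
  have hN := h.continuous_NN
  obtain ⟨l, hl, he⟩ := exists_continuous_log
    (g := fun x : ℂ × ℂ => NN D (1 + exp x.1, x.2) / -exp x.1)
    (Continuous.div (by fun_prop) (by fun_prop) fun x => neg_ne_zero.2 (exp_ne_zero _))
    (fun x => div_ne_zero (fun h0 => exp_ne_zero x.1 (by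
      simpa using h.eq_one_of_NN h0)) (neg_ne_zero.2 (exp_ne_zero _)))
  have hpi : ∀ z, exp (l (Real.pi * I, z)) = 1 := by
    intro z
    rw [he, exp_pi_mul_I]
    simp [NN]
  obtain ⟨a, ha⟩ := log_unique_univ (f := fun z => l (Real.pi * I, z)) (g := fun _ => 0)
    (by fun_prop) continuous_const (fun z => by rw [hpi]; simp)
  have hW : IsPreconnected {x : ℂ × ℂ | 4 * Real.pi * E + 1 < x.1.re} := by
    refine Convex.isPreconnected ?_
    exact (convex_halfSpace_gt (f := fun x : ℂ × ℂ => x.1.re)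
      ⟨fun _ _ => by simp, fun _ _ => by simp⟩ _)
  obtain ⟨b, hb⟩ := log_unique hW hl.continuousOn h.continuousOn_lowLog
    (fun x hx => by rw [he, h.exp_lowLog hx])
  obtain ⟨m, hm⟩ := log_unique_univ (f := fun x : ℂ × ℂ => l (x.1 + 2 * Real.pi * I, x.2))
    (g := l) (by fun_prop) hl (fun x => by
      rw [he, he]; simp only [exp_add, exp_two_pi_mul_I, mul_one])
  have hm0 : (2 * Real.pi * I * m : ℂ) = 0 := by
    have hx : 4 * Real.pi * E + 1 < (((4 * Real.pi * E + 2 : ℝ) : ℂ)).re := by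
      rw [ofReal_re]; linarith
    have h1 := hm (((4 * Real.pi * E + 2 : ℝ) : ℂ), 0)
    rw [hb (((4 * Real.pi * E + 2 : ℝ) : ℂ), 0) hx,
      hb _ (by simp)] at h1
    rw [h.lowLog_add_two_pi (((4 * Real.pi * E + 2 : ℝ) : ℂ), 0)] at h1
    simpa using h1
  have hper1 : ∀ z ζ, l (ζ + 2 * Real.pi * I, z) = l (ζ, z) := fun z ζ => by
    have := hm (ζ, z)
    rw [hm0, add_zero] at this
    exact this
  refine ⟨fun x => l x - 2 * Real.pi * I * a, by fun_prop, fun x => ?_, fun z => ?_, ?_, b - a, ?_⟩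
  · rw [exp_sub, mul_comm _ (a:ℂ), exp_int_mul_two_pi_mul_I, div_one, he]
  · have := ha z
    simp only [zero_add] at this
    simp only [this, sub_self]
  · intro z ζ k
    have hp : Function.Periodic (fun ζ => l (ζ, z)) (2 * Real.pi * I) := hper1 z
    have := hp.int_mul k ζ
    simp only at this ⊢
    rw [this]
  · intro x hx
    simp only [hb x hx]; push_cast; ring

end IsDisp

namespace IsDisp

variable {D : ℂ → ℂ} {E : ℝ} (h : IsDisp D E)
include h

/-- The logarithm of the distortion of `EE 1 · z` under `q ↦ q + D q`. -/
theorem exists_distortion_log : ∃ c : ℤ, ∀ z : ℂ, ∃ Λ : ℂ → ℂ,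
    (∀ q : ℂ, (∀ k : ℤ, q - z ≠ k) → ContinuousAt Λ q) ∧
    (∀ q : ℂ, (∀ k : ℤ, q - z ≠ k) → exp (Λ q) * EE 1 q z = EE 1 (q + D q) (z + D z)) ∧
    Tendsto Λ (comap im atTop) (𝓝 0) ∧
    Tendsto (fun q => Λ q - 2 * Real.pi * I * (D q - D z)) (comap im atBot)
      (𝓝 (2 * Real.pi * I * c)) := by
  obtain ⟨l, hl, he, hl0, hper, c, hc⟩ := h.exists_cover_log
  refine ⟨c, fun z => ?_⟩
  have hee := continuous_ee 1
  have hne : ∀ q : ℂ, (∀ k : ℤ, q - z ≠ k) → ee 1 (q - z) - 1 ≠ 0 := fun q hq h0 => by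
    obtain ⟨k, hk⟩ := (ee_eq_one_iff one_ne_zero).1 (sub_eq_zero.1 h0)
    exact hq k (by simpa using hk)
  refine ⟨fun q => l (log (ee 1 (q - z) - 1), z), fun q hq => ?_, fun q hq => ?_, ?_, ?_⟩
  · have h1 := continuousAt_comp_log hl hper (hne q hq) z
    have h2 : ContinuousAt (fun q => (ee 1 (q - z) - 1, z)) q := by fun_prop
    exact ContinuousAt.comp (f := fun q => (ee 1 (q - z) - 1, z)) h1 h2
  · have h0 := hne q hq
    simp only [he, exp_log h0, add_sub_cancel, h.NN_ee, neg_sub]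
    exact div_mul_cancel₀ _ (EE_ne_zero_of_forall_ne one_ne_zero hq)
  · have h1 := continuousAt_comp_log hl hper (u := -1) (by simp) z
    have h2 : Tendsto (fun q => (ee 1 (q - z) - 1, z)) (comap im atTop) (𝓝 (-1, z)) := by
      refine Tendsto.prodMk_nhds ?_ tendsto_const_nhds
      simpa using (tendsto_ee_top one_ne_zero z).sub_const 1
    have h3 := h1.tendsto.comp h2
    simp only [log_neg_one, hl0] at h3
    exact h3
  · have t0 := tendsto_ee_bot one_ne_zero z
    have t1 : Tendsto (fun q => ee 1 (z - q) * ee 1 (D z - D q)) (comap im atBot) (𝓝 0) := by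
      refine squeeze_zero_norm (a := fun q => ‖ee 1 (z - q)‖ * Real.exp (4 * Real.pi * E))
        (fun q => ?_) ?_
      · rw [norm_mul]
        exact mul_le_mul_of_nonneg_left (h.norm_ee_le _ _) (norm_nonneg _)
      · simpa using t0.norm.mul_const (Real.exp (4 * Real.pi * E))
    have t2 : Tendsto (fun q => log ((1 - ee 1 (z - q))⁻¹) +
        log (1 - ee 1 (z - q) * ee 1 (D z - D q)) + 2 * Real.pi * I * c) (comap im atBot)
        (𝓝 (2 * Real.pi * I * c)) := by
      have a1 : Tendsto (fun q => (1 - ee 1 (z - q))⁻¹) (comap im atBot) (𝓝 1) := by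
        have := (tendsto_const_nhds (x := (1:ℂ))).sub t0
        simpa using this.inv₀ (by simp)
      have a2 : Tendsto (fun q => 1 - ee 1 (z - q) * ee 1 (D z - D q)) (comap im atBot) (𝓝 1) := by
        simpa using (tendsto_const_nhds (x := (1:ℂ))).sub t1
      have := ((a1.clog (by simp)).add (a2.clog (by simp))).add_const (2 * Real.pi * I * c : ℂ)
      simpa using this
    refine t2.congr' ?_
    set A := Real.exp (4 * Real.pi * E + 1) with hA
    have hA0 : 0 < A := Real.exp_pos _
    have ev : ∀ᶠ q in comap im atBot, ‖ee 1 (z - q)‖ < (A + 1)⁻¹ := by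
      have := t0.norm
      rw [norm_zero] at this
      exact this.eventually (gt_mem_nhds (by positivity))
    filter_upwards [ev] with q hq
    have e1 : ee 1 (z - q) = (ee 1 (q - z))⁻¹ := by rw [← ee_neg, neg_sub]
    have n0 := ee_ne_zero 1 (q - z)
    have hbig : A + 1 < ‖ee 1 (q - z)‖ := by
      rw [e1, norm_inv] at hq
      exact (inv_lt_inv₀ (norm_pos_iff.2 n0) (by positivity)).1 hq
    have hbig' : A < ‖ee 1 (q - z) - 1‖ := by
      have := norm_sub_norm_le (ee 1 (q - z)) 1
      rw [norm_one] at this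
      linarith
    have n1 : ee 1 (q - z) - 1 ≠ 0 := norm_pos_iff.1 (hA0.trans hbig')
    have hre : 4 * Real.pi * E + 1 < (log (ee 1 (q - z) - 1)).re := by
      rw [log_re]
      exact (Real.lt_log_iff_exp_lt (hA0.trans hbig')).2 hbig'
    have hE : 0 ≤ E := (norm_nonneg _).trans (h.bound 0)
    have hq := ee_qlow (x := (log (ee 1 (q - z) - 1), z))
      (by simp only; nlinarith [mul_nonneg Real.pi_pos.le hE])
    simp only [exp_log n1, add_sub_cancel] at hq
    rw [hc (log (ee 1 (q - z) - 1), z) hre, lowLog]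
    set Q := qlow (log (ee 1 (q - z) - 1), z) with hQ
    have hQq : ee 1 Q = ee 1 q := by
      rw [ee_sub, ee_sub] at hq
      exact (div_left_inj' (ee_ne_zero 1 z)).1 hq
    have hDQ : D Q = D q := h.eq_of_ee_eq hQq
    have b1 : 1 + exp (-log (ee 1 (q - z) - 1)) = (1 - ee 1 (z - q))⁻¹ := by
      rw [exp_neg, exp_log n1, e1]
      field_simp
      ring
    have b2 : EE 1 (z + D z) (Q + D Q) = 1 - ee 1 (z - q) * ee 1 (D z - D q) := by
      rw [EE, show z + D z - (Q + D Q) = (z - Q) + (D z - D Q) by ring, ee_add, hDQ, ee_sub, hQq,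
        ← ee_sub]
    rw [b2]
    simp only [b1, hDQ]
    ring

omit h in
theorem tendsto_symm {Φ : ℂ ≃ₜ ℂ} (h : IsDisp (fun q => Φ q - q) E) (A : Set ℂ) :
    Tendsto Φ.symm (comap im atBot ⊓ 𝓟 (Φ '' A)) (comap im atBot ⊓ 𝓟 A) ∧
    Tendsto Φ.symm (comap im atTop ⊓ 𝓟 (Φ '' A)) (comap im atTop ⊓ 𝓟 A) := by
  have hA : Tendsto Φ.symm (𝓟 (Φ '' A)) (𝓟 A) := by
    rw [tendsto_principal_principal]
    rintro _ ⟨q, hq, rfl⟩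
    simpa using hq
  have hb : ∀ q, |(q - Φ.symm q).im| ≤ E := fun q => by
    have := (abs_im_le_norm _).trans (h.bound (Φ.symm q))
    simpa using this
  constructor
  · refine tendsto_inf.2 ⟨Tendsto.mono_left (tendsto_comap_iff.2 ?_) inf_le_left,
      tendsto_inf_right hA⟩
    refine tendsto_atBot_mono (f := fun q : ℂ => q.im + E) (fun q => ?_)
      (tendsto_atBot_add_const_right _ _ tendsto_comap)
    have := (abs_le.1 (hb q)).1
    simp only [sub_im] at this
    simp only [Function.comp]; linarith
  · refine tendsto_inf.2 ⟨Tendsto.mono_left (tendsto_comap_iff.2 ?_) inf_le_left,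
      tendsto_inf_right hA⟩
    refine tendsto_atTop_mono (f := fun q : ℂ => q.im + -E) (fun q => ?_)
      (tendsto_atTop_add_const_right _ _ tendsto_comap)
    have := (abs_le.1 (hb q)).2
    simp only [sub_im] at this
    simp only [Function.comp]; linarith

omit h in
/-- Logarithms and degrees can be pushed forward by a homeomorphism. -/
theorem exists_push {Φ : ℂ ≃ₜ ℂ} (h : IsDisp (fun q => Φ q - q) E) (z w : ℂ) : ∃ Λ : ℂ → ℂ,
    (∀ (A : Set ℂ) (G : ℂ → ℂ), (∀ q ∈ A, ∀ k : ℤ, q + k ∈ A) → z ∉ A → w ∉ A →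
      IsLog 1 A z w G →
      IsLog 1 (Φ '' A) (Φ z) (Φ w) (fun q => G (Φ.symm q) + Λ (Φ.symm q))) ∧
    (∀ (GX GY : ℂ → ℂ) (κ : ℝ → ℂ) (d : ℤ), ContinuousOn κ (Icc 0 1) →
      (∀ t ∈ Icc (0:ℝ) 1, ∀ k : ℤ, κ t - z ≠ k) → (∀ t ∈ Icc (0:ℝ) 1, ∀ k : ℤ, κ t - w ≠ k) →
      IsDeg 1 z w GX GY κ d →
      IsDeg 1 (Φ z) (Φ w) (fun q => GX (Φ.symm q) + Λ (Φ.symm q))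
        (fun q => GY (Φ.symm q) + Λ (Φ.symm q)) (fun t => Φ (κ t)) d) := by
  obtain ⟨c, hc⟩ := h.exists_distortion_log
  obtain ⟨Λz, cz, ez, tz, bz⟩ := hc z
  obtain ⟨Λw, cw, ew, tw, bw⟩ := hc w
  simp only [add_sub_cancel] at ez ew
  have hmul : ∀ q, (∀ k : ℤ, q - z ≠ k) → (∀ k : ℤ, q - w ≠ k) → ∀ g : ℂ,
      exp g * EE 1 q w = EE 1 q z →
      exp (g + (Λz q - Λw q)) * EE 1 (Φ q) (Φ w) = EE 1 (Φ q) (Φ z) := by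
    intro q hz hw g hg
    rw [exp_add, exp_sub, ← ez q hz, ← ew q hw, ← hg]
    field_simp [exp_ne_zero (Λw q)]
  have ttop : Tendsto (fun q => Λz q - Λw q) (comap im atTop) (𝓝 0) := by
    simpa using tz.sub tw
  have tbot : Tendsto (fun q => Λz q - Λw q) (comap im atBot)
      (𝓝 (2 * Real.pi * I * ((Φ w - w) - (Φ z - z)))) := by
    have := (bz.sub bw).add_const (2 * Real.pi * I * ((Φ w - w) - (Φ z - z)))
    rw [sub_self, zero_add] at this
    refine this.congr fun q => ?_
    ring
  refine ⟨fun q => Λz q - Λw q, fun A G inv hz hw hG => ?_, fun GX GY κ d hκ hz hw hd => ?_⟩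
  · have hz' : ∀ q ∈ A, ∀ k : ℤ, q - z ≠ k := fun q hq k hk => hz (by
      have := inv q hq (-k)
      convert this using 1
      push_cast; linear_combination -hk)
    have hw' : ∀ q ∈ A, ∀ k : ℤ, q - w ≠ k := fun q hq k hk => hw (by
      have := inv q hq (-k)
      convert this using 1
      push_cast; linear_combination -hk)
    have hmap : MapsTo Φ.symm (Φ '' A) A := by
      rintro _ ⟨q, hq, rfl⟩
      simpa using hq
    refine ⟨?_, ?_, ?_, ?_⟩
    · refine ContinuousOn.comp (g := fun q => G q + (Λz q - Λw q)) ?_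
        Φ.symm.continuous.continuousOn hmap
      exact hG.cont.add fun q hq =>
        ((cz q (hz' q hq)).sub (cw q (hw' q hq))).continuousWithinAt
    · rintro _ ⟨q, hq, rfl⟩
      simp only [Homeomorph.symm_apply_apply]
      exact hmul q (hz' q hq) (hw' q hq) _ (hG.exp_eq q hq)
    · have := (hG.bot.add (tbot.mono_left inf_le_left)).comp (tendsto_symm h A).1
      have e : 2 * Real.pi * I * (Φ w - Φ z) / (1:ℕ) = 2 * Real.pi * I * (w - z) / (1:ℕ) +
          2 * Real.pi * I * (Φ w - w - (Φ z - z)) := by push_cast; ring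
      rw [e]
      exact this
    · have := (hG.top.add (ttop.mono_left inf_le_left)).comp (tendsto_symm h A).2
      rw [add_zero] at this
      exact this
  · obtain ⟨l, hl, he, h0, h1⟩ := hd
    refine ⟨fun t => l t + (Λz (κ t) - Λw (κ t)), ?_, fun t ht => ?_, ?_, ?_⟩
    · refine hl.add fun t ht => ?_
      exact (((cz _ (hz t ht)).sub (cw _ (hw t ht))).comp_continuousWithinAt (hκ t ht))
    · exact hmul _ (hz t ht) (hw t ht) _ (he t ht)
    · simp [h0]
    · simp only [Homeomorph.symm_apply_apply, h1]; ring

end IsDisp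

/-- A lift of a torus homeomorphism with bounded vertical deviation from an irrational `α`. -/
structure Sys (F : ℂ ≃ₜ ℂ) (α M E : ℝ) : Prop where
  re_per : ∀ (q : ℂ) (k : ℤ), F (q + k) = F q + k
  im_per : ∀ (q : ℂ) (k : ℤ), F (q + k * I) = F q + k * I
  dev : ∀ (n : ℤ) (q : ℂ), |((F ^ n) q).im - q.im - n * α| ≤ M
  irr : Irrational α
  disp : ∀ q, ‖F q - q‖ ≤ E

/-- The union of the translated images of the half-plane `σ * im < r`. -/
def side (F : ℂ ≃ₜ ℂ) (α σ r : ℝ) : Set ℂ := {z | ∃ n : ℤ, σ * (((F ^ n) z).im - n * α) < r}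

/-- A closed path connected exhaustion of `side`. -/
def core (F : ℂ ≃ₜ ℂ) (α σ r : ℝ) (N : ℕ) : Set ℂ :=
  ⋃ n ∈ Icc (-N : ℤ) N, {z | σ * (((F ^ n) z).im - n * α) ≤ r - 1 / (N + 1)}

theorem comm_zpow {F : ℂ ≃ₜ ℂ} {c : ℂ} (h : ∀ q, F (q + c) = F q + c) (n : ℤ) (q : ℂ) :
    (F ^ n) (q + c) = (F ^ n) q + c := by
  have h1 : Commute F (Homeomorph.addRight c) := by
    ext q
    simp [Homeomorph.mul_apply, h]
  have h2 := (h1.zpow_left n).eq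
  have h3 := congrArg (fun H : ℂ ≃ₜ ℂ => H q) h2
  simpa [Homeomorph.mul_apply] using h3

theorem side_mono (F : ℂ ≃ₜ ℂ) (α σ : ℝ) {r r' : ℝ} (h : r ≤ r') : side F α σ r ⊆ side F α σ r' :=
  fun _ ⟨n, hn⟩ => ⟨n, hn.trans_le h⟩

theorem core_subset_side (F : ℂ ≃ₜ ℂ) (α σ r : ℝ) (N : ℕ) : core F α σ r N ⊆ side F α σ r := by
  intro z hz
  simp only [core, mem_iUnion] at hz
  obtain ⟨n, hn, hz⟩ := hz
  have h1 : (0:ℝ) < 1 / (N + 1) := by positivity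
  simp only [mem_ofPred_eq] at hz
  exact ⟨n, by linarith⟩

theorem eventually_mem_core {F : ℂ ≃ₜ ℂ} {α σ r : ℝ} {z : ℂ} (hz : z ∈ side F α σ r) :
    ∀ᶠ N in atTop, z ∈ core F α σ r N := by
  obtain ⟨n, hn⟩ := hz
  have h1 := tendsto_one_div_add_atTop_nhds_zero_nat (𝕜 := ℝ)
  filter_upwards [h1.eventually (gt_mem_nhds (sub_pos.2 hn)), eventually_ge_atTop n.natAbs]
    with N hN hN'
  simp only [core, mem_iUnion, mem_Icc]
  refine ⟨n, ⟨by omega, by omega⟩, ?_⟩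
  simp only [mem_ofPred_eq]
  linarith

theorem isOpen_side (F : ℂ ≃ₜ ℂ) (α σ r : ℝ) : IsOpen (side F α σ r) := by
  have : side F α σ r = ⋃ n : ℤ, {z | σ * (((F ^ n) z).im - n * α) < r} := by
    ext z; simp [side]
  rw [this]
  refine isOpen_iUnion fun n => isOpen_lt ?_ continuous_const
  have := (F ^ n).continuous
  fun_prop

theorem isClosed_core (F : ℂ ≃ₜ ℂ) (α σ r : ℝ) (N : ℕ) : IsClosed (core F α σ r N) := by
  refine (Set.finite_Icc _ _).isClosed_biUnion fun n _ => isClosed_le ?_ continuous_const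
  have := (F ^ n).continuous
  fun_prop

namespace Sys

variable {F : ℂ ≃ₜ ℂ} {α M E : ℝ} (h : Sys F α M E)
include h

theorem zpow_add_int (n : ℤ) (q : ℂ) (k : ℤ) : (F ^ n) (q + k) = (F ^ n) q + k :=
  comm_zpow (fun q => h.re_per q k) n q

theorem zpow_add_int_I (n : ℤ) (q : ℂ) (k : ℤ) : (F ^ n) (q + k * I) = (F ^ n) q + k * I :=
  comm_zpow (fun q => h.im_per q k) n q

theorem side_add_int {σ r : ℝ} {z : ℂ} (hz : z ∈ side F α σ r) (k : ℤ) : z + k ∈ side F α σ r := by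
  obtain ⟨n, hn⟩ := hz
  exact ⟨n, by simpa [h.zpow_add_int] using hn⟩

theorem core_add_int {σ r : ℝ} {N : ℕ} {z : ℂ} (hz : z ∈ core F α σ r N) (k : ℤ) :
    z + k ∈ core F α σ r N := by
  simp only [core, mem_iUnion, mem_Icc, mem_ofPred_eq] at hz ⊢
  obtain ⟨n, hn, hz⟩ := hz
  exact ⟨n, hn, by simpa [h.zpow_add_int] using hz⟩

theorem closure_side_add_int {σ r : ℝ} {z : ℂ} (hz : z ∈ closure (side F α σ r)) (k : ℤ) :
    z + k ∈ closure (side F α σ r) :=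
  map_mem_closure (f := fun z => z + (k:ℂ)) (by fun_prop) hz fun _ hw => h.side_add_int hw k

theorem side_add_int_I {σ r : ℝ} {z : ℂ} (k : ℤ) :
    z + k * I ∈ side F α σ (r + σ * k) ↔ z ∈ side F α σ r := by
  simp only [side, mem_ofPred_eq, h.zpow_add_int_I]
  refine exists_congr fun n => ?_
  simp only [add_im, mul_im, intCast_re, I_im, mul_one, intCast_im, I_re, mul_zero, add_zero]
  constructor <;> intro h <;> linarith

omit h in
theorem side_zpow {σ r : ℝ} {z : ℂ} (j : ℤ) :
    (F ^ j) z ∈ side F α σ (r + σ * (j * α)) ↔ z ∈ side F α σ r := by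
  simp only [side, mem_ofPred_eq]
  constructor
  · rintro ⟨n, hn⟩
    refine ⟨n + j, ?_⟩
    rw [zpow_add, Homeomorph.mul_apply]
    push_cast
    linarith
  · rintro ⟨n, hn⟩
    refine ⟨n - j, ?_⟩
    rw [← Homeomorph.mul_apply, ← zpow_add, sub_add_cancel]
    push_cast
    linarith

omit h in
theorem half_subset_side {σ r : ℝ} {z : ℂ} (hz : σ * z.im < r) : z ∈ side F α σ r :=
  ⟨0, by simpa using hz⟩

theorem dev' {σ : ℝ} (hσ : σ * σ = 1) (n : ℤ) (q : ℂ) :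
    |σ * (((F ^ n) q).im - n * α) - σ * q.im| ≤ M := by
  have h1 := h.dev n q
  have h2 : |σ| = 1 := by
    rcases mul_self_eq_one_iff.1 hσ with rfl | rfl <;> simp
  have : σ * (((F ^ n) q).im - n * α) - σ * q.im = σ * (((F ^ n) q).im - q.im - n * α) := by ring
  rw [this, abs_mul, h2, one_mul]
  exact h1

theorem lt_of_mem_side {σ r : ℝ} (hσ : σ * σ = 1) {z : ℂ} (hz : z ∈ side F α σ r) :
    σ * z.im < r + M := by
  obtain ⟨n, hn⟩ := hz
  linarith [(abs_le.1 (h.dev' hσ n z)).1]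

theorem le_of_mem_closure_side {σ r : ℝ} (hσ : σ * σ = 1) {z : ℂ}
    (hz : z ∈ closure (side F α σ r)) : σ * z.im ≤ r + M := by
  have h1 : IsClosed {z : ℂ | σ * z.im ≤ r + M} := isClosed_le (by fun_prop) continuous_const
  exact h1.closure_subset_iff.2 (fun z hz => (h.lt_of_mem_side hσ hz).le) hz

omit h in
theorem convex_half (σ c : ℝ) : Convex ℝ {z : ℂ | σ * z.im < c} := by
  have : {z : ℂ | σ * z.im < c} = (σ • imLm) ⁻¹' Iio c := by ext; simp
  rw [this]
  exact (convex_Iio c).linear_preimage _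

omit h in
theorem convex_half_le (σ c : ℝ) : Convex ℝ {z : ℂ | σ * z.im ≤ c} := by
  have : {z : ℂ | σ * z.im ≤ c} = (σ • imLm) ⁻¹' Iic c := by ext; simp
  rw [this]
  exact (convex_Iic c).linear_preimage _

theorem preconnected_side {σ r : ℝ} (hσ : σ * σ = 1) : IsPreconnected (side F α σ r) := by
  have : side F α σ r = ⋃ n : ℤ, {z | σ * (((F ^ n) z).im - n * α) < r} := by
    ext z; simp [side]
  rw [this]
  refine isPreconnected_iUnion ⟨(σ * (r - M - 1) : ℝ) * I, ?_⟩ fun n => ?_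
  · refine mem_iInter.2 fun n => ?_
    have := (abs_le.1 (h.dev' hσ n ((σ * (r - M - 1) : ℝ) * I))).2
    simp only [mul_im, ofReal_re, I_im, mul_one, ofReal_im, I_re, mul_zero, add_zero] at this
    rw [← mul_assoc, hσ] at this
    simp only [mem_ofPred_eq]
    linarith
  · have : {z | σ * (((F ^ n) z).im - n * α) < r} =
        (F ^ n).symm '' {z : ℂ | σ * z.im < r + σ * (n * α)} := by
      rw [Homeomorph.image_symm]
      ext z
      simp only [mem_ofPred_eq, mem_preimage]
      constructor <;> intro h <;> linarith
    rw [this]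
    exact (convex_half _ _).isPreconnected.image _ (F ^ n).symm.continuous.continuousOn

theorem pathConnected_core {σ r : ℝ} (hσ : σ * σ = 1) (N : ℕ) :
    IsPathConnected (core F α σ r N) := by
  set p : ℂ := (σ * (r - M - 1) : ℝ) * I with hp
  have hpm : ∀ n : ℤ, σ * (((F ^ n) p).im - n * α) ≤ r - 1 / (N + 1) := by
    intro n
    have := (abs_le.1 (h.dev' hσ n p)).2
    simp only [hp, mul_im, ofReal_re, I_im, mul_one, ofReal_im, I_re, mul_zero, add_zero] at this
    rw [← mul_assoc, hσ] at this
    have h1 : (1:ℝ) / (N + 1) ≤ 1 := by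
      rw [div_le_one (by positivity)]
      have : (0:ℝ) ≤ N := N.cast_nonneg
      linarith
    linarith
  refine ⟨p, ?_, ?_⟩
  · simp only [core, mem_iUnion, mem_Icc, mem_ofPred_eq]
    exact ⟨0, by omega, hpm 0⟩
  · intro z hz
    simp only [core, mem_iUnion] at hz
    obtain ⟨n, hn, hz⟩ := hz
    have : {z | σ * (((F ^ n) z).im - n * α) ≤ r - 1 / (N + 1)} =
        (F ^ n).symm '' {z : ℂ | σ * z.im ≤ r - 1 / (N + 1) + σ * (n * α)} := by
      rw [Homeomorph.image_symm]
      ext z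
      simp only [mem_ofPred_eq, mem_preimage]
      constructor <;> intro h <;> linarith
    have hpc : IsPathConnected {z | σ * (((F ^ n) z).im - n * α) ≤ r - 1 / (N + 1)} := by
      rw [this]
      refine IsPathConnected.image ?_ (F ^ n).symm.continuous
      refine (convex_half_le _ _).isPathConnected ⟨(F ^ n) p, ?_⟩
      have := hpm n
      simp only [mem_ofPred_eq]
      linarith
    refine (hpc.joinedIn p (hpm n) z hz).mono ?_
    intro x hx
    simp only [core, mem_iUnion]
    exact ⟨n, hn, hx⟩

theorem isSide {σ : ℝ} (r : ℝ) (hσ : σ * σ = 1) : IsSide (closure (side F α σ r)) where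
  closed := isClosed_closure
  preconn := (h.preconnected_side hσ).closure
  inv := fun q hq k => h.closure_side_add_int hq k
  far := by
    rcases mul_self_eq_one_iff.1 hσ with rfl | rfl
    · left
      have h1 : Tendsto (fun y : ℝ => (y : ℂ) * I) atBot
          (comap im atBot ⊓ 𝓟 (closure (side F α 1 r))) := by
        refine tendsto_inf.2 ⟨tendsto_comap_iff.2 ?_, tendsto_principal.2 ?_⟩
        · convert tendsto_id using 1
          ext; simp
        · filter_upwards [eventually_lt_atBot r] with y hy
          exact subset_closure (half_subset_side (by simpa using hy))
      exact h1.neBot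
    · right
      have h1 : Tendsto (fun y : ℝ => (y : ℂ) * I) atTop
          (comap im atTop ⊓ 𝓟 (closure (side F α (-1) r))) := by
        refine tendsto_inf.2 ⟨tendsto_comap_iff.2 ?_, tendsto_principal.2 ?_⟩
        · convert tendsto_id using 1
          ext; simp
        · filter_upwards [eventually_gt_atTop (-r)] with y hy
          exact subset_closure (half_subset_side (by simp; linarith))
      exact h1.neBot

end Sys

theorem subset_connectedComponentIn_or {A B : Set ℂ} (hA : IsClosed A)
    (hA' : IsPreconnected A) (hB' : IsPreconnected B) (hA0 : A.Nonempty)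
    (hAB : Disjoint A B) (z : ℂ) :
    B ⊆ connectedComponentIn Aᶜ z ∨ A ⊆ connectedComponentIn Bᶜ z := by
  by_cases hzA : z ∈ A
  · exact Or.inr (hA'.subset_connectedComponentIn hzA hAB.subset_compl_right)
  set Q := connectedComponentIn Aᶜ z with hQ
  have hzQ : z ∈ Q := mem_connectedComponentIn hzA
  have hQo : IsOpen Q := hA.isOpen_compl.connectedComponentIn
  have hQA : Q ⊆ Aᶜ := connectedComponentIn_subset _ _
  by_cases hQB : (Q ∩ B).Nonempty
  · obtain ⟨x, hxQ, hxB⟩ := hQB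
    left
    rw [hQ, connectedComponentIn_eq hxQ]
    exact hB'.subset_connectedComponentIn hxB hAB.subset_compl_left
  right
  have hQp : IsPreconnected Q := isPreconnected_connectedComponentIn
  have hx : (closure Q ∩ A).Nonempty := by
    by_contra hn
    have h1 : closure Q ⊆ Aᶜ := fun x hx hxA => hn ⟨x, hx, hxA⟩
    have h2 : closure Q ⊆ Q := hQp.closure.subset_connectedComponentIn (subset_closure hzQ) h1
    have h3 : IsClopen Q := ⟨isClosed_of_closure_subset h2, hQo⟩
    obtain ⟨a, ha⟩ := hA0
    have : a ∈ Q := by rw [h3.eq_univ ⟨z, hzQ⟩]; trivial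
    exact hQA this ha
  obtain ⟨x, hxQ, hxA⟩ := hx
  have h1 : IsPreconnected (insert x Q) :=
    hQp.subset_closure (subset_insert _ _) (insert_subset hxQ subset_closure)
  have h2 : IsPreconnected (insert x Q ∪ A) := h1.union x (mem_insert _ _) hxA hA'
  refine subset_trans subset_union_right
    (h2.subset_connectedComponentIn (Or.inl (mem_insert_of_mem _ hzQ)) ?_)
  rintro y ((rfl | hy) | hy) hyB
  · exact hAB.le_bot ⟨hxA, hyB⟩
  · exact hQB ⟨y, hy, hyB⟩
  · exact hAB.le_bot ⟨hy, hyB⟩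

/-- `z` lies in the component of the complement of `closure (side F α σ r)` containing
every point far enough on its side of the plane. -/
def Far (F : ℂ ≃ₜ ℂ) (α σ r : ℝ) (z : ℂ) : Prop :=
  ∃ B : ℝ, ∀ q : ℂ, B < σ * q.im → q ∈ connectedComponentIn (closure (side F α σ r))ᶜ z

namespace Far

variable {F : ℂ ≃ₜ ℂ} {α σ r : ℝ} {z w : ℂ}

theorem mono (hz : Far F α σ r z) {r' : ℝ} (h : r' ≤ r) : Far F α σ r' z := by
  obtain ⟨B, hB⟩ := hz
  exact ⟨B, fun q hq => connectedComponentIn_mono _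
    (compl_subset_compl.2 (closure_mono (side_mono F α σ h))) (hB q hq)⟩

theorem exists_mem (hσ : σ * σ = 1) (hz : Far F α σ r z) (hw : Far F α σ r w) :
    ∃ q, q ∈ connectedComponentIn (closure (side F α σ r))ᶜ z ∧
      q ∈ connectedComponentIn (closure (side F α σ r))ᶜ w := by
  obtain ⟨B, hB⟩ := hz
  obtain ⟨B', hB'⟩ := hw
  refine ⟨(σ * (max B B' + 1) : ℝ) * I, hB _ ?_, hB' _ ?_⟩ <;>
    simp only [mul_im, ofReal_re, I_im, mul_one, ofReal_im, I_re, mul_zero, add_zero] <;>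
    rw [← mul_assoc, hσ]
  · linarith [le_max_left B B']
  · linarith [le_max_right B B']

theorem notMem (hσ : σ * σ = 1) (hz : Far F α σ r z) : z ∉ closure (side F α σ r) := by
  obtain ⟨q, hq, _⟩ := hz.exists_mem hσ hz
  exact connectedComponentIn_nonempty_iff.1 ⟨q, hq⟩

theorem le (hσ : σ * σ = 1) (hz : Far F α σ r z) : r ≤ σ * z.im := by
  by_contra hn
  exact hz.notMem hσ (subset_closure (Sys.half_subset_side (not_le.1 hn)))

theorem homeo (hz : Far F α σ r z) {Φ : ℂ ≃ₜ ℂ} {r' c : ℝ}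
    (hΦ : ∀ q, Φ q ∈ side F α σ r' ↔ q ∈ side F α σ r)
    (hc : ∀ q, σ * (Φ q).im ≤ σ * q.im + c) : Far F α σ r' (Φ z) := by
  obtain ⟨B, hB⟩ := hz
  refine ⟨B + c, fun q hq => ?_⟩
  have h1 : Φ.symm q ∈ connectedComponentIn (closure (side F α σ r))ᶜ z := by
    refine hB _ ?_
    have := hc (Φ.symm q)
    rw [Φ.apply_symm_apply] at this
    linarith
  have hz' : z ∈ (closure (side F α σ r))ᶜ := by
    by_contra hz
    rw [connectedComponentIn_eq_empty hz] at h1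
    exact h1
  have h2 : Φ '' (closure (side F α σ r))ᶜ = (closure (side F α σ r'))ᶜ := by
    rw [image_compl_eq Φ.bijective, Φ.image_closure]
    congr 2
    ext q
    constructor
    · rintro ⟨x, hx, rfl⟩
      exact (hΦ x).2 hx
    · intro hq
      exact ⟨Φ.symm q, (hΦ _).1 (by simpa using hq), by simp⟩
  rw [← h2, ← Φ.image_connectedComponentIn hz']
  exact ⟨_, h1, by simp⟩

end Far

namespace Sys

variable {F : ℂ ≃ₜ ℂ} {α M E : ℝ} (h : Sys F α M E)
include h

theorem far_add_int {σ r : ℝ} {z : ℂ} (hz : Far F α σ r z) (k : ℤ) : Far F α σ r (z + k) := by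
  refine hz.homeo (Φ := Homeomorph.addRight (k : ℂ)) (c := 0) (fun q => ⟨fun hq => ?_, fun hq => h.side_add_int hq k⟩)
    (fun q => by simp)
  simpa using h.side_add_int hq (-k)

theorem far_add_int_I {σ r : ℝ} {z : ℂ} (hz : Far F α σ r z) (k : ℤ) :
    Far F α σ (r + σ * k) (z + k * I) :=
  hz.homeo (Φ := Homeomorph.addRight (k * I : ℂ)) (c := σ * k) (fun q => h.side_add_int_I k)
    (fun q => by simp [mul_add])

theorem far_zpow {σ r : ℝ} (hσ : σ * σ = 1) {z : ℂ} (hz : Far F α σ r z) (j : ℤ) :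
    Far F α σ (r + σ * (j * α)) ((F ^ j) z) := by
  refine hz.homeo (Φ := F ^ j) (c := σ * (j * α) + M) (fun q => side_zpow j) fun q => ?_
  linarith [(abs_le.1 (h.dev' hσ j q)).2]

theorem far_of_lt {σ r : ℝ} (hσ : σ * σ = 1) {z : ℂ} (hz : r + M < σ * z.im) : Far F α σ r z := by
  refine ⟨r + M, fun q hq => ?_⟩
  have hc : IsPreconnected {z : ℂ | r + M < σ * z.im} := by
    have : {z : ℂ | r + M < σ * z.im} = {z : ℂ | (-σ) * z.im < -(r + M)} := by
      ext z; simp only [mem_ofPred_eq]; constructor <;> intro h <;> linarith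
    rw [this]
    exact (convex_half _ _).isPreconnected
  have hs : {z : ℂ | r + M < σ * z.im} ⊆ (closure (side F α σ r))ᶜ := fun x hx hx' =>
    absurd (h.le_of_mem_closure_side hσ hx') (not_le.2 hx)
  exact hc.subset_connectedComponentIn hz hs hq

theorem far_or_far {θ s : ℝ} (hd : Disjoint (closure (side F α 1 θ)) (closure (side F α (-1) (-s))))
    (z : ℂ) : Far F α 1 θ z ∨ Far F α (-1) (-s) z := by
  have hne : (closure (side F α 1 θ)).Nonempty :=
    ⟨(θ - 1 : ℝ) * I, subset_closure (half_subset_side (by simp))⟩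
  rcases subset_connectedComponentIn_or isClosed_closure (h.isSide θ (one_mul 1)).preconn
    (h.isSide (-s) (by norm_num : (-1:ℝ) * -1 = 1)).preconn hne hd z with h1 | h1
  · exact Or.inl ⟨s, fun q hq => h1 (subset_closure (half_subset_side (by linarith)))⟩
  · exact Or.inr ⟨-θ, fun q hq => h1 (subset_closure (half_subset_side (by linarith)))⟩

/-- Every point lies above a lower side and below an upper side, with optimal gap. -/
theorem exists_far {G η : ℝ} (hη : 0 < η)
    (hd : ∀ θ, Disjoint (closure (side F α 1 θ)) (closure (side F α (-1) (-(θ + G))))) (z : ℂ) :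
    ∃ r, z.im - M - η - 1 ≤ r ∧ r ≤ z.im ∧ Far F α 1 r z ∧ Far F α (-1) (-(r + η + G)) z := by
  set T := {r | Far F α 1 r z} with hT
  have hb : BddAbove T := ⟨z.im, fun r hr => by simpa using hr.le (one_mul 1)⟩
  have h1 : z.im - M - 1 ∈ T := h.far_of_lt (one_mul 1) (by linarith)
  obtain ⟨r, hr, hr'⟩ := exists_lt_of_lt_csSup ⟨_, h1⟩ (show sSup T - η < sSup T by linarith)
  have h2 : max r (z.im - M - 1) ∈ T := by
    rcases max_cases r (z.im - M - 1) with ⟨h, -⟩ | ⟨h, -⟩ <;> rw [h] <;> assumption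
  refine ⟨max r (z.im - M - 1), ?_, by simpa using h2.le (one_mul 1), h2, ?_⟩
  · linarith [le_max_right r (z.im - M - 1)]
  · refine (h.far_or_far (hd (max r (z.im - M - 1) + η)) z).resolve_left fun h3 => ?_
    have := le_csSup hb h3
    linarith [le_max_left r (z.im - M - 1)]

theorem exists_isLog_of_far {σ r : ℝ} (hσ : σ * σ = 1) {z w : ℂ} (hz : Far F α σ r z)
    (hw : Far F α σ r w) {p : ℕ} (hp : p ≠ 0) :
    ∃ G C, IsLog p (closure (side F α σ r)) z w G ∧
      ∀ q ∈ closure (side F α σ r), |(G q).im| ≤ C := by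
  obtain ⟨q, hq, hq'⟩ := hz.exists_mem hσ hw
  have h1 := (connectedComponentIn_eq hq).trans (connectedComponentIn_eq hq').symm
  refine exists_isLog hp isClosed_closure (h.isSide r hσ).inv
    (S := connectedComponentIn (closure (side F α σ r))ᶜ z) isPreconnected_connectedComponentIn
    (connectedComponentIn_subset _ _) (mem_connectedComponentIn (hz.notMem hσ)) ?_
  rw [h1]
  exact mem_connectedComponentIn (hw.notMem hσ)

theorem exists_int_mem_Icc {a b : ℝ} (hab : a < b) : ∃ j m : ℤ, (j * α + m : ℝ) ∈ Ioo a b := by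
  have h1 := (dense_addSubgroupClosure_pair_iff (a := α) (b := 1)).2 (by simpa using h.irr)
  obtain ⟨x, hx, hx'⟩ := h1.exists_mem_open isOpen_Ioo (nonempty_Ioo.2 hab)
  obtain ⟨j, m, rfl⟩ := AddSubgroup.mem_closure_pair.1 hx
  exact ⟨j, m, by simpa using hx'⟩

theorem exists_gap : ∃ G : ℝ, 0 ≤ G ∧
    (∀ g, G < g → ∀ θ, Disjoint (closure (side F α 1 θ)) (closure (side F α (-1) (-(θ + g))))) ∧
    (∀ g, g < G → ∀ θ, (closure (side F α 1 θ) ∩ closure (side F α (-1) (-(θ + g)))).Nonempty) := by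
  set T := {g | ∀ θ, Disjoint (closure (side F α 1 θ)) (closure (side F α (-1) (-(θ + g))))} with hT
  have hs : (-1:ℝ) * -1 = 1 := by norm_num
  have h0 : ∀ g ∈ T, 0 ≤ g := by
    intro g hg
    by_contra hn
    have hmem : ∀ σ r, σ * (g / 2) < r → ((g / 2 : ℝ) * I : ℂ) ∈ closure (side F α σ r) :=
      fun σ r hr => subset_closure (half_subset_side (by simpa using hr))
    refine disjoint_left.1 (hg 0) (hmem _ _ ?_) (hmem _ _ ?_)
    · linarith
    · linarith
  have hT0 : 2 * M + 1 ∈ T := by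
    intro θ
    refine disjoint_left.2 fun z hz hz' => ?_
    have h1 := h.le_of_mem_closure_side (one_mul 1) hz
    have h2 := h.le_of_mem_closure_side hs hz'
    linarith
  have hTup : ∀ g ∈ T, ∀ g', g ≤ g' → g' ∈ T := fun g hg g' hgg θ =>
    (hg θ).mono_right (closure_mono (side_mono _ _ _ (by linarith)))
  have hTb : BddBelow T := ⟨0, h0⟩
  refine ⟨sInf T, le_csInf ⟨_, hT0⟩ h0, fun g hg => ?_, fun g hg θ => ?_⟩
  · obtain ⟨g', hg', hgg⟩ := exists_lt_of_csInf_lt ⟨_, hT0⟩ hg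
    exact hTup _ hg' _ hgg.le
  · obtain ⟨g', h1, h2⟩ := exists_between hg
    have h3 : g' ∉ T := fun h3 => absurd (csInf_le hTb h3) (not_le.2 h2)
    simp only [hT, mem_ofPred_eq, not_forall] at h3
    obtain ⟨θ₀, hθ₀⟩ := h3
    obtain ⟨q, hq, hq'⟩ := Set.not_disjoint_iff.1 hθ₀
    obtain ⟨j, m, hjm, hjm'⟩ := h.exists_int_mem_Icc
      (show θ - (g' - g) - θ₀ < θ - θ₀ by linarith)
    have key : ∀ σ r r' : ℝ, r + σ * (j * α) + σ * m ≤ r' → q ∈ closure (side F α σ r) →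
        (F ^ j) q + m * I ∈ closure (side F α σ r') := by
      intro σ r r' hr hq
      refine map_mem_closure (f := fun q => (F ^ j) q + m * I) ?_ hq fun x hx => ?_
      · have := (F ^ j).continuous
        fun_prop
      · exact side_mono _ _ _ hr ((h.side_add_int_I m).2 ((side_zpow j).2 hx))
    exact ⟨(F ^ j) q + m * I, key _ _ _ (by linarith) hq, key _ _ _ (by linarith) hq'⟩

end Sys

theorem exists_isArc_of_segment {X Y : Set ℂ} (hX : IsClosed X) (hY : IsClosed Y)
    (hXY : Disjoint X Y) {p d z w : ℂ} (hp : p ∈ X) (hp' : p + d ∈ Y) (hd : |d.re| < 1)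
    (hz : ∀ t : ℝ, ∀ k : ℤ, p + t * d - z ≠ k) (hw : ∀ t : ℝ, ∀ k : ℤ, p + t * d - w ≠ k) :
    ∃ κ, IsArc z w X Y κ ∧ ∀ t ∈ Icc (0:ℝ) 1, ∃ t' ∈ Icc (0:ℝ) 1, κ t = p + t' * d := by
  have hd0 : d ≠ 0 := by
    rintro rfl
    exact disjoint_left.1 hXY hp (by simpa using hp')
  set γ : ℝ → ℂ := fun t => p + t * d with hγ
  have hγc : Continuous γ := by fun_prop
  obtain ⟨t₀, ⟨ht₀, ht₀X⟩, hmax⟩ := (isCompact_Icc.inter_right (hX.preimage hγc)).exists_isGreatest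
    (⟨0, by simp, by simpa [hγ] using hp⟩ : (Icc (0:ℝ) 1 ∩ γ ⁻¹' X).Nonempty)
  obtain ⟨t₁, ⟨ht₁, ht₁Y⟩, hmin⟩ := ((isCompact_Icc (a := t₀) (b := (1:ℝ))).inter_right
    (hY.preimage hγc)).exists_isLeast ⟨1, ⟨ht₀.2, le_rfl⟩, by simpa [hγ] using hp'⟩
  have h01 : t₀ < t₁ := by
    refine lt_of_le_of_ne ht₁.1 fun he => ?_
    rw [← he] at ht₁Y
    exact disjoint_left.1 hXY ht₀X ht₁Y
  have hpos : 0 < t₁ - t₀ := by linarith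
  have hs : ∀ t ∈ Icc (0:ℝ) 1, t₀ ≤ t₀ + t * (t₁ - t₀) ∧ t₀ + t * (t₁ - t₀) ≤ t₁ := by
    rintro t ⟨h0, h1⟩
    constructor
    · nlinarith
    · nlinarith
  have hs' : ∀ t ∈ Icc (0:ℝ) 1, t₀ + t * (t₁ - t₀) ∈ Icc (0:ℝ) 1 := fun t ht =>
    ⟨ht₀.1.trans (hs t ht).1, (hs t ht).2.trans ht₁.2⟩
  refine ⟨fun t => γ (t₀ + t * (t₁ - t₀)), ⟨by fun_prop, ?_, ?_, ?_, ?_, ?_, ?_, ?_⟩, ?_⟩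
  · simpa using ht₀X
  · simpa using ht₁Y
  · intro t ht htX
    have := hmax ⟨hs' t ht, htX⟩
    have h2 : t * (t₁ - t₀) ≤ 0 := by linarith
    nlinarith [ht.1]
  · intro t ht htY
    have := hmin ⟨⟨(hs t ht).1, (hs' t ht).2⟩, htY⟩
    nlinarith [ht.2]
  · intro s hs1 t ht1 k hk
    have h1 := hs' s hs1
    have h2 := hs' t ht1
    set a := t₀ + s * (t₁ - t₀) with ha
    set b := t₀ + t * (t₁ - t₀) with hb
    have h3 : ((a - b : ℝ) : ℂ) * d = k := by
      simp only [hγ] at hk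
      push_cast
      linear_combination hk
    have h4 : (a - b) * d.re = k := by simpa using congrArg re h3
    have h5 : |(k:ℝ)| < 1 := by
      rw [← h4, abs_mul]
      have : |a - b| ≤ 1 := abs_le.2 ⟨by linarith [h1.1, h2.2], by linarith [h1.2, h2.1]⟩
      nlinarith [abs_nonneg d.re, abs_nonneg (a - b)]
    have h6 : k = 0 := by
      have : |k| < 1 := by exact_mod_cast h5
      exact Int.abs_lt_one_iff.1 this
    rw [h6, Int.cast_zero, mul_eq_zero, or_iff_left hd0] at h3
    have h7 : a - b = 0 := by exact_mod_cast h3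
    have h8 : (s - t) * (t₁ - t₀) = 0 := by rw [← h7, ha, hb]; ring
    rcases mul_eq_zero.1 h8 with h | h <;> linarith
  · exact fun t _ k => hz _ k
  · exact fun t _ k => hw _ k
  · exact fun t ht => ⟨_, hs' t ht, rfl⟩

theorem exists_avoiding_line {U V : Set ℂ} (hU : IsOpen U) (hV : IsOpen V) {p d : ℂ} (hd : d ≠ 0)
    (hp : p ∈ U) (hp' : p + d ∈ V) (z w : ℂ) :
    ∃ q ∈ U, q + d ∈ V ∧ (∀ t : ℝ, ∀ k : ℤ, q + t * d - z ≠ k) ∧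
      ∀ t : ℝ, ∀ k : ℤ, q + t * d - w ≠ k := by
  set bad : ℂ → Set ℝ := fun z => range fun k : ℤ => ((z + k - p) / d).im with hbad
  have hc : (bad z ∪ bad w).Countable := (countable_range _).union (countable_range _)
  have ho : IsOpen {ε : ℝ | p + ε * I * d ∈ U ∧ p + ε * I * d + d ∈ V} :=
    (hU.preimage (by fun_prop : Continuous fun ε : ℝ => p + ε * I * d)).inter
      (hV.preimage (by fun_prop : Continuous fun ε : ℝ => p + ε * I * d + d))
  obtain ⟨ε, ⟨h1, h2⟩, h3⟩ := (hc.dense_compl ℝ).inter_open_nonempty _ ho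
    ⟨0, by simpa using ⟨hp, hp'⟩⟩
  have key : ∀ z, ε ∉ bad z → ∀ t : ℝ, ∀ k : ℤ, p + ε * I * d + t * d - z ≠ k := by
    intro z hz t k hk
    refine hz ⟨k, ?_⟩
    have : (z + k - p) / d = t + ε * I := by
      rw [← hk]; field_simp; ring
    simp [this]
  exact ⟨p + ε * I * d, h1, h2, key z fun h => h3 (Or.inl h), key w fun h => h3 (Or.inr h)⟩

theorem Sys.isDisp {F : ℂ ≃ₜ ℂ} {α M E : ℝ} (h : Sys F α M E) : IsDisp (fun q => F q - q) E where
  cont := F.continuous.sub continuous_id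
  per := fun q k => by simp [h.re_per]
  bound := h.disp
  inj := fun q z k hk => ⟨k, F.injective (by rw [h.re_per]; simpa using hk)⟩

/-- One step of the comparison of degrees along an orbit. -/
theorem IsDisp.step {Φ : ℂ ≃ₜ ℂ} {E : ℝ} (h : IsDisp (fun q => Φ q - q) E)
    (hΦ : ∀ (q : ℂ) (k : ℤ), Φ (q + k) = Φ q + k) {z w : ℂ}
    (hzw : ∀ k : ℤ, z - w ≠ k) {A B X Y : Set ℂ} (hA : IsSide A) (hB : IsSide B)
    (hA' : IsSide (Φ '' A)) (hB' : IsSide (Φ '' B))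
    (hzA : z ∉ A) (hzB : z ∉ B) (hwA : w ∉ A) (hwB : w ∉ B) (hXA : X ⊆ A) (hYB : Y ⊆ B)
    (hX : IsPathConnected X) (hY : IsPathConnected Y) (hXi : ∀ q ∈ X, ∀ k : ℤ, q + k ∈ X)
    (hYi : ∀ q ∈ Y, ∀ k : ℤ, q + k ∈ Y) (hXY : Disjoint X Y) {p : ℕ} (hp : p ≠ 0)
    (hHX : ∃ H, IsLog p (Φ '' A) (Φ z) (Φ w) H) (hHY : ∃ H, IsLog p (Φ '' B) (Φ z) (Φ w) H)
    {κ κ' : ℝ → ℂ} (hκ : IsArc z w X Y κ) (hκ' : IsArc (Φ z) (Φ w) (Φ '' X) (Φ '' Y) κ') {j : ℤ}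
    (hdis : ∀ s ∈ Icc (0:ℝ) 1, ∀ t ∈ Icc (0:ℝ) 1, ∀ k : ℤ, Φ (κ s) ≠ κ' t + j + k * p)
    {GX GY : ℂ → ℂ} {d : ℤ} (hGX : IsLog 1 A z w GX) (hGY : IsLog 1 B z w GY)
    (hd : IsDeg 1 z w GX GY κ d) :
    ∃ GX' GY', IsLog 1 (Φ '' A) (Φ z) (Φ w) GX' ∧ IsLog 1 (Φ '' B) (Φ z) (Φ w) GY' ∧
      ∃ d', IsDeg 1 (Φ z) (Φ w) GX' GY' κ' d' ∧ |d - d'| ≤ p := by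
  obtain ⟨Λ, h1, h2⟩ := h.exists_push z w
  obtain ⟨HX, hHX⟩ := hHX
  obtain ⟨HY, hHY⟩ := hHY
  have hGX' := h1 A GX hA.inv hzA hwA hGX
  have hGY' := h1 B GY hB.inv hzB hwB hGY
  have hd1 := h2 GX GY κ d hκ.cont hκ.avoid_left hκ.avoid_right hd
  have hwA' : Φ w ∉ Φ '' A := fun hw => hwA (by simpa using hw)
  have hwB' : Φ w ∉ Φ '' B := fun hw => hwB (by simpa using hw)
  have hinv : ∀ X : Set ℂ, (∀ q ∈ X, ∀ k : ℤ, q + k ∈ X) → ∀ q ∈ Φ '' X, ∀ k : ℤ, q + k ∈ Φ '' X := by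
    rintro X hX _ ⟨q, hq, rfl⟩ k
    exact ⟨q + k, hX q hq k, hΦ q k⟩
  have hXY' : Disjoint (Φ '' X) (Φ '' Y) := (disjoint_image_iff Φ.injective).2 hXY
  have hne : ∀ a b : ℂ, ∀ k : ℤ, a - b ≠ k → Φ a - Φ b ≠ k := by
    intro a b k hab he
    refine hab ?_
    have : Φ a = Φ (b + k) := by rw [hΦ, ← he]; ring
    rw [Φ.injective this]; ring
  have hFκ : IsArc (Φ z) (Φ w) (Φ '' X) (Φ '' Y) fun t => Φ (κ t) := by
    refine ⟨Φ.continuous.comp_continuousOn hκ.cont, ⟨_, hκ.left, rfl⟩, ⟨_, hκ.right, rfl⟩, ?_, ?_, ?_, ?_, ?_⟩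
    · exact fun t ht htX => hκ.eq_zero t ht (by simpa using htX)
    · exact fun t ht htX => hκ.eq_one t ht (by simpa using htX)
    · intro s hs t ht k hk
      rw [← hΦ] at hk
      exact hκ.inj s hs t ht k (Φ.injective hk)
    · exact fun t ht k => hne _ _ _ (hκ.avoid_left t ht k)
    · exact fun t ht k => hne _ _ _ (hκ.avoid_right t ht k)
  obtain ⟨d', hd'⟩ := hκ'.exists_isDeg one_ne_zero
    (GX := fun q => GX (Φ.symm q) + Λ (Φ.symm q)) (GY := fun q => GY (Φ.symm q) + Λ (Φ.symm q))
    (hGX'.exp_eq _ (image_mono hXA hκ'.left)) (hGY'.exp_eq _ (image_mono hYB hκ'.right))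
  exact ⟨_, _, hGX', hGY', d', hd', deg_compare hp (fun k => hne z w k (hzw k)) hA' hB' hwA' hwB'
    (image_mono hXA) (image_mono hYB) (hX.image Φ.continuous) (hY.image Φ.continuous)
    (hinv X hXi) (hinv Y hYi) hXY' hGX' hGY' hHX hHY hFκ hκ' j hdis hd1 hd'⟩

/-- The lower side at height `θ` and the upper side at height `θ + g` are `τ`-separated. -/
def Wide (F : ℂ ≃ₜ ℂ) (α g τ θ : ℝ) : Prop :=
  ∀ p ∈ side F α 1 θ, ∀ p' ∈ side F α (-1) (-(θ + g)), τ ≤ ‖p' - p‖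

theorem le_norm_sub_of_mem_closure {S : Set ℂ} {q : ℂ} {c : ℝ} (h : ∀ p ∈ S, c ≤ ‖q - p‖) :
    ∀ p ∈ closure S, c ≤ ‖q - p‖ := by
  have h1 : IsClosed {p : ℂ | c ≤ ‖q - p‖} := isClosed_le continuous_const (by fun_prop)
  exact h1.closure_subset_iff.2 h

namespace Sys

variable {F : ℂ ≃ₜ ℂ} {α M E : ℝ} (h : Sys F α M E)
include h

theorem wide_add_int {g τ θ : ℝ} (hw : Wide F α g τ θ) (m : ℤ) : Wide F α g τ (θ + m) := by
  intro p hp p' hp'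
  have h1 := (h.side_add_int_I (-m)).2 hp
  have h2 := (h.side_add_int_I (-m)).2 hp'
  have h3 := hw (p + (-m : ℤ) * I) (by convert h1 using 2; push_cast; ring)
    (p' + (-m : ℤ) * I) (by convert h2 using 2; push_cast; ring)
  simpa using h3

theorem exists_wide_witness {G τ δ θ : ℝ} (hG0 : 0 ≤ G) (hδ : 0 < δ) (hδ1 : δ ≤ 1)
    (hG : ∀ g, g < G → ∀ θ,
      (closure (side F α 1 θ) ∩ closure (side F α (-1) (-(θ + g)))).Nonempty)
    (hθ : θ ∈ Ico (0:ℝ) 1) (hw : Wide F α (G + 2 * δ) τ θ) :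
    ∃ q ∈ Icc (0:ℝ) 1 ×ℂ Icc (-M) (M + 2), q ∈ closure (side F α 1 (θ + δ)) ∧
      q ∈ closure (side F α (-1) (-(θ + G))) ∧
      ∃ b : Bool, (b = true → ∀ p ∈ side F α 1 θ, τ / 2 ≤ ‖q - p‖) ∧
        (b = false → ∀ p ∈ side F α (-1) (-(θ + (G + 2 * δ))), τ / 2 ≤ ‖q - p‖) := by
  obtain ⟨q, hq, hq'⟩ := hG (G - δ) (by linarith) (θ + δ)
  have e : θ + δ + (G - δ) = θ + G := by ring
  rw [e] at hq'
  have h1 := h.le_of_mem_closure_side (one_mul 1) hq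
  have h2 := h.le_of_mem_closure_side (by norm_num) hq'
  refine ⟨q + (-⌊q.re⌋ : ℤ), ?_, h.closure_side_add_int hq _, h.closure_side_add_int hq' _, ?_⟩
  · rw [mem_reProdIm]
    simp only [add_re, intCast_re, add_im, intCast_im, neg_re, neg_im, neg_zero, add_zero, mem_Icc, Int.cast_neg]
    refine ⟨⟨?_, ?_⟩, ?_, ?_⟩
    · linarith [Int.floor_le q.re]
    · linarith [Int.lt_floor_add_one q.re]
    · linarith [hθ.1]
    · linarith [hθ.2]
  · generalize q + (-⌊q.re⌋ : ℤ) = q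
    by_cases hc : ∀ p ∈ side F α 1 θ, τ / 2 ≤ ‖q - p‖
    · exact ⟨true, fun _ => hc, by simp⟩
    · push Not at hc
      obtain ⟨p, hp, hpq⟩ := hc
      refine ⟨false, by simp, fun _ p' hp' => ?_⟩
      have h3 := hw p hp p' hp'
      have h4 := norm_sub_le_norm_sub_add_norm_sub p' q p
      rw [norm_sub_rev p' q] at h4
      linarith

theorem exists_wide_card {G τ : ℝ} (hτ : 0 < τ) (hG0 : 0 ≤ G)
    (hG : ∀ g, g < G → ∀ θ,
      (closure (side F α 1 θ) ∩ closure (side F α (-1) (-(θ + g)))).Nonempty) :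
    ∃ Q : ℕ, ∀ δ, 0 < δ → δ ≤ 1 → ∀ T : Finset ℝ, (∀ θ ∈ T, θ ∈ Ico (0:ℝ) 1) →
      (∀ θ ∈ T, ∀ θ' ∈ T, θ < θ' → θ + 2 * δ ≤ θ') →
      (∀ θ ∈ T, Wide F α (G + 2 * δ) τ θ) → T.card ≤ Q := by
  have hK : IsCompact (Icc (0:ℝ) 1 ×ℂ Icc (-M) (M + 2)) := isCompact_Icc.reProdIm isCompact_Icc
  obtain ⟨t, -, htf, ht⟩ := hK.finite_cover_balls (show 0 < τ / 4 by linarith)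
  lift t to Finset ℂ using htf
  refine ⟨((Finset.univ : Finset Bool) ×ˢ t).card, fun δ hδ hδ1 T hT hsep hwide => ?_⟩
  have hex : ∀ θ : ℝ, ∃ (q c : ℂ) (b : Bool), θ ∈ T → c ∈ t ∧ q ∈ ball c (τ / 4) ∧
      q ∈ closure (side F α 1 (θ + δ)) ∧ q ∈ closure (side F α (-1) (-(θ + G))) ∧
      (b = true → ∀ p ∈ side F α 1 θ, τ / 2 ≤ ‖q - p‖) ∧
        (b = false → ∀ p ∈ side F α (-1) (-(θ + (G + 2 * δ))), τ / 2 ≤ ‖q - p‖) := by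
    intro θ
    by_cases hθ : θ ∈ T
    · obtain ⟨q, hq, h1, h2, b, h3, h4⟩ :=
        h.exists_wide_witness hG0 hδ hδ1 hG (hT θ hθ) (hwide θ hθ)
      obtain ⟨c, hc, hqc⟩ := mem_iUnion₂.1 (ht hq)
      exact ⟨q, c, b, fun _ => ⟨hc, hqc, h1, h2, h3, h4⟩⟩
    · exact ⟨0, 0, true, fun hn => absurd hn hθ⟩
  choose q c b hqcb using hex
  have key : ∀ θ ∈ T, ∀ θ' ∈ T, (b θ, c θ) = (b θ', c θ') → ¬ θ < θ' := by
    intro θ hθ θ' hθ' heq hlt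
    obtain ⟨hb, hc⟩ := Prod.mk.inj heq
    obtain ⟨-, hq, h1, h2, h3, h4⟩ := hqcb θ hθ
    obtain ⟨-, hq', h1', h2', h3', h4'⟩ := hqcb θ' hθ'
    have hs := hsep θ hθ θ' hθ' hlt
    rw [mem_ball_iff_norm] at hq hq'
    have hqq : ‖q θ - q θ'‖ < τ / 2 := by
      have h5 := norm_sub_le_norm_sub_add_norm_sub (q θ) (c θ) (q θ')
      rw [norm_sub_rev (c θ), hc] at h5
      rw [hc] at hq
      linarith
    cases hbθ : b θ
    · have h5 := le_norm_sub_of_mem_closure (h4 hbθ) (q θ')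
        (closure_mono (side_mono F α (-1) (by linarith)) h2')
      linarith
    · have h5 := le_norm_sub_of_mem_closure (h3' (hb ▸ hbθ)) (q θ)
        (closure_mono (side_mono F α 1 (by linarith)) h1)
      rw [norm_sub_rev] at h5
      linarith
  refine Finset.card_le_card_of_injOn (fun θ => (b θ, c θ)) (fun θ hθ => ?_) ?_
  · exact Finset.mem_coe.2 (Finset.mem_product.2 ⟨Finset.mem_univ _, (hqcb θ hθ).1⟩)
  · intro θ hθ θ' hθ' heq
    exact le_antisymm (not_lt.1 (key θ' hθ' θ hθ heq.symm)) (not_lt.1 (key θ hθ θ' hθ' heq))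

omit h in
theorem _root_.TorusRot.exists_sep {α : ℝ} (hα : Irrational α) (R : ℕ) : ∃ δ : ℝ, 0 < δ ∧ δ ≤ 1 ∧
    ∀ j : ℕ, 1 ≤ j → j < R → ∀ m : ℤ, 2 * δ ≤ |j * α - m| := by
  induction R with
  | zero => exact ⟨1, one_pos, le_rfl, fun j _ hj => by omega⟩
  | succ R ih =>
    obtain ⟨δ, h0, h1, h2⟩ := ih
    rcases Nat.eq_zero_or_pos R with rfl | hR
    · exact ⟨1, one_pos, le_rfl, fun j _ hj => by omega⟩
    have h3 : 0 < |R * α - round (R * α)| :=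
      abs_pos.2 (sub_ne_zero.2 ((hα.natCast_mul hR.ne').ne_int _))
    refine ⟨min δ (|R * α - round (R * α)| / 2), by positivity, (min_le_left _ _).trans h1, ?_⟩
    intro j hj hj' m
    rcases (Nat.lt_succ_iff_lt_or_eq.1 hj') with hlt | rfl
    · exact (mul_le_mul_of_nonneg_left (min_le_left _ _) (by norm_num)).trans (h2 j hj hlt m)
    · have := round_le (j * α) m
      linarith [min_le_right δ (|j * α - round (j * α)| / 2)]

theorem wide_count {g τ δ θ : ℝ} {Q R : ℕ} (hR : 0 < R) (hδ : 0 < δ)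
    (hsep : ∀ j : ℕ, 1 ≤ j → j < R → ∀ m : ℤ, 2 * δ ≤ |j * α - m|)
    (hQ : ∀ T : Finset ℝ, (∀ θ ∈ T, θ ∈ Ico (0:ℝ) 1) →
      (∀ θ ∈ T, ∀ θ' ∈ T, θ < θ' → θ + 2 * δ ≤ θ') →
      (∀ θ ∈ T, Wide F α g τ θ) → T.card ≤ Q) (n : ℕ) (S : Finset ℕ) (hSn : ∀ k ∈ S, k ≤ n)
    (hS : ∀ k ∈ S, Wide F α g τ (θ + k * α)) : S.card ≤ Q * (n / R + 1) := by
  have himg : (S.image (· / R)).card ≤ n / R + 1 := by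
    have : S.image (· / R) ⊆ Finset.range (n / R + 1) := by
      intro b hb
      obtain ⟨k, hk, rfl⟩ := Finset.mem_image.1 hb
      exact Finset.mem_range.2 (Nat.lt_succ_of_le (Nat.div_le_div_right (hSn k hk)))
    simpa using Finset.card_le_card this
  refine (Finset.card_le_mul_card_image (f := (· / R)) S Q fun b _ => ?_).trans
    (Nat.mul_le_mul_left _ himg)
  have hd : ∀ k l : ℕ, k / R = b → l / R = b → k < l → ∀ m : ℤ,
      2 * δ ≤ |(θ + l * α) - (θ + k * α) - m| := by
    intro k l hk hl hkl m
    have hb : l - k < R := by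
      have h1 := Nat.div_add_mod k R
      have h2 := Nat.div_add_mod l R
      have h3 := Nat.mod_lt l hR
      rw [hk] at h1
      rw [hl] at h2
      omega
    have := hsep (l - k) (by omega) hb m
    rw [Nat.cast_sub hkl.le] at this
    convert this using 2
    ring
  have hd' : ∀ k l : ℕ, k / R = b → l / R = b → k ≠ l →
      2 * δ ≤ |Int.fract (θ + l * α) - Int.fract (θ + k * α)| := by
    intro k l hk hl hkl
    have e : ∀ x y : ℝ, Int.fract x - Int.fract y = x - y - (⌊x⌋ - ⌊y⌋ : ℤ) := by
      intro x y
      push_cast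
      rw [Int.fract, Int.fract]
      ring
    rcases hkl.lt_or_gt with hlt | hlt
    · rw [e]
      exact hd k l hk hl hlt _
    · rw [abs_sub_comm, e]
      exact hd l k hl hk hlt _
  set B := S.filter (fun k => k / R = b) with hB
  have hinj : Set.InjOn (fun k : ℕ => Int.fract (θ + k * α)) B := by
    intro k hk l hl hkl
    by_contra hne
    have := hd' k l (Finset.mem_filter.1 hk).2 (Finset.mem_filter.1 hl).2 hne
    simp only at hkl
    rw [hkl, sub_self, abs_zero] at this
    linarith
  rw [← Finset.card_image_of_injOn hinj]
  refine hQ _ ?_ ?_ ?_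
  · intro x hx
    obtain ⟨k, hk, rfl⟩ := Finset.mem_image.1 hx
    exact ⟨Int.fract_nonneg _, Int.fract_lt_one _⟩
  · intro x hx y hy hxy
    obtain ⟨k, hk, rfl⟩ := Finset.mem_image.1 hx
    obtain ⟨l, hl, rfl⟩ := Finset.mem_image.1 hy
    have hne : k ≠ l := by rintro rfl; exact lt_irrefl _ hxy
    have := hd' k l (Finset.mem_filter.1 hk).2 (Finset.mem_filter.1 hl).2 hne
    rw [abs_of_pos (by linarith)] at this
    linarith
  · intro x hx
    obtain ⟨k, hk, rfl⟩ := Finset.mem_image.1 hx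
    have h1 := h.wide_add_int (hS k (Finset.mem_filter.1 hk).1) (-⌊θ + k * α⌋)
    convert h1 using 1
    rw [Int.fract]
    push_cast
    ring

end Sys

/-- Degrees along an orbit change by at most the sum of the comparison widths. -/
theorem IsDisp.orbit_compare {Φ : ℂ ≃ₜ ℂ} {E : ℝ} (h : IsDisp (fun q => Φ q - q) E)
    (hΦ : ∀ (q : ℂ) (k : ℤ), Φ (q + k) = Φ q + k) {z w : ℕ → ℂ} {A B X Y : ℕ → Set ℂ}
    {κ : ℕ → ℝ → ℂ} {p : ℕ → ℕ} {n : ℕ}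
    (hz : ∀ k, z (k + 1) = Φ (z k)) (hw : ∀ k, w (k + 1) = Φ (w k))
    (hAΦ : ∀ k, A (k + 1) = Φ '' A k) (hBΦ : ∀ k, B (k + 1) = Φ '' B k)
    (hXΦ : ∀ k, X (k + 1) = Φ '' X k) (hYΦ : ∀ k, Y (k + 1) = Φ '' Y k)
    (hzw : ∀ k : ℤ, z 0 - w 0 ≠ k) (hA : ∀ k, IsSide (A k)) (hB : ∀ k, IsSide (B k))
    (hzA : ∀ k, z k ∉ A k) (hzB : ∀ k, z k ∉ B k) (hwA : ∀ k, w k ∉ A k) (hwB : ∀ k, w k ∉ B k)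
    (hXA : ∀ k, X k ⊆ A k) (hYB : ∀ k, Y k ⊆ B k)
    (hX : ∀ k, IsPathConnected (X k)) (hY : ∀ k, IsPathConnected (Y k))
    (hXi : ∀ k, ∀ q ∈ X k, ∀ m : ℤ, q + m ∈ X k) (hYi : ∀ k, ∀ q ∈ Y k, ∀ m : ℤ, q + m ∈ Y k)
    (hXY : ∀ k, Disjoint (X k) (Y k)) (hp : ∀ k, p k ≠ 0)
    (hHX : ∀ k, ∃ H, IsLog (p k) (A (k + 1)) (z (k + 1)) (w (k + 1)) H)
    (hHY : ∀ k, ∃ H, IsLog (p k) (B (k + 1)) (z (k + 1)) (w (k + 1)) H)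
    (hκ : ∀ k ≤ n, IsArc (z k) (w k) (X k) (Y k) (κ k))
    (hdis : ∀ k < n, ∃ j : ℤ, ∀ s ∈ Icc (0:ℝ) 1, ∀ t ∈ Icc (0:ℝ) 1, ∀ m : ℤ,
      Φ (κ k s) ≠ κ (k + 1) t + j + m * p k)
    {GX GY : ℂ → ℂ} {d : ℤ} (hGX : IsLog 1 (A 0) (z 0) (w 0) GX)
    (hGY : IsLog 1 (B 0) (z 0) (w 0) GY) (hd : IsDeg 1 (z 0) (w 0) GX GY (κ 0) d) :
    ∀ k ≤ n, ∃ GX' GY', IsLog 1 (A k) (z k) (w k) GX' ∧ IsLog 1 (B k) (z k) (w k) GY' ∧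
      ∃ d', IsDeg 1 (z k) (w k) GX' GY' (κ k) d' ∧ |d - d'| ≤ ∑ i ∈ Finset.range k, (p i : ℤ) := by
  have hzw' : ∀ k, ∀ m : ℤ, z k - w k ≠ m := by
    intro k
    induction k with
    | zero => exact hzw
    | succ k ih =>
      intro m he
      refine ih m ?_
      have : Φ (z k) = Φ (w k + m) := by rw [hΦ, ← hz, ← hw, ← he]; ring
      rw [Φ.injective this]; ring
  intro k
  induction k with
  | zero => exact fun _ => ⟨GX, GY, hGX, hGY, d, hd, by simp⟩
  | succ k ih =>
    intro hk
    obtain ⟨GX', GY', h1, h2, d', h3, h4⟩ := ih (by omega)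
    obtain ⟨j, hj⟩ := hdis k (by omega)
    have a1 := hA (k + 1)
    have a2 := hB (k + 1)
    have a3 := hκ (k + 1) hk
    have a4 := hHX k
    have a5 := hHY k
    rw [hAΦ] at a1 a4
    rw [hBΦ] at a2 a5
    rw [hXΦ, hYΦ] at a3
    rw [hz, hw] at a3 a4 a5
    obtain ⟨GX₁, GY₁, g1, g2, d₁, g3, g4⟩ := h.step hΦ (hzw' k) (hA k) (hB k) a1 a2 (hzA k) (hzB k)
      (hwA k) (hwB k) (hXA k) (hYB k) (hX k) (hY k) (hXi k) (hYi k) (hXY k) (hp k) a4 a5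
      (hκ k (by omega)) a3 hj h1 h2 h3
    rw [hz, hw, hAΦ, hBΦ]
    refine ⟨GX₁, GY₁, g1, g2, d₁, g3, ?_⟩
    rw [Finset.sum_range_succ]
    calc |d - d₁| ≤ |d - d'| + |d' - d₁| := abs_sub_le _ _ _
      _ ≤ _ := add_le_add h4 g4

/-- Two points together with logarithms of bounded imaginary part on both sides. -/
structure Pair (F : ℂ ≃ₜ ℂ) (α θ s C : ℝ) (z w : ℂ) : Prop where
  zlow : Far F α 1 θ z
  wlow : Far F α 1 θ w
  zup : Far F α (-1) (-s) z
  wup : Far F α (-1) (-s) w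
  logX : ∃ G, IsLog 1 (closure (side F α 1 θ)) z w G ∧
    ∀ q ∈ closure (side F α 1 θ), |(G q).im - 2 * Real.pi * (w.re - z.re)| ≤ C
  logY : ∃ G, IsLog 1 (closure (side F α (-1) (-s))) z w G ∧
    ∀ q ∈ closure (side F α (-1) (-s)), |(G q).im| ≤ C

namespace Sys

variable {F : ℂ ≃ₜ ℂ} {α M E : ℝ} (h : Sys F α M E)
include h

theorem exists_line {θ g τ : ℝ} (hd : Disjoint (closure (side F α 1 θ))
    (closure (side F α (-1) (-(θ + g))))) (V : Prop) (z w : ℂ) :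
    ∃ p d : ℂ, p ∈ side F α 1 θ ∧ p + d ∈ side F α (-1) (-(θ + g)) ∧
      (∀ t : ℝ, ∀ k : ℤ, p + t * d - z ≠ k) ∧ (∀ t : ℝ, ∀ k : ℤ, p + t * d - w ≠ k) ∧
      (d.re = 0 ∨ ‖d‖ < τ) ∧ (V → d.re = 0) ∧ (¬ V → ¬ Wide F α g τ θ → ‖d‖ < τ) := by
  have key : ∀ p d : ℂ, p ∈ side F α 1 θ → p + d ∈ side F α (-1) (-(θ + g)) →
      ∃ p : ℂ, p ∈ side F α 1 θ ∧ p + d ∈ side F α (-1) (-(θ + g)) ∧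
      (∀ t : ℝ, ∀ k : ℤ, p + t * d - z ≠ k) ∧ (∀ t : ℝ, ∀ k : ℤ, p + t * d - w ≠ k) := by
    intro p d hp hpd
    have hd0 : d ≠ 0 := by
      rintro rfl
      exact disjoint_left.1 hd (subset_closure hp) (subset_closure (by simpa using hpd))
    obtain ⟨q, h1, h2, h3⟩ := exists_avoiding_line (isOpen_side F α 1 θ)
      (isOpen_side F α (-1) (-(θ + g))) hd0 hp hpd z w
    exact ⟨q, h1, h2, h3⟩
  by_cases hV : ¬ V ∧ ¬ Wide F α g τ θ
  · obtain ⟨hV, hW⟩ := hV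
    simp only [Wide, not_forall, not_le] at hW
    obtain ⟨p, hp, p', hp', hpp⟩ := hW
    obtain ⟨q, h1, h2, h3, h4⟩ := key p (p' - p) hp (by simpa using hp')
    exact ⟨q, p' - p, h1, h2, h3, h4, Or.inr hpp, fun hv => absurd hv hV, fun _ _ => hpp⟩
  · obtain ⟨q, h1, h2, h3, h4⟩ := key ((θ - 1 : ℝ) * I) ((g + 2 : ℝ) * I)
      (half_subset_side (by simp)) (half_subset_side (by simp; linarith))
    have h0 : ((g + 2 : ℝ) * I : ℂ).re = 0 := by simp
    exact ⟨q, (g + 2 : ℝ) * I, h1, h2, h3, h4, Or.inl h0, fun _ => h0,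
      fun a b => absurd ⟨a, b⟩ hV⟩

omit h in
theorem image_side {σ r : ℝ} (j : ℤ) :
    (F ^ j) '' side F α σ r = side F α σ (r + σ * (j * α)) := by
  ext q
  constructor
  · rintro ⟨x, hx, rfl⟩
    exact (side_zpow j).2 hx
  · intro hq
    refine ⟨(F ^ j).symm q, (side_zpow j).1 ?_, by simp⟩
    simpa using hq

omit h in
theorem image_closure_side {σ r : ℝ} (j : ℤ) :
    (F ^ j) '' closure (side F α σ r) = closure (side F α σ (r + σ * (j * α))) := by
  rw [Homeomorph.image_closure, image_side]

omit h in
theorem zpow_succ_apply (k : ℕ) (q : ℂ) :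
    (F ^ ((k + 1 : ℕ) : ℤ)) q = F ((F ^ (k : ℤ)) q) := by
  rw [← Homeomorph.mul_apply, ← zpow_one_add, Nat.cast_succ, add_comm]

end Sys

theorem sum_ite_le (S : Finset ℕ) (P n : ℕ) :
    ∑ k ∈ Finset.range n, (if k ∈ S ∨ k + 1 ∈ S then P else 2) ≤ 2 * n + P * (2 * S.card) := by
  have h1 : ∀ k ∈ Finset.range n, (if k ∈ S ∨ k + 1 ∈ S then P else 2) ≤
      2 + ((if k ∈ S then P else 0) + (if k + 1 ∈ S then P else 0)) := by
    intro k _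
    split_ifs <;> simp_all <;> omega
  refine (Finset.sum_le_sum h1).trans ?_
  rw [Finset.sum_add_distrib, Finset.sum_add_distrib, ← Finset.sum_filter, ← Finset.sum_filter]
  simp only [Finset.sum_const, Finset.card_range, smul_eq_mul]
  have h2 : ((Finset.range n).filter (· ∈ S)).card ≤ S.card :=
    Finset.card_le_card fun k hk => (Finset.mem_filter.1 hk).2
  have h3 : ((Finset.range n).filter (· + 1 ∈ S)).card ≤ S.card :=
    Finset.card_le_card_of_injOn (· + 1) (fun k hk => (Finset.mem_filter.1 hk).2)
      fun a _ b _ hab => by simpa using hab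
  nlinarith [Nat.mul_le_mul_right P h2, Nat.mul_le_mul_right P h3]

namespace Sys

variable {F : ℂ ≃ₜ ℂ} {α M E : ℝ} (h : Sys F α M E)
include h

theorem exists_arcs {θ g τ : ℝ} (hτ' : τ ≤ 1 / 4)
    (hd : ∀ θ, Disjoint (closure (side F α 1 θ)) (closure (side F α (-1) (-(θ + g)))))
    (z w : ℂ) (n : ℕ) (S : Finset ℕ)
    (hS : ∀ k ≤ n, k = 0 ∨ k = n ∨ Wide F α g τ (θ + k * α) → k ∈ S) :
    ∃ (N : ℕ) (κ : ℕ → ℝ → ℂ) (p : ℕ → ℂ), ∀ k ≤ n,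
      IsArc ((F ^ (k : ℤ)) z) ((F ^ (k : ℤ)) w) ((F ^ (k : ℤ)) '' core F α 1 θ N)
        ((F ^ (k : ℤ)) '' core F α (-1) (-(θ + g)) N) (κ k) ∧
      (∀ t ∈ Icc (0:ℝ) 1, (κ k t).re ∈ Icc ((p k).re - 1 / 4) ((p k).re - 1 / 4 + 1 / 2)) ∧
      (k ∉ S → ∀ t ∈ Icc (0:ℝ) 1, ‖κ k t - p k‖ < τ) ∧
      (k = 0 ∨ k = n → (∀ t ∈ Icc (0:ℝ) 1, (κ k t).re = (p k).re) ∧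
        (∀ m : ℤ, (p k).re - ((F ^ (k : ℤ)) z).re ≠ m) ∧
        ∀ m : ℤ, (p k).re - ((F ^ (k : ℤ)) w).re ≠ m) := by
  have hex := fun k : ℕ => h.exists_line (τ := τ) (hd (θ + k * α)) (k = 0 ∨ k = n)
    ((F ^ (k : ℤ)) z) ((F ^ (k : ℤ)) w)
  choose p d hp hpd hz hw hre hV hW using hex
  have hcore : ∃ N : ℕ, ∀ k ∈ Finset.range (n + 1), (F ^ (k : ℤ)).symm (p k) ∈ core F α 1 θ N ∧
      (F ^ (k : ℤ)).symm (p k + d k) ∈ core F α (-1) (-(θ + g)) N := by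
    refine Eventually.exists (f := atTop) ((Filter.eventually_all_finset _).2 fun k _ => ?_)
    refine (eventually_mem_core ((side_zpow k).1 ?_)).and (eventually_mem_core ((side_zpow k).1 ?_))
    · simpa using hp k
    · have := hpd k
      rw [Homeomorph.apply_symm_apply]
      convert this using 2
      push_cast
      ring
  obtain ⟨N, hN⟩ := hcore
  have hdisj : ∀ k : ℕ, Disjoint ((F ^ (k : ℤ)) '' core F α 1 θ N)
      ((F ^ (k : ℤ)) '' core F α (-1) (-(θ + g)) N) := fun k =>
    (disjoint_image_iff (F ^ (k : ℤ)).injective).2 ((hd θ).mono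
      ((core_subset_side _ _ _ _ _).trans subset_closure)
      ((core_subset_side _ _ _ _ _).trans subset_closure))
  have hdre : ∀ k, |(d k).re| ≤ 1 / 4 := by
    intro k
    rcases hre k with h0 | h0
    · rw [h0]; norm_num
    · linarith [abs_re_le_norm (d k)]
  have hκ : ∀ k : ℕ, ∃ κ : ℝ → ℂ, k ≤ n →
      IsArc ((F ^ (k : ℤ)) z) ((F ^ (k : ℤ)) w) ((F ^ (k : ℤ)) '' core F α 1 θ N)
        ((F ^ (k : ℤ)) '' core F α (-1) (-(θ + g)) N) κ ∧
      ∀ t ∈ Icc (0:ℝ) 1, ∃ t' ∈ Icc (0:ℝ) 1, κ t = p k + t' * d k := by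
    intro k
    by_cases hk : k ≤ n
    · obtain ⟨h1, h2⟩ := hN k (Finset.mem_range.2 (by omega))
      obtain ⟨κ, hκ⟩ := exists_isArc_of_segment
        ((F ^ (k : ℤ)).isClosedMap _ (isClosed_core F α 1 θ N))
        ((F ^ (k : ℤ)).isClosedMap _ (isClosed_core F α (-1) (-(θ + g)) N)) (hdisj k)
        ⟨_, h1, by simp⟩ ⟨_, h2, by simp⟩ (lt_of_le_of_lt (hdre k) (by norm_num)) (hz k) (hw k)
      exact ⟨κ, fun _ => hκ⟩
    · exact ⟨0, fun hk' => absurd hk' hk⟩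
  choose κ hκ using hκ
  refine ⟨N, κ, p, fun k hk => ⟨(hκ k hk).1, fun t ht => ?_, fun hkS t ht => ?_, fun hkn => ?_⟩⟩
  · obtain ⟨t', ht', he⟩ := (hκ k hk).2 t ht
    have h1 : |t' * (d k).re| ≤ 1 / 4 := by
      rw [abs_mul, abs_of_nonneg ht'.1]
      nlinarith [hdre k, ht'.2, abs_nonneg (d k).re]
    have h2 : (κ k t).re = (p k).re + t' * (d k).re := by simp [he]
    rw [h2]
    constructor <;> linarith [(abs_le.1 h1).1, (abs_le.1 h1).2]
  · obtain ⟨t', ht', he⟩ := (hκ k hk).2 t ht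
    have h1 : ‖d k‖ < τ := hW k (fun hv => hkS (hS k hk (by tauto))) fun hv => hkS (hS k hk (by tauto))
    rw [he, add_sub_cancel_left, norm_mul, norm_real, Real.norm_of_nonneg ht'.1]
    nlinarith [ht'.2, norm_nonneg (d k)]
  · have h0 := hV k hkn
    have him : (d k).im ≠ 0 := by
      intro h1
      have hd0 : d k = 0 := Complex.ext h0 h1
      refine disjoint_left.1 (hd (θ + k * α)) (subset_closure (hp k)) (subset_closure ?_)
      simpa [hd0] using hpd k
    have key : ∀ x : ℂ, (∀ t : ℝ, ∀ m : ℤ, p k + t * d k - x ≠ m) → ∀ m : ℤ, (p k).re - x.re ≠ m := by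
      intro x hx m hm
      refine hx ((x.im - (p k).im) / (d k).im) m (Complex.ext ?_ ?_)
      · simp [h0, hm]
      · simp only [sub_im, add_im, mul_im, ofReal_re, ofReal_im, intCast_im]
        field_simp
        ring
    refine ⟨fun t ht => ?_, key _ (hz k), key _ (hw k)⟩
    obtain ⟨t', ht', he⟩ := (hκ k hk).2 t ht
    simp [he, h0]

theorem orbit_degree {θ g τ C : ℝ} (hτ' : τ ≤ 1 / 4)
    (hu : ∀ q q', ‖q - q'‖ < τ → ‖F q - F q'‖ ≤ 1 / 8)
    (hd : ∀ θ, Disjoint (closure (side F α 1 θ)) (closure (side F α (-1) (-(θ + g)))))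
    {P : ℕ} (hP : 2 * E + 2 < P) {z w : ℂ} (hzw : ∀ k : ℤ, z - w ≠ k) (n : ℕ) (S : Finset ℕ)
    (hS : ∀ k ≤ n, k = 0 ∨ k = n ∨ Wide F α g τ (θ + k * α) → k ∈ S)
    (h0 : Pair F α θ (θ + g) C z w)
    (hn : Pair F α (θ + n * α) (θ + n * α + g) C ((F ^ (n : ℤ)) z) ((F ^ (n : ℤ)) w)) :
    |(((F ^ (n : ℤ)) z).re - ((F ^ (n : ℤ)) w).re) - (z.re - w.re)| ≤
      2 * n + P * (2 * S.card) + 2 * (2 + C) := by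
  obtain ⟨N, κ, p, hκ⟩ := h.exists_arcs hτ' hd z w n S hS
  have hs : (-1 : ℝ) * -1 = 1 := by norm_num
  have hE : 0 ≤ E := (norm_nonneg _).trans (h.disp 0)
  have hP0 : P ≠ 0 := by
    rintro rfl
    norm_num at hP
    linarith
  have hdisp := h.isDisp
  have hF := h.re_per
  have ezero : ∀ q, (F ^ ((0:ℕ) : ℤ)) q = q := fun q => rfl
  have iszero : ∀ U : Set ℂ, (F ^ ((0:ℕ) : ℤ)) '' U = U := fun U => by
    ext q; simp
  have imsucc : ∀ (k : ℕ) (U : Set ℂ), (F ^ ((k + 1 : ℕ) : ℤ)) '' U = F '' ((F ^ (k : ℤ)) '' U) := by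
    intro k U
    rw [image_image]
    exact image_congr fun q _ => zpow_succ_apply k q
  set A : ℕ → Set ℂ := fun k => (F ^ (k : ℤ)) '' closure (side F α 1 θ) with hA
  set B : ℕ → Set ℂ := fun k => (F ^ (k : ℤ)) '' closure (side F α (-1) (-(θ + g))) with hB
  have hA' : ∀ k, A k = closure (side F α 1 (θ + k * α)) := fun k => by
    rw [hA]; simp only [image_closure_side]; simp
  have hB' : ∀ k, B k = closure (side F α (-1) (-(θ + k * α + g))) := fun k => by
    rw [hB]; simp only [image_closure_side]; push_cast; ring_nf
  have farA : ∀ (k : ℕ) (x : ℂ), Far F α 1 θ x → Far F α 1 (θ + k * α) ((F ^ (k : ℤ)) x) :=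
    fun k x hx => by simpa using h.far_zpow (one_mul 1) hx k
  have farB : ∀ (k : ℕ) (x : ℂ), Far F α (-1) (-(θ + g)) x →
      Far F α (-1) (-(θ + k * α + g)) ((F ^ (k : ℤ)) x) := fun k x hx => by
    have := h.far_zpow hs hx k
    convert this using 1
    push_cast; ring
  have invk : ∀ (k : ℕ) (U : Set ℂ), (∀ q ∈ U, ∀ m : ℤ, q + m ∈ U) →
      ∀ q ∈ (F ^ (k : ℤ)) '' U, ∀ m : ℤ, q + m ∈ (F ^ (k : ℤ)) '' U := by
    rintro k U hU _ ⟨q, hq, rfl⟩ m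
    exact ⟨q + m, hU q hq m, h.zpow_add_int _ _ _⟩
  have hcA : core F α 1 θ N ⊆ closure (side F α 1 θ) :=
    (core_subset_side _ _ _ _ _).trans subset_closure
  have hcB : core F α (-1) (-(θ + g)) N ⊆ closure (side F α (-1) (-(θ + g))) :=
    (core_subset_side _ _ _ _ _).trans subset_closure
  obtain ⟨GX, hGX, hGXb⟩ := h0.logX
  obtain ⟨GY, hGY, hGYb⟩ := h0.logY
  obtain ⟨GX₁, hGX₁, hGXb₁⟩ := hn.logX
  obtain ⟨GY₁, hGY₁, hGYb₁⟩ := hn.logY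
  have arc0 := (hκ 0 (Nat.zero_le n)).1
  rw [iszero, iszero, ezero, ezero] at arc0
  obtain ⟨d, hdeg⟩ := arc0.exists_isDeg one_ne_zero (GX := GX) (GY := GY)
    (hGX.exp_eq _ (hcA arc0.left)) (hGY.exp_eq _ (hcB arc0.right))
  set pp : ℕ → ℕ := fun k => if k ∈ S ∨ k + 1 ∈ S then P else 2 with hpp
  have hpp0 : ∀ k, pp k ≠ 0 := fun k => by
    simp only [hpp]; split_ifs
    · exact hP0
    · norm_num
  have hdis : ∀ k < n, ∃ j : ℤ, ∀ s ∈ Icc (0:ℝ) 1, ∀ t ∈ Icc (0:ℝ) 1, ∀ m : ℤ,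
      F (κ k s) ≠ κ (k + 1) t + j + m * pp k := by
    intro k hk
    obtain ⟨-, h1, h2, -⟩ := hκ k hk.le
    obtain ⟨-, h1', h2', -⟩ := hκ (k + 1) hk
    simp only [hpp]
    split_ifs with hkS
    · refine exists_avoid_of_width (κ := fun t => F (κ k t)) (κ' := κ (k + 1))
        (a := (p k).re - 1 / 4 - E) (e := 1 / 2 + 2 * E)
        (e' := 1 / 2) (by linarith) (fun t ht => ?_) h1'
      have a1 := h1 t ht
      have a2 := (abs_re_le_norm _).trans (h.disp (κ k t))
      rw [sub_re, abs_le] at a2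
      constructor <;> linarith [a1.1, a1.2, a2.1, a2.2]
    · refine exists_avoid_of_width (κ := fun t => F (κ k t)) (κ' := κ (k + 1))
        (a := (F (p k)).re - 1 / 8) (e := 1 / 4)
        (e' := 1 / 2) (by norm_num) (fun t ht => ?_) h1'
      have a2 := (abs_re_le_norm _).trans (hu _ _ (h2 (fun hc => hkS (Or.inl hc)) t ht))
      rw [sub_re, abs_le] at a2
      constructor <;> linarith [a2.1, a2.2]
  obtain ⟨GX', GY', g1, g2, d', g3, g4⟩ := hdisp.orbit_compare hF
    (z := fun k => (F ^ (k : ℤ)) z) (w := fun k => (F ^ (k : ℤ)) w) (A := A) (B := B)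
    (X := fun k => (F ^ (k : ℤ)) '' core F α 1 θ N)
    (Y := fun k => (F ^ (k : ℤ)) '' core F α (-1) (-(θ + g)) N) (κ := κ) (p := pp) (n := n)
    (fun k => zpow_succ_apply k z) (fun k => zpow_succ_apply k w)
    (fun k => imsucc k _) (fun k => imsucc k _) (fun k => imsucc k _) (fun k => imsucc k _)
    hzw (fun k => by rw [hA']; exact h.isSide _ (one_mul 1)) (fun k => by rw [hB']; exact h.isSide _ hs)
    (fun k => by rw [hA']; exact (farA k z h0.zlow).notMem (one_mul 1))
    (fun k => by rw [hB']; exact (farB k z h0.zup).notMem hs)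
    (fun k => by rw [hA']; exact (farA k w h0.wlow).notMem (one_mul 1))
    (fun k => by rw [hB']; exact (farB k w h0.wup).notMem hs)
    (fun k => image_mono hcA) (fun k => image_mono hcB)
    (fun k => (h.pathConnected_core (one_mul 1) N).image (F ^ (k : ℤ)).continuous)
    (fun k => (h.pathConnected_core hs N).image (F ^ (k : ℤ)).continuous)
    (fun k => invk k _ fun q hq m => h.core_add_int hq m)
    (fun k => invk k _ fun q hq m => h.core_add_int hq m)
    (fun k => (disjoint_image_iff (F ^ (k : ℤ)).injective).2 ((hd θ).mono hcA hcB))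
    hpp0
    (fun k => by
      rw [hA']
      obtain ⟨H, _, hH, _⟩ := h.exists_isLog_of_far (one_mul 1) (farA (k + 1) z h0.zlow)
        (farA (k + 1) w h0.wlow) (hpp0 k)
      exact ⟨H, hH⟩)
    (fun k => by
      rw [hB']
      obtain ⟨H, _, hH, _⟩ := h.exists_isLog_of_far hs (farB (k + 1) z h0.zup)
        (farB (k + 1) w h0.wup) (hpp0 k)
      exact ⟨H, hH⟩)
    (fun k hk => (hκ k hk).1) hdis
    (by simp only [hA, iszero]; exact hGX) (by simp only [hB, iszero]; exact hGY) hdeg n le_rfl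
  obtain ⟨arcn, -, -, hvn⟩ := hκ n le_rfl
  obtain ⟨v1, v2, v3⟩ := hvn (Or.inr rfl)
  obtain ⟨u1, u2, u3⟩ := (hκ 0 (Nat.zero_le n)).2.2.2 (Or.inl rfl)
  rw [ezero] at u2 u3
  rw [hA'] at g1
  rw [hB'] at g2
  have sA := h.isSide (θ + n * α) (one_mul 1)
  have sB := h.isSide (-(θ + n * α + g)) hs
  have eX := g1.unique sA.preconn (sA.EE_ne_zero one_ne_zero (hn.wlow.notMem (one_mul 1))) hGX₁ sA.far
  have eY := g2.unique sB.preconn (sB.EE_ne_zero one_ne_zero (hn.wup.notMem hs)) hGY₁ sB.far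
  have memX : κ n 0 ∈ closure (side F α 1 (θ + n * α)) := by
    rw [← hA']; exact image_mono hcA arcn.left
  have memY : κ n 1 ∈ closure (side F α (-1) (-(θ + n * α + g))) := by
    rw [← hB']; exact image_mono hcB arcn.right
  have b1 := deg_vertical (C := C) hdeg arc0.cont u1 u2 u3 (hGXb _ (hcA arc0.left)) (hGYb _ (hcB arc0.right))
  have b2 := deg_vertical (C := C) g3 arcn.cont v1 v2 v3
    (by rw [eX memX]; exact hGXb₁ _ memX) (by rw [eY memY]; exact hGYb₁ _ memY)
  have b3 : |(d:ℝ) - d'| ≤ 2 * n + P * (2 * S.card) := by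
    have e1 : ∑ i ∈ Finset.range n, (pp i : ℤ) ≤ ((2 * n + P * (2 * S.card) : ℕ) : ℤ) := by
      rw [← Nat.cast_sum]
      exact_mod_cast sum_ite_le S P n
    have e2 : ((|d - d'| : ℤ) : ℝ) ≤ (((2 * n + P * (2 * S.card) : ℕ) : ℤ) : ℝ) :=
      Int.cast_le.2 (g4.trans e1)
    push_cast at e2
    exact e2
  rw [abs_le] at b1 b2 b3 ⊢
  constructor <;> linarith [b1.1, b1.2, b2.1, b2.2, b3.1, b3.2]

end Sys

namespace Sys

variable {F : ℂ ≃ₜ ℂ} {α M E : ℝ} (h : Sys F α M E)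
include h

theorem exists_modulus : ∃ τ : ℝ, 0 < τ ∧ τ ≤ 1 / 4 ∧
    ∀ q q', ‖q - q'‖ < τ → ‖F q - F q'‖ ≤ 1 / 8 := by
  have hK : IsCompact (Icc (-1:ℝ) 2 ×ℂ Icc (-1:ℝ) 2) := isCompact_Icc.reProdIm isCompact_Icc
  have hu := hK.uniformContinuousOn_of_continuous F.continuous.continuousOn
  obtain ⟨τ, h0, hτ⟩ := Metric.uniformContinuousOn_iff.1 hu (1 / 8) (by norm_num)
  refine ⟨min τ (1 / 4), by positivity, min_le_right _ _, fun q q' hq => ?_⟩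
  have h1 : ∀ x : ℂ, F (x + (-⌊q.re⌋ : ℤ) + (-⌊q.im⌋ : ℤ) * I) =
      F x + (-⌊q.re⌋ : ℤ) + (-⌊q.im⌋ : ℤ) * I := fun x => by rw [h.im_per, h.re_per]
  have h2 : F q - F q' = F (q + (-⌊q.re⌋ : ℤ) + (-⌊q.im⌋ : ℤ) * I) -
      F (q' + (-⌊q.re⌋ : ℤ) + (-⌊q.im⌋ : ℤ) * I) := by
    rw [h1, h1]; ring
  rw [h2, ← dist_eq_norm]
  have h3 := abs_re_le_norm (q - q')
  have h4 := abs_im_le_norm (q - q')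
  have h5 := hq.trans_le (min_le_right τ (1 / 4))
  rw [sub_re, abs_le] at h3
  rw [sub_im, abs_le] at h4
  have := Int.floor_le q.re
  have := Int.lt_floor_add_one q.re
  have := Int.floor_le q.im
  have := Int.lt_floor_add_one q.im
  refine (hτ _ ?_ _ ?_ ?_).le
  · simp only [mem_reProdIm, mem_Icc, add_re, add_im, mul_re, mul_im, I_re, I_im, Int.cast_neg]
    refine ⟨⟨?_, ?_⟩, ?_, ?_⟩ <;> simp <;> linarith
  · simp only [mem_reProdIm, mem_Icc, add_re, add_im, mul_re, mul_im, I_re, I_im, Int.cast_neg]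
    refine ⟨⟨?_, ?_⟩, ?_, ?_⟩ <;> simp <;> linarith
  · rw [dist_eq_norm, add_sub_add_right_eq_sub, add_sub_add_right_eq_sub]
    exact hq.trans_le (min_le_left τ (1 / 4))

theorem exists_orbit_bound : ∃ G δ : ℝ, 0 < δ ∧
    (∀ g, G < g → ∀ θ, Disjoint (closure (side F α 1 θ)) (closure (side F α (-1) (-(θ + g))))) ∧
    ∀ C : ℝ, ∃ C' : ℝ, ∀ (n : ℕ) (z w : ℂ) (θ : ℝ), Pair F α θ (θ + (G + 2 * δ)) C z w →
      Pair F α (θ + n * α) (θ + n * α + (G + 2 * δ)) C ((F ^ (n : ℤ)) z) ((F ^ (n : ℤ)) w) →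
      |(((F ^ n) z).re - ((F ^ n) w).re) - (z.re - w.re)| ≤ 3 * n + C' := by
  classical
  obtain ⟨G, hG0, hG1, hG2⟩ := h.exists_gap
  obtain ⟨τ, hτ0, hτ1, hu⟩ := h.exists_modulus
  obtain ⟨Q, hQ⟩ := h.exists_wide_card hτ0 hG0 hG2
  obtain ⟨P, hP⟩ := exists_nat_gt (2 * E + 2)
  set R := 2 * P * Q + 1 with hR
  obtain ⟨δ, hδ0, hδ1, hsep⟩ := exists_sep h.irr R
  refine ⟨G, δ, hδ0, hG1, fun C => ⟨max 0 (P * (2 * (2 + Q)) + 2 * (2 + C)), fun n z w θ h0 hn => ?_⟩⟩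
  by_cases hzw : ∀ k : ℤ, z - w ≠ k
  · set S₁ := (Finset.range (n + 1)).filter fun k : ℕ => Wide F α (G + 2 * δ) τ (θ + k * α) with hS₁
    have hc := h.wide_count (θ := θ) (n := n) (S := S₁) (R := R) (by omega) hδ0 hsep (hQ δ hδ0 hδ1)
      (fun k hk => by simp [hS₁] at hk; omega) (fun k hk => by simp [hS₁] at hk; exact hk.2)
    have h1 := h.orbit_degree hτ1 hu (fun θ => hG1 (G + 2 * δ) (by linarith) θ) hP hzw n
      (insert 0 (insert n S₁)) (fun k hk hk' => by
        rcases hk' with rfl | rfl | hk'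
        · simp
        · simp
        · simp only [Finset.mem_insert, hS₁, Finset.mem_filter, Finset.mem_range]
          right; right; exact ⟨by omega, hk'⟩) h0 hn
    rw [zpow_natCast] at h1
    have h2 : (insert 0 (insert n S₁)).card ≤ 2 + Q * (n / R + 1) := by
      have := Finset.card_insert_le 0 (insert n S₁)
      have := Finset.card_insert_le n S₁
      omega
    have h3 : P * (2 * (insert 0 (insert n S₁)).card) ≤ P * (2 * (2 + Q)) + n := by
      have h4 : R * (n / R) ≤ n := Nat.mul_div_le n R
      calc P * (2 * (insert 0 (insert n S₁)).card) ≤ P * (2 * (2 + Q * (n / R + 1))) := by gcongr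
        _ = P * (2 * (2 + Q)) + 2 * P * Q * (n / R) := by ring
        _ ≤ P * (2 * (2 + Q)) + R * (n / R) := by gcongr; omega
        _ ≤ _ := by omega
    have h5 : (P * (2 * (insert 0 (insert n S₁)).card) : ℝ) ≤ P * (2 * (2 + Q)) + n := by
      exact_mod_cast h3
    have := le_max_right 0 ((P * (2 * (2 + Q)) + 2 * (2 + C) : ℝ))
    linarith
  · push Not at hzw
    obtain ⟨k, hk⟩ := hzw
    have h1 : z = w + k := by rw [← hk]; ring
    have h2 : (F ^ n) z = (F ^ n) w + k := by
      rw [h1]; exact_mod_cast h.zpow_add_int n w k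
    have h3 : |(((F ^ n) z).re - ((F ^ n) w).re) - (z.re - w.re)| = 0 := by
      rw [h2, h1]; simp
    rw [h3]
    positivity

end Sys

namespace IsLog

theorem translate {p : ℕ} {A A' : Set ℂ} {z w : ℂ} {G : ℂ → ℂ} (h : IsLog p A z w G) (c : ℂ)
    (hc : ∀ q ∈ A', q - c ∈ A) : IsLog p A' (z + c) (w + c) (fun q => G (q - c)) where
  cont := h.cont.comp (by fun_prop) hc
  exp_eq q hq := by
    have e : ∀ x, EE p q (x + c) = EE p (q - c) x := fun x => by
      simp only [EE]; congr 2; ring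
    rw [e, e]
    exact h.exp_eq _ (hc q hq)
  bot := by
    have h1 : Tendsto (fun q : ℂ => q - c) (comap im atBot ⊓ 𝓟 A') (comap im atBot ⊓ 𝓟 A) := by
      refine tendsto_inf.2 ⟨tendsto_comap_iff.2 ?_, tendsto_principal.2 ?_⟩
      · have := (tendsto_atBot_add_const_right (comap im atBot) (-c.im)
          (tendsto_comap (f := im) (x := atBot))).mono_left
          (inf_le_left : comap im atBot ⊓ 𝓟 A' ≤ _)
        exact this.congr fun q => by simp [sub_eq_add_neg]
      · exact eventually_inf_principal.2 (Eventually.of_forall hc)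
    have := h.bot.comp h1
    rwa [add_sub_add_right_eq_sub]
  top := by
    have h1 : Tendsto (fun q : ℂ => q - c) (comap im atTop ⊓ 𝓟 A') (comap im atTop ⊓ 𝓟 A) := by
      refine tendsto_inf.2 ⟨tendsto_comap_iff.2 ?_, tendsto_principal.2 ?_⟩
      · have := (tendsto_atTop_add_const_right (comap im atTop) (-c.im)
          (tendsto_comap (f := im) (x := atTop))).mono_left
          (inf_le_left : comap im atTop ⊓ 𝓟 A' ≤ _)
        exact this.congr fun q => by simp [sub_eq_add_neg]
      · exact eventually_inf_principal.2 (Eventually.of_forall hc)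
    exact h.top.comp h1

theorem _root_.TorusRot.EE_one_add_int (q w : ℂ) (k : ℤ) : EE 1 q (w + k) = EE 1 q w := by
  have : (2 * Real.pi * I * (q - w) : ℂ) = 2 * Real.pi * I * (q - (w + k)) + k * (2 * Real.pi * I) := by
    ring
  simp only [EE, ee, Nat.cast_one, div_one, this, exp_add, exp_int_mul_two_pi_mul_I, mul_one]

theorem add_int_of_le {A : Set ℂ} {z w : ℂ} {G : ℂ → ℂ} (h : IsLog 1 A z w G) {c : ℝ}
    (hA : ∀ q ∈ A, q.im ≤ c) (k : ℤ) :
    IsLog 1 A z (w + k) (fun q => G q + k * (2 * Real.pi * I)) where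
  cont := h.cont.add continuousOn_const
  exp_eq q hq := by
    rw [EE_one_add_int, exp_add, exp_int_mul_two_pi_mul_I, mul_one, h.exp_eq q hq]
  bot := by
    have := h.bot.add_const (k * (2 * Real.pi * I) : ℂ)
    convert this using 2
    push_cast; ring
  top := by
    have : comap im atTop ⊓ 𝓟 A = ⊥ := by
      refine inf_principal_eq_bot.2 ⟨Ioi c, Ioi_mem_atTop c, fun q hq hq' => ?_⟩
      exact absurd hq (not_lt.2 (hA q hq'))
    rw [this]; exact tendsto_bot

theorem add_int_of_ge {A : Set ℂ} {z w : ℂ} {G : ℂ → ℂ} (h : IsLog 1 A z w G) {c : ℝ}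
    (hA : ∀ q ∈ A, c ≤ q.im) (k : ℤ) : IsLog 1 A z (w + k) G where
  cont := h.cont
  exp_eq q hq := by rw [EE_one_add_int, h.exp_eq q hq]
  bot := by
    have : comap im atBot ⊓ 𝓟 A = ⊥ := by
      refine inf_principal_eq_bot.2 ⟨Iio c, Iio_mem_atBot c, fun q hq hq' => ?_⟩
      exact absurd hq (not_lt.2 (hA q hq'))
    rw [this]; exact tendsto_bot
  top := h.top

end IsLog

theorem Far.eventually {F : ℂ ≃ₜ ℂ} {α σ r : ℝ} {z₀ : ℂ} (hσ : σ * σ = 1)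
    (h : Far F α σ r z₀) : ∀ᶠ z in 𝓝 z₀, Far F α σ r z := by
  have h1 : IsOpen (closure (side F α σ r))ᶜ := isClosed_closure.isOpen_compl
  filter_upwards [h1.connectedComponentIn.mem_nhds
    (mem_connectedComponentIn (h.notMem hσ))] with z hz
  obtain ⟨B, hB⟩ := h
  exact ⟨B, fun q hq => connectedComponentIn_eq hz ▸ hB q hq⟩

theorem Pair.mono {F : ℂ ≃ₜ ℂ} {α θ s C θ' s' C' : ℝ} {z w : ℂ} (h : Pair F α θ s C z w)
    (hθ : θ' ≤ θ) (hs : s ≤ s') (hC : C ≤ C') : Pair F α θ' s' C' z w where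
  zlow := h.zlow.mono hθ
  wlow := h.wlow.mono hθ
  zup := h.zup.mono (neg_le_neg hs)
  wup := h.wup.mono (neg_le_neg hs)
  logX := by
    obtain ⟨G, hG, hG'⟩ := h.logX
    have := closure_mono (side_mono F α 1 hθ)
    exact ⟨G, hG.mono this, fun q hq => (hG' q (this hq)).trans hC⟩
  logY := by
    obtain ⟨G, hG, hG'⟩ := h.logY
    have := closure_mono (side_mono F α (-1) (neg_le_neg hs))
    exact ⟨G, hG.mono this, fun q hq => (hG' q (this hq)).trans hC⟩

namespace Sys

variable {F : ℂ ≃ₜ ℂ} {α M E : ℝ} (h : Sys F α M E)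
include h

theorem pair_add_int {θ s C : ℝ} {z w : ℂ} (hp : Pair F α θ s C z w) (k : ℤ) :
    Pair F α θ s C z (w + k) where
  zlow := hp.zlow
  wlow := h.far_add_int hp.wlow k
  zup := hp.zup
  wup := h.far_add_int hp.wup k
  logX := by
    obtain ⟨G, hG, hG'⟩ := hp.logX
    refine ⟨_, hG.add_int_of_le (c := θ + M)
      (fun q hq => by simpa using h.le_of_mem_closure_side (one_mul 1) hq) k, fun q hq => ?_⟩
    convert hG' q hq using 2
    simp; ring
  logY := by
    obtain ⟨G, hG, hG'⟩ := hp.logY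
    refine ⟨_, hG.add_int_of_ge (c := s - M) (fun q hq => ?_) k, hG'⟩
    linarith [h.le_of_mem_closure_side (by norm_num : (-1:ℝ) * -1 = 1) hq]

theorem mem_closure_side_sub {σ r : ℝ} {q : ℂ} (a b : ℤ)
    (hq : q ∈ closure (side F α σ (r + σ * b))) : q - (a + b * I) ∈ closure (side F α σ r) := by
  refine map_mem_closure (f := fun z => z - (a + b * I : ℂ)) (by fun_prop) hq fun q hq => ?_
  have := h.side_add_int ((h.side_add_int_I (z := q - b * I) b).1 (by simpa using hq)) (-a)
  convert this using 1
  push_cast; ring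

theorem pair_add {θ s C : ℝ} {z w : ℂ} (hp : Pair F α θ s C z w) (a b : ℤ) :
    Pair F α (θ + b) (s + b) C (z + (a + b * I)) (w + (a + b * I)) := by
  have e1 : θ + 1 * (b:ℝ) = θ + b := by ring
  have e2 : -s + -1 * (b:ℝ) = -(s + b) := by ring
  have f1 : ∀ {x}, Far F α 1 θ x → Far F α 1 (θ + b) (x + (a + b * I)) := fun hx => by
    have := h.far_add_int_I (h.far_add_int hx a) b
    rwa [e1, add_assoc] at this
  have f2 : ∀ {x}, Far F α (-1) (-s) x → Far F α (-1) (-(s + b)) (x + (a + b * I)) := fun hx => by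
    have := h.far_add_int_I (h.far_add_int hx a) b
    rwa [e2, add_assoc] at this
  refine ⟨f1 hp.zlow, f1 hp.wlow, f2 hp.zup, f2 hp.wup, ?_, ?_⟩
  · obtain ⟨G, hG, hG'⟩ := hp.logX
    rw [← e1]
    refine ⟨_, hG.translate (a + b * I) fun q hq => h.mem_closure_side_sub a b hq, fun q hq => ?_⟩
    convert hG' _ (h.mem_closure_side_sub a b hq) using 3
    simp
  · obtain ⟨G, hG, hG'⟩ := hp.logY
    rw [← e2]
    exact ⟨_, hG.translate (a + b * I) fun q hq => h.mem_closure_side_sub a b hq,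
      fun q hq => hG' _ (h.mem_closure_side_sub a b hq)⟩

theorem eventually_pair {G δ : ℝ} (hδ : 0 < δ)
    (hG : ∀ g, G < g → ∀ θ,
      Disjoint (closure (side F α 1 θ)) (closure (side F α (-1) (-(θ + g))))) (z₀ w₀ : ℂ) :
    ∃ (j m : ℤ) (θ C : ℝ), ∀ᶠ x : ℂ × ℂ in 𝓝 (z₀, w₀), x.1.im - (M + δ + 2) ≤ θ ∧
      Pair F α θ (θ + (G + δ)) C x.1 ((F ^ j) x.2 + m * I) := by
  have hs : (-1:ℝ) * -1 = 1 := by norm_num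
  have hs1 : (1:ℝ) * 1 = 1 := one_mul 1
  have hd := hG (G + δ / 4) (by linarith)
  obtain ⟨r, hr1, hr2, hr3, hr4⟩ := h.exists_far (η := δ / 4) (by linarith) hd z₀
  obtain ⟨r', -, -, hr3', hr4'⟩ := h.exists_far (η := δ / 4) (by linarith) hd w₀
  obtain ⟨j, m, hjm⟩ := h.exists_int_mem_Icc (show r - r' < r - r' + δ / 4 by linarith)
  set w₁ := (F ^ j) w₀ + m * I with hw₁
  have a1 : Far F α 1 r w₁ :=
    (h.far_add_int_I (h.far_zpow hs1 hr3' j) m).mono (by linarith [hjm.1])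
  have a2 : Far F α (-1) (-(r + (G + δ))) w₁ :=
    (h.far_add_int_I (h.far_zpow hs hr4' j) m).mono (by linarith [hjm.2])
  have a3 : Far F α (-1) (-(r + (G + δ))) z₀ := hr4.mono (by linarith)
  obtain ⟨GX, CX, hGX, hGX'⟩ := h.exists_isLog_of_far hs1 hr3 a1 one_ne_zero
  obtain ⟨GY, CY, hGY, hGY'⟩ := h.exists_isLog_of_far hs a3 a2 one_ne_zero
  have sA := h.isSide r hs1
  have sB := h.isSide (-(r + (G + δ))) hs
  have hF : Tendsto (fun w : ℂ => (F ^ j) w + m * I) (𝓝 w₀) (𝓝 w₁) :=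
    ((F ^ j).continuous.add continuous_const).continuousAt
  refine ⟨j, m, r, max (CX + 2 * Real.pi + 2 * Real.pi * (|w₁.re - z₀.re| + 2))
    (CY + 2 * Real.pi), ?_⟩
  rw [nhds_prod_eq]
  have hz := ((hr3.eventually hs1).and ((a3.eventually hs).and
    ((eventually_isLog one_ne_zero isClosed_closure sA.inv (hr3.notMem hs1)).and
    ((eventually_isLog one_ne_zero isClosed_closure sB.inv (a3.notMem hs)).and
    (ball_mem_nhds z₀ one_pos)))))
  have hw := hF.eventually ((a1.eventually hs1).and ((a2.eventually hs).and
    ((eventually_isLog one_ne_zero isClosed_closure sA.inv (a1.notMem hs1)).and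
    ((eventually_isLog one_ne_zero isClosed_closure sB.inv (a2.notMem hs)).and
    (ball_mem_nhds w₁ one_pos)))))
  filter_upwards [hz.prod_mk hw] with ⟨z, w⟩ ⟨⟨b1, b2, ⟨L1, b3, b3'⟩, ⟨L2, b4, b4'⟩, b5⟩,
    c1, c2, ⟨L3, c3, c3'⟩, ⟨L4, c4, c4'⟩, c5⟩
  rw [dist_eq_norm] at b5 c5
  dsimp only at b1 b2 b5 c1 c2 c5 ⊢
  have d1 := abs_le.1 ((abs_re_le_norm (z - z₀)).trans b5.le)
  have d2 := abs_le.1 ((abs_im_le_norm (z - z₀)).trans b5.le)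
  have d3 := abs_le.1 ((abs_re_le_norm (((F ^ j) w + m * I) - w₁)).trans c5.le)
  rw [sub_re] at d1 d3
  rw [sub_im] at d2
  refine ⟨by linarith, b1, c1, b2, c2, ⟨_, (b3.trans hGX).trans c3.symm, fun q hq => ?_⟩,
    ⟨_, (b4.trans hGY).trans c4.symm, fun q hq => ?_⟩⟩
  · refine le_trans ?_ (le_max_left _ _)
    have e1 := abs_le.1 (hGX' q hq)
    have e2 := abs_le.1 (b3' q hq)
    have e3 := abs_le.1 (c3' q hq)
    have e4 : |((F ^ j) w + m * I).re - z.re| ≤ |w₁.re - z₀.re| + 2 := by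
      have := abs_le.1 (le_refl |w₁.re - z₀.re|)
      rw [abs_le]; constructor <;> linarith
    have e5 : |2 * Real.pi * (((F ^ j) w + m * I).re - z.re)| ≤
        2 * Real.pi * (|w₁.re - z₀.re| + 2) := by
      rw [abs_mul, abs_of_pos Real.two_pi_pos]
      gcongr
    rw [abs_le] at e5 ⊢
    simp only [add_im (_ + _), neg_im, add_im (L1 q)]
    constructor <;> linarith
  · refine le_trans ?_ (le_max_right _ _)
    have e1 := abs_le.1 (hGY' q hq)
    have e2 := abs_le.1 (b4' q hq)
    have e3 := abs_le.1 (c4' q hq)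
    rw [abs_le]
    simp only [add_im, neg_im]
    constructor <;> linarith

end Sys

/-- A process whose values increase by at most `D` in one step and by at most `C` between visits
to the same state grows by at most `C + D` per state. -/
theorem le_of_finite_states {ι : Type*} [DecidableEq ι] {f : ℕ → ℝ} {c : ℕ → ι} {C D : ℝ}
    (hC : 0 ≤ C) (hD : 0 ≤ D) {n : ℕ} (h1 : ∀ t, f (t + 1) ≤ f t + D)
    (h2 : ∀ s t, s ≤ t → t ≤ n → c s = c t → f t ≤ f s + C) (T : Finset ι) (s : ℕ) (hs : s ≤ n)
    (hT : ∀ t, s ≤ t → t ≤ n → c t ∈ T) : f n ≤ f s + T.card * (C + D) := by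
  induction hk : T.card generalizing T s with
  | zero =>
    have := hT s le_rfl hs
    rw [Finset.card_eq_zero.1 hk] at this
    simp at this
  | succ k ih =>
    set t := Nat.findGreatest (fun t => c t = c s) n with ht
    have ht1 : c t = c s := Nat.findGreatest_spec (P := fun t => c t = c s) hs rfl
    have ht2 : s ≤ t := Nat.le_findGreatest hs rfl
    have ht3 : t ≤ n := Nat.findGreatest_le n
    have h3 := h2 s t ht2 ht3 ht1.symm
    have h4 : 0 ≤ k * (C + D) := by positivity
    push_cast
    rcases ht3.eq_or_lt with h5 | h5
    · rw [h5] at h3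
      linarith
    · have h6 := ih (T.erase (c s)) (t + 1) (by omega) (fun u hu hu' => by
        refine Finset.mem_erase.2 ⟨fun he => ?_, hT u (by omega) hu'⟩
        exact Nat.findGreatest_is_greatest (P := fun t => c t = c s) (by omega) hu' he)
        (by rw [Finset.card_erase_of_mem (hT s le_rfl hs), hk]; rfl)
      linarith [h1 t]

namespace Sys

variable {F : ℂ ≃ₜ ℂ} {α M E : ℝ} (h : Sys F α M E)
include h

theorem exists_pair {G δ : ℝ} (hδ : 0 < δ)
    (hG : ∀ g, G < g → ∀ θ,
      Disjoint (closure (side F α 1 θ)) (closure (side F α (-1) (-(θ + g))))) (B : ℝ) :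
    ∃ (T : Finset (ℤ × ℤ)) (C : ℝ), ∀ z w : ℂ, |z.im - w.im| ≤ B →
      ∃ x ∈ T, ∃ θ, z.im - (M + δ + 2) ≤ θ ∧
        Pair F α θ (θ + (G + δ)) C z ((F ^ x.1) w + x.2 * I) := by
  classical
  have hK : IsCompact ((Icc (0:ℝ) 1 ×ℂ Icc (0:ℝ) 1) ×ˢ (Icc (0:ℝ) 1 ×ℂ Icc (-B) (1 + B))) :=
    (isCompact_Icc.reProdIm isCompact_Icc).prod (isCompact_Icc.reProdIm isCompact_Icc)
  obtain ⟨T, C, hTC⟩ := hK.induction_on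
    (p := fun S : Set (ℂ × ℂ) => ∃ (T : Finset (ℤ × ℤ)) (C : ℝ), ∀ y ∈ S,
      ∃ x ∈ T, ∃ θ, y.1.im - (M + δ + 2) ≤ θ ∧
        Pair F α θ (θ + (G + δ)) C y.1 ((F ^ x.1) y.2 + x.2 * I))
    ⟨∅, 0, by simp⟩ (fun S S' hS ⟨T, C, hT⟩ => ⟨T, C, fun y hy => hT y (hS hy)⟩)
    (fun S S' ⟨T, C, hT⟩ ⟨T', C', hT'⟩ => ⟨T ∪ T', max C C', fun y hy => by
      rcases hy with hy | hy
      · obtain ⟨x, hx, θ, h1, h2⟩ := hT y hy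
        exact ⟨x, Finset.mem_union_left _ hx, θ, h1, h2.mono le_rfl le_rfl (le_max_left _ _)⟩
      · obtain ⟨x, hx, θ, h1, h2⟩ := hT' y hy
        exact ⟨x, Finset.mem_union_right _ hx, θ, h1, h2.mono le_rfl le_rfl (le_max_right _ _)⟩⟩)
    (fun y _ => by
      obtain ⟨j, m, θ, C, hy⟩ := h.eventually_pair hδ hG y.1 y.2
      exact ⟨_, mem_nhdsWithin_of_mem_nhds hy, {(j, m)}, C, fun y' hy' =>
        ⟨(j, m), by simp, θ, hy'.1, hy'.2⟩⟩)
  refine ⟨T, C, fun z w hzw => ?_⟩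
  rw [abs_le] at hzw
  set a := ⌊z.re⌋ with ha
  set b := ⌊z.im⌋ with hb
  set c := ⌊w.re⌋ with hc
  have := Int.floor_le z.re
  have := Int.lt_floor_add_one z.re
  have := Int.floor_le z.im
  have := Int.lt_floor_add_one z.im
  have := Int.floor_le w.re
  have := Int.lt_floor_add_one w.re
  obtain ⟨x, hx, θ, h1, h2⟩ := hTC (z - (a + b * I), w - (c + b * I)) (by
    simp only [mem_prod, mem_reProdIm, mem_Icc, sub_re, add_re, intCast_re, mul_re, I_re, mul_zero,
      intCast_im, I_im, mul_one, sub_im, add_im, mul_im]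
    refine ⟨⟨⟨?_, ?_⟩, ?_, ?_⟩, ⟨?_, ?_⟩, ?_, ?_⟩ <;> simp <;> linarith)
  refine ⟨x, hx, θ + b, ?_, ?_⟩
  · simp at h1
    linarith
  · have h3 := h.pair_add_int (h.pair_add h2 a b) (c - a)
    have h4 : (F ^ x.1) w = (F ^ x.1) (w - (c + b * I)) + c + b * I := by
      rw [← h.zpow_add_int, ← h.zpow_add_int_I]; congr 1; ring
    convert h3 using 1
    · ring
    · simp
    · simp only [h4]; push_cast; ring

theorem norm_pow_sub_le (n : ℕ) (q : ℂ) : ‖(F ^ n) q - q‖ ≤ n * E := by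
  induction n with
  | zero => simp
  | succ n ih =>
    have h1 := h.disp ((F ^ n) q)
    have h2 : (F ^ (n + 1)) q - q = (F ((F ^ n) q) - (F ^ n) q) + ((F ^ n) q - q) := by
      rw [pow_succ']; simp [Homeomorph.mul_apply]
    rw [h2]
    refine (norm_add_le _ _).trans ?_
    push_cast
    linarith

theorem norm_zpow_sub_le (j : ℤ) (q : ℂ) : ‖(F ^ j) q - q‖ ≤ j.natAbs * E := by
  rcases Int.natAbs_eq j with hj | hj
  · have := h.norm_pow_sub_le j.natAbs q
    rwa [← zpow_natCast, ← hj] at this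
  · have := h.norm_pow_sub_le j.natAbs ((F ^ j) q)
    rw [← zpow_natCast, ← Homeomorph.mul_apply, ← zpow_add] at this
    rw [norm_sub_rev]
    have e : (j.natAbs : ℤ) + j = 0 := by omega
    rwa [e, zpow_zero, Homeomorph.one_apply] at this

theorem E_nonneg : 0 ≤ E := (norm_nonneg _).trans (h.disp 0)

/-- Horizontal displacements of orbits cannot separate at a speed exceeding `3`. -/
theorem exists_separation_bound : ∃ K : ℝ, ∀ (n : ℕ) (z w : ℂ), z.im ∈ Icc (0:ℝ) 1 →
    w.im ∈ Icc (0:ℝ) 1 →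
    ((F ^ n) z).re - ((F ^ n) w).re - (z.re - w.re) ≤ 3 * n + K := by
  classical
  obtain ⟨G, δ, hδ, hG, hC⟩ := h.exists_orbit_bound
  obtain ⟨T, C, hT⟩ := h.exists_pair hδ hG (2 * M + 1)
  obtain ⟨C', hC'⟩ := hC C
  obtain ⟨J, hJ⟩ : ∃ J : ℕ, ∀ x ∈ T, x.1.natAbs ≤ J :=
    ⟨T.sup fun x => x.1.natAbs, fun x hx => Finset.le_sup (f := fun x : ℤ × ℤ => x.1.natAbs) hx⟩
  set A := T ×ˢ Finset.Icc ⌊(-(M + δ + 2) - M) / δ⌋ ⌊(1 + M) / δ⌋ with hA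
  refine ⟨A.card * (max 0 (C' + 2 * (J * E)) + 2 * E), fun n z w hz hw => ?_⟩
  have hE := h.E_nonneg
  have key : ∀ k : ℕ, ∃ x ∈ T, ∃ θ, ((F ^ k) z).im - (M + δ + 2) ≤ θ ∧
      Pair F α θ (θ + (G + δ)) C ((F ^ k) z) ((F ^ x.1) ((F ^ k) w) + x.2 * I) := by
    intro k
    refine hT _ _ ?_
    have h1 := abs_le.1 (h.dev k z)
    have h2 := abs_le.1 (h.dev k w)
    rw [zpow_natCast] at h1 h2
    rw [abs_le]
    constructor <;> linarith [hz.1, hz.2, hw.1, hw.2]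
  choose x hx θ hθ hp using key
  set c : ℕ → (ℤ × ℤ) × ℤ := fun k => (x k, ⌊(θ k - k * α) / δ⌋) with hc
  have hcA : ∀ k, c k ∈ A := by
    intro k
    have h1 := abs_le.1 (h.dev k z)
    rw [zpow_natCast] at h1
    have h2 := (hp k).zlow.le (one_mul 1)
    simp only [hA, hc, Finset.mem_product, Finset.mem_Icc]
    push_cast at h1
    exact ⟨hx k, Int.floor_mono (div_le_div_of_nonneg_right (by linarith [hθ k, hz.1]) hδ.le),
      Int.floor_mono (div_le_div_of_nonneg_right (by linarith [hz.2]) hδ.le)⟩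
  have hw' : ∀ k, |((F ^ (x k).1) ((F ^ k) w) + (x k).2 * I).re - ((F ^ k) w).re| ≤ J * E := by
    intro k
    have h1 := (abs_re_le_norm _).trans (h.norm_zpow_sub_le (x k).1 ((F ^ k) w))
    have h2 : ((x k).1.natAbs : ℝ) * E ≤ J * E := by
      gcongr; exact_mod_cast hJ _ (hx k)
    simpa using h1.trans h2
  have main := le_of_finite_states (f := fun k : ℕ => ((F ^ k) z).re - ((F ^ k) w).re - 3 * k)
    (c := c) (C := max 0 (C' + 2 * (J * E))) (D := 2 * E) (n := n) (le_max_left _ _)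
    (by positivity) ?_ ?_ A 0 (Nat.zero_le _) (fun k _ _ => hcA k)
  · simp only [pow_zero, Homeomorph.one_apply, Nat.cast_zero] at main
    linarith
  · intro t
    have h1 := abs_le.1 ((abs_re_le_norm _).trans (h.disp ((F ^ t) z)))
    have h2 := abs_le.1 ((abs_re_le_norm _).trans (h.disp ((F ^ t) w)))
    simp only [pow_succ', Homeomorph.mul_apply, sub_re] at h1 h2 ⊢
    push_cast
    linarith
  · intro s t hst _ hcst
    obtain ⟨d, rfl⟩ := Nat.exists_eq_add_of_le hst
    simp only [hc, Prod.mk.injEq] at hcst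
    obtain ⟨hx1, hx2⟩ := hcst
    set v : ℝ := ⌊(θ s - s * α) / δ⌋ * δ with hv
    have hv1 : ∀ k : ℕ, ⌊(θ s - s * α) / δ⌋ = ⌊(θ k - k * α) / δ⌋ →
        v + k * α ≤ θ k ∧ θ k + (G + δ) ≤ v + k * α + (G + 2 * δ) := by
      intro k hk
      rw [hv, hk]
      have e1 := (le_div_iff₀ hδ).1 (Int.floor_le ((θ k - k * α) / δ))
      have e2 := (div_lt_iff₀ hδ).1 (Int.lt_floor_add_one ((θ k - k * α) / δ))
      constructor <;> linarith
    have p0 := (hp s).mono (hv1 s rfl).1 (hv1 s rfl).2 le_rfl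
    have p1 := (hp (s + d)).mono (hv1 _ hx2).1 (hv1 _ hx2).2 le_rfl
    have e1 : (F ^ (s + d)) z = (F ^ d) ((F ^ s) z) := by
      rw [add_comm, pow_add, Homeomorph.mul_apply]
    have e2 : (F ^ (x (s + d)).1) ((F ^ (s + d)) w) + (x (s + d)).2 * I =
        (F ^ d) ((F ^ (x s).1) ((F ^ s) w) + (x s).2 * I) := by
      have := h.zpow_add_int_I d ((F ^ (x s).1) ((F ^ s) w)) (x s).2
      rw [zpow_natCast] at this
      rw [this, ← hx1]
      congr 1
      simp only [← Homeomorph.mul_apply, ← zpow_natCast, ← zpow_add]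
      congr 2
      push_cast; ring
    have e3 : v + ((s + d : ℕ):ℝ) * α = v + s * α + d * α := by push_cast; ring
    have h1 := hC' d _ _ _ p0 (by
      rw [zpow_natCast, ← e1, ← e2, ← e3]; exact p1)
    rw [← e1, ← e2] at h1
    have h2 := abs_le.1 (hw' s)
    have h3 := abs_le.1 (hw' (s + d))
    have h4 := (abs_le.1 h1).2
    have h5 := le_max_right 0 (C' + 2 * (J * E))
    push_cast
    linarith

end Sys

theorem exists_disp_bound {F : ℂ ≃ₜ ℂ} (h1 : ∀ (q : ℂ) (k : ℤ), F (q + k) = F q + k)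
    (h2 : ∀ (q : ℂ) (k : ℤ), F (q + k * I) = F q + k * I) : ∃ E, ∀ q, ‖F q - q‖ ≤ E := by
  have hK : IsCompact (Icc (0:ℝ) 1 ×ℂ Icc (0:ℝ) 1) := isCompact_Icc.reProdIm isCompact_Icc
  obtain ⟨E, hE⟩ := hK.exists_bound_of_continuousOn (f := fun q => F q - q)
    (F.continuous.sub continuous_id).continuousOn
  refine ⟨E, fun q => ?_⟩
  have h3 : q = q - (⌊q.re⌋ + ⌊q.im⌋ * I) + ⌊q.re⌋ + ⌊q.im⌋ * I := by ring
  have h4 := hE (q - (⌊q.re⌋ + ⌊q.im⌋ * I)) (by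
    simp only [mem_reProdIm, mem_Icc]
    refine ⟨⟨?_, ?_⟩, ?_, ?_⟩ <;> simp [(Int.fract_lt_one _).le])
  have h5 : F q - q = F (q - (⌊q.re⌋ + ⌊q.im⌋ * I)) - (q - (⌊q.re⌋ + ⌊q.im⌋ * I)) := by
    conv_lhs => rw [h3, h2, h1]
    ring
  rw [h5]
  exact h4

namespace Sys

variable {F : ℂ ≃ₜ ℂ} {α M E : ℝ} (h : Sys F α M E)
include h

theorem pow {N : ℕ} (hN : N ≠ 0) : Sys (F ^ N) (N * α) M (N * E) where
  re_per q k := by exact_mod_cast h.zpow_add_int N q k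
  im_per q k := by exact_mod_cast h.zpow_add_int_I N q k
  dev n q := by
    have := h.dev (N * n) q
    rw [zpow_mul, zpow_natCast] at this
    push_cast at this
    convert this using 2
    ring
  irr := h.irr.natCast_mul hN
  disp q := h.norm_pow_sub_le N q

theorem exists_displacement_ge {σ B : ℝ} (hσ : |σ| = 1) {z : ℕ → ℂ} {n : ℕ → ℕ} (hn : StrictMono n)
    (hz : Tendsto (fun i => (n i : ℝ)⁻¹ * (σ * (((F ^ n i) (z i)).re - (z i).re))) atTop (𝓝 B))
    (m : ℕ) : ∃ q, m * B - 1 ≤ σ * (((F ^ m) q).re - q.re) := by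
  by_contra! hlt
  rcases Nat.eq_zero_or_pos m with rfl | hm
  · have := hlt 0
    simp at this
    linarith
  have hm' : (0:ℝ) < m := by exact_mod_cast hm
  have h1 : ∀ (k : ℕ) (q : ℂ), σ * (((F ^ (m * k)) q).re - q.re) ≤ k * (m * B - 1) := by
    intro k q
    induction k with
    | zero => simp
    | succ k ih =>
      have := hlt ((F ^ (m * k)) q)
      have e : (F ^ (m * (k + 1))) q = (F ^ m) ((F ^ (m * k)) q) := by
        rw [mul_add, mul_one, add_comm, pow_add, Homeomorph.mul_apply]
      rw [e]
      push_cast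
      linarith
  have hE := h.E_nonneg
  have h2 : ∀ (k : ℕ) (q : ℂ), σ * (((F ^ k) q).re - q.re) ≤
      k * (B - 1 / m) + (m * (|B - 1 / m| + E)) := by
    intro k q
    have e : (F ^ k) q = (F ^ (k % m)) ((F ^ (m * (k / m))) q) := by
      rw [← Homeomorph.mul_apply, ← pow_add, Nat.mod_add_div]
    have a1 := h1 (k / m) q
    have a2 : σ * (((F ^ (k % m)) ((F ^ (m * (k / m))) q)).re - ((F ^ (m * (k / m))) q).re) ≤
        m * E := by
      refine (le_abs_self _).trans ?_
      rw [abs_mul, hσ, one_mul, ← sub_re]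
      refine (abs_re_le_norm _).trans ((h.norm_pow_sub_le _ _).trans ?_)
      have : ((k % m : ℕ):ℝ) ≤ m := by exact_mod_cast (Nat.mod_lt k hm).le
      gcongr
    rw [← e] at a2
    have a3 : (k:ℝ) = (k % m : ℕ) + m * (k / m : ℕ) := by exact_mod_cast (Nat.mod_add_div k m).symm
    have a4 : -((m:ℝ) * |B - 1 / m|) ≤ (k % m : ℕ) * (B - 1 / m) := by
      have b1 : ((k % m : ℕ):ℝ) ≤ m := by exact_mod_cast (Nat.mod_lt k hm).le
      have b2 : |((k % m : ℕ):ℝ) * (B - 1 / m)| ≤ m * |B - 1 / m| := by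
        rw [abs_mul, Nat.abs_cast]; gcongr
      exact (abs_le.1 b2).1
    have a5 : ((k / m : ℕ):ℝ) * (m * B - 1) = m * (k / m : ℕ) * (B - 1 / m) := by
      field_simp
    rw [a3, add_mul, ← a5]
    linarith
  have h3 : Tendsto (fun i => (B - 1 / m) + (n i : ℝ)⁻¹ * (m * (|B - 1 / m| + E))) atTop
      (𝓝 ((B - 1 / m) + 0 * (m * (|B - 1 / m| + E)))) :=
    ((tendsto_inv_atTop_zero.comp
      (tendsto_natCast_atTop_atTop.comp hn.tendsto_atTop)).mul_const _).const_add _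
  have h4 := le_of_tendsto_of_tendsto hz h3 (by
    filter_upwards [eventually_gt_atTop 0] with i hi
    have hpos : (0:ℝ) < n i := by exact_mod_cast (Nat.zero_le _).trans_lt (hn hi)
    have := mul_le_mul_of_nonneg_left (h2 (n i) (z i)) (inv_nonneg.2 hpos.le)
    rwa [mul_add, ← mul_assoc _ (n i : ℝ) (B - 1 / m), inv_mul_cancel₀ hpos.ne', one_mul] at this)
  have : (0:ℝ) < 1 / m := by positivity
  linarith

theorem rotation_le {a b : ℝ} {z w : ℕ → ℂ} {m n : ℕ → ℕ} (hm : StrictMono m) (hn : StrictMono n)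
    (ha : Tendsto (fun i => (m i : ℝ)⁻¹ * (((F ^ m i) (z i)).re - (z i).re)) atTop (𝓝 a))
    (hb : Tendsto (fun i => (n i : ℝ)⁻¹ * (((F ^ n i) (w i)).re - (w i).re)) atTop (𝓝 b)) :
    b ≤ a := by
  by_contra! hab
  obtain ⟨N, hN⟩ := exists_nat_gt (10 / (b - a))
  rw [div_lt_iff₀ (sub_pos.2 hab)] at hN
  have hN0 : N ≠ 0 := by rintro rfl; norm_num at hN
  obtain ⟨K, hK⟩ := (h.pow hN0).exists_separation_bound
  obtain ⟨k, hk⟩ := exists_nat_gt (K + 2)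
  obtain ⟨x, hx⟩ := h.exists_displacement_ge (σ := 1) (by simp) hn (by simpa using hb) (N * k)
  obtain ⟨y, hy⟩ := h.exists_displacement_ge (σ := -1) (B := -a) (by simp) hm
    (ha.neg.congr fun i => by ring) (N * k)
  have e : ∀ q : ℂ, (q - ⌊q.im⌋ * I).im ∈ Icc (0:ℝ) 1 ∧
      ((F ^ N) ^ k) (q - ⌊q.im⌋ * I) = (F ^ (N * k)) q - ⌊q.im⌋ * I := by
    intro q
    refine ⟨⟨by simp, by simp [(Int.fract_lt_one _).le]⟩, ?_⟩
    have := h.zpow_add_int_I (N * k : ℕ) q (-⌊q.im⌋)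
    rw [zpow_natCast] at this
    rw [← pow_mul]
    simpa [sub_eq_add_neg] using this
  have h1 := hK k (x - ⌊x.im⌋ * I) (y - ⌊y.im⌋ * I) (e x).1 (e y).1
  rw [(e x).2, (e y).2] at h1
  simp only [sub_re, mul_re, intCast_re, I_re, mul_zero, intCast_im, I_im, mul_one, sub_self,
    sub_zero] at h1
  push_cast at hx hy
  have h2 : (10:ℝ) * k ≤ N * (b - a) * k := by gcongr
  linarith

end Sys

/-- The linear isomorphism with matrix rows `(s, t)` and `(-d, c)`. -/
def unimodular (c d s t : ℝ) (h : s * c + t * d = 1) : ℝ × ℝ ≃ₜ ℂ where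
  toFun x := (s * x.1 + t * x.2 : ℝ) + (-d * x.1 + c * x.2 : ℝ) * I
  invFun q := (c * q.re - t * q.im, d * q.re + s * q.im)
  left_inv x := by
    ext
    · simp; linear_combination x.1 * h
    · simp; linear_combination x.2 * h
  right_inv q := by
    apply Complex.ext
    · simp; linear_combination q.re * h
    · simp; linear_combination q.im * h
  continuous_toFun := by fun_prop
  continuous_invFun := by fun_prop

section Conjugate

variable {c d s t : ℝ} (h : s * c + t * d = 1)

theorem unimodular_re (x : R2) : (unimodular c d s t h x).re = s * x.1 + t * x.2 := by
  simp [unimodular]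

theorem unimodular_im (x : R2) : (unimodular c d s t h x).im = -d * x.1 + c * x.2 := by
  simp [unimodular]

theorem unimodular_add (x y : R2) :
    unimodular c d s t h (x + y) = unimodular c d s t h x + unimodular c d s t h y := by
  apply Complex.ext <;> simp only [add_re, add_im, unimodular_re, unimodular_im, Prod.fst_add,
    Prod.snd_add] <;> ring

/-- The map `F` read in the coordinates given by `unimodular`. -/
def conj (F : R2 ≃ₜ R2) : ℂ ≃ₜ ℂ := (unimodular c d s t h).symm.trans (F.trans (unimodular c d s t h))

theorem conj_apply (F : R2 ≃ₜ R2) (x : R2) :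
    conj h F (unimodular c d s t h x) = unimodular c d s t h (F x) := by
  simp [conj]

theorem conj_pow_apply (F : R2 ≃ₜ R2) (n : ℕ) (x : R2) :
    (conj h F ^ n) (unimodular c d s t h x) = unimodular c d s t h (F^[n] x) := by
  induction n with
  | zero => simp
  | succ n ih =>
    rw [pow_succ', Homeomorph.mul_apply, ih, conj_apply, Function.iterate_succ_apply']

theorem conj_add {F : R2 ≃ₜ R2} {y : R2} (hy : ∀ x, F (x + y) = F x + y) (q : ℂ) :
    conj h F (q + unimodular c d s t h y) = conj h F q + unimodular c d s t h y := by
  obtain ⟨x, rfl⟩ := (unimodular c d s t h).surjective q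
  rw [← unimodular_add, conj_apply, conj_apply, hy, unimodular_add]

theorem tendsto_conj {F : R2 ≃ₜ R2} {w : R2} (hw : w ∈ rotSet F) :
    ∃ (z : ℕ → ℂ) (n : ℕ → ℕ), StrictMono n ∧
      Tendsto (fun i => (n i : ℝ)⁻¹ * (((conj h F ^ n i) (z i)).re - (z i).re)) atTop
        (𝓝 (s * w.1 + t * w.2)) := by
  obtain ⟨x, n, hn, hx⟩ := hw
  refine ⟨fun i => unimodular c d s t h (x i), n, hn, ?_⟩
  have h1 : Continuous fun y : R2 => s * y.1 + t * y.2 := by fun_prop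
  refine ((h1.tendsto w).comp hx).congr fun i => ?_
  simp only [Function.comp, conj_pow_apply, unimodular_re, Prod.smul_fst, Prod.smul_snd,
    Prod.fst_sub, Prod.snd_sub, smul_eq_mul]
  ring

end Conjugate

theorem abs_zpow_im_le {F : ℂ ≃ₜ ℂ} {α M : ℝ}
    (h : ∀ (n : ℕ) q, |((F ^ n) q).im - q.im - n * α| ≤ M) (n : ℤ) (q : ℂ) :
    |((F ^ n) q).im - q.im - n * α| ≤ M := by
  obtain ⟨k, rfl | rfl⟩ := n.eq_nat_or_neg
  · simpa using h k q
  · have h1 := h k ((F ^ (-(k:ℤ))) q)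
    rw [← zpow_natCast, ← Homeomorph.mul_apply, ← zpow_add, add_neg_cancel, zpow_zero,
      Homeomorph.one_apply, abs_sub_comm] at h1
    convert h1 using 2
    push_cast; ring

theorem exists_lt_infDist
    (F : R2 ≃ₜ R2)
    (hF : ∀ (x : R2) (v : ℤ × ℤ), F (x + ((v.1 : ℝ), (v.2 : ℝ))) = F x + ((v.1 : ℝ), (v.2 : ℝ)))
    (a b p : R2) (v : ℤ × ℤ) (hv : v ≠ 0) (hab : a ≠ b)
    (hseg : rotSet ⇑F = segment ℝ a b)
    (hline : ∀ w ∈ rotSet ⇑F, ∃ l : ℝ, w = p + l • (((v.1 : ℝ), (v.2 : ℝ)) : R2))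
    (hirr : ∀ w ∈ rotSet ⇑F, ¬ ∃ q r : ℚ, w = (((q : ℝ), (r : ℝ)) : R2))
    (u : R2) (hu : dotp u u = 1) (huv : dotp u (((v.1 : ℝ), (v.2 : ℝ)) : R2) = 0) :
    ∀ M : ℝ, ∃ (x : R2) (n : ℕ),
      M < Metric.infDist (dotp ((⇑F)^[n] x - x) u)
        ((fun w => (n : ℝ) * dotp w u) '' rotSet ⇑F) := by
  intro M
  by_contra! hM
  have hg : 0 < Int.gcd v.1 v.2 := Int.gcd_pos_iff.2 (by
    by_contra! h0
    exact hv (Prod.ext h0.1 h0.2))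
  obtain ⟨c, d, hcd, hv1, hv2⟩ := Int.exists_gcd_one hg
  obtain ⟨s, t, hst⟩ := Int.isCoprime_iff_gcd_eq_one.2 hcd
  set g := Int.gcd v.1 v.2
  have hst' : (s:ℝ) * c + t * d = 1 := by exact_mod_cast hst
  have hv1' : (v.1:ℝ) = c * g := by exact_mod_cast hv1
  have hv2' : (v.2:ℝ) = d * g := by exact_mod_cast hv2
  have hg' : (g:ℝ) ≠ 0 := by exact_mod_cast hg.ne'
  set L := unimodular (c:ℝ) d s t hst' with hL
  set κ : ℝ := -d * u.1 + c * u.2 with hκ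
  simp only [dotp] at hu huv hM
  have huv' : u.1 * c + u.2 * d = 0 := by
    rw [hv1', hv2'] at huv
    exact mul_right_cancel₀ hg' (by linear_combination huv)
  have hY : ∀ x : R2, (L x).im = κ * (x.1 * u.1 + x.2 * u.2) := by
    intro x
    have e1 : κ * u.1 = -d := by rw [hκ]; linear_combination -(d:ℝ) * hu + u.2 * huv'
    have e2 : κ * u.2 = c := by rw [hκ]; linear_combination (c:ℝ) * hu - u.1 * huv'
    rw [hL, unimodular_im, ← e1, ← e2]; ring
  set α := (L p).im with hα
  have hrot : ∀ w ∈ rotSet F, (L w).im = α := by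
    intro w hw
    obtain ⟨l, rfl⟩ := hline w hw
    rw [hL, unimodular_add, add_im, ← hL, ← hα, hL, unimodular_im]
    simp only [Prod.smul_fst, Prod.smul_snd, smul_eq_mul]
    rw [hv1', hv2']; ring
  have ha : a ∈ rotSet F := hseg ▸ left_mem_segment ℝ a b
  have hb : b ∈ rotSet F := hseg ▸ right_mem_segment ℝ a b
  have hab' : (L a).re ≠ (L b).re := fun he =>
    hab (L.injective (Complex.ext he ((hrot a ha).trans (hrot b hb).symm)))
  have hαirr : Irrational α := by
    rintro ⟨y, hy⟩
    obtain ⟨x, hx⟩ : ∃ x : ℚ, (x:ℝ) ∈ uIcc (L a).re (L b).re := by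
      rcases hab'.lt_or_gt with hlt | hlt
      · obtain ⟨x, h1, h2⟩ := exists_rat_btwn hlt
        exact ⟨x, Icc_subset_uIcc ⟨h1.le, h2.le⟩⟩
      · obtain ⟨x, h1, h2⟩ := exists_rat_btwn hlt
        exact ⟨x, Icc_subset_uIcc' ⟨h1.le, h2.le⟩⟩
    rw [← segment_eq_uIcc] at hx
    obtain ⟨l, l', hl, hl', hll, hx⟩ := hx
    refine hirr (l • a + l' • b) (hseg ▸ ⟨l, l', hl, hl', hll, rfl⟩)
      ⟨c * x - t * y, d * x + s * y, L.injective ?_⟩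
    have h1 : L (l • a + l' • b) = x + y * I := by
      apply Complex.ext
      · rw [hL, unimodular_re, unimodular_re] at hx
        rw [hL, unimodular_re]
        simp at hx ⊢
        rw [← hx]; ring
      · have e1 := hrot a ha
        have e2 := hrot b hb
        rw [hL, unimodular_im] at e1 e2 ⊢
        simp
        rw [hy]
        linear_combination l * e1 + l' * e2 + α * hll
    rw [h1]
    apply Complex.ext
    · rw [hL, unimodular_re]
      simp
      linear_combination -(x:ℝ) * hst'
    · rw [hL, unimodular_im]
      simp
      linear_combination -(y:ℝ) * hst'
  have hper : ∀ (q : ℂ) (k l : ℤ), conj hst' F (q + (k + l * I)) = conj hst' F q + (k + l * I) := by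
    intro q k l
    have h1 : (k + l * I : ℂ) = L (((c * k - t * l : ℤ) : ℝ), ((d * k + s * l : ℤ) : ℝ)) := by
      apply Complex.ext
      · rw [hL, unimodular_re]
        simp
        linear_combination -(k:ℝ) * hst'
      · rw [hL, unimodular_im]
        simp
        linear_combination -(l:ℝ) * hst'
    rw [h1]
    exact conj_add hst' (fun x => hF x (c * k - t * l, d * k + s * l)) q
  have hre : ∀ (q : ℂ) (k : ℤ), conj hst' F (q + k) = conj hst' F q + k := by
    intro q k
    simpa using hper q k 0
  have him : ∀ (q : ℂ) (k : ℤ), conj hst' F (q + k * I) = conj hst' F q + k * I := by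
    intro q k
    simpa using hper q 0 k
  obtain ⟨E, hE⟩ := exists_disp_bound hre him
  have hdev : ∀ (n : ℕ) q, |((conj hst' F ^ n) q).im - q.im - n * α| ≤ |κ| * (M + 1) := by
    intro n q
    obtain ⟨x, rfl⟩ := L.surjective q
    obtain ⟨_, ⟨w, hw, rfl⟩, hy⟩ := (Metric.infDist_lt_iff (Nonempty.image _ ⟨a, ha⟩)).1
      ((hM x n).trans_lt (lt_add_one M))
    have hw' := hrot w hw
    rw [hY] at hw'
    rw [hL, conj_pow_apply, ← hL, hY, hY, ← hw']
    rw [Real.dist_eq] at hy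
    refine le_of_eq_of_le ?_ (mul_le_mul_of_nonneg_left hy.le (abs_nonneg κ))
    rw [← abs_mul]
    congr 1
    simp only [Prod.fst_sub, Prod.snd_sub]
    ring
  have hS : Sys (conj hst' F) α (|κ| * (M + 1)) E := ⟨hre, him, abs_zpow_im_le hdev, hαirr, hE⟩
  obtain ⟨z, m, hm, hz⟩ := tendsto_conj hst' ha
  obtain ⟨w, n, hn, hw⟩ := tendsto_conj hst' hb
  have h1 := hS.rotation_le hm hn hz hw
  have h2 := hS.rotation_le hn hm hw hz
  rw [hL, unimodular_re, unimodular_re] at hab'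
  exact hab' (le_antisymm h2 h1)

end TorusRot

/-- If `f` is a torus homeomorphism homotopic to the identity (encoded by its lift
`F`, a homeomorphism of the plane commuting with integer translations) whose
rotation set is a nondegenerate line segment of rational slope (contained in a
line of direction `v ∈ ℤ² ∖ {0}`) containing no rational point, then `f` has
infinite perpendicular deviation: for a unit vector `u ⊥ v`, the distances
d(pr_⊥(n·ρ(F)), pr_⊥(Fⁿ(x) − x)) are unbounded over x ∈ ℝ², n ∈ ℕ. -/
theorem franks_misiurewicz_rational_counterexample_infinite_perpendicular_deviation
    (F : R2 ≃ₜ R2)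
    (hF : ∀ (x : R2) (v : ℤ × ℤ), F (x + ((v.1 : ℝ), (v.2 : ℝ))) = F x + ((v.1 : ℝ), (v.2 : ℝ)))
    (a b p : R2) (v : ℤ × ℤ) (hv : v ≠ 0) (hab : a ≠ b)
    (hseg : rotSet ⇑F = segment ℝ a b)
    (hline : ∀ w ∈ rotSet ⇑F, ∃ l : ℝ, w = p + l • (((v.1 : ℝ), (v.2 : ℝ)) : R2))
    (hirr : ∀ w ∈ rotSet ⇑F, ¬ ∃ q r : ℚ, w = (((q : ℝ), (r : ℝ)) : R2))
    (u : R2) (hu : dotp u u = 1) (huv : dotp u (((v.1 : ℝ), (v.2 : ℝ)) : R2) = 0) :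
    ∀ M : ℝ, ∃ (x : R2) (n : ℕ),
      M < Metric.infDist (dotp ((⇑F)^[n] x - x) u)
        ((fun w => (n : ℝ) * dotp w u) '' rotSet ⇑F) :=
  TorusRot.exists_lt_infDist F hF a b p v hv hab hseg hline hirr u hu huv
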